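/- arXiv:1708.06379 — 3 statements merged into one kernel-verified Lean document; each statement's English description precedes it below -/
import Mathlib

section
/- Let G be a nilpotent subgroup of Homeo(T²). Then there exists a finite-index normal subgroup H of G containing G₀ such that for every φ ∈ G₀ and every lift φ̃ of φ one has {ρ_μ(φ̃) : μ ∈ P(φ)} = {ρ_ν(φ̃) : ν ∈ P(H)}. In particular, the set I_G of irrotational elements of G is a normal subgroup of G; moreover, if G = G₀ then I_G = G_I. -/
open MeasureTheory Set

noncomputable section

/-- The group of self-homeomorphisms of a topological space. -/
noncomputable instance homeoGroup {X : Type*} [TopologicalSpace X] : Group (X ≃ₜ X) where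
  mul f g := g.trans f
  one := Homeomorph.refl X
  inv := Homeomorph.symm
  mul_assoc _ _ _ := Homeomorph.ext fun _ => rfl
  one_mul _ := Homeomorph.ext fun _ => rfl
  mul_one _ := Homeomorph.ext fun _ => rfl
  inv_mul_cancel f := Homeomorph.ext f.symm_apply_apply

/-- The 2-torus ℝ²/ℤ². -/
abbrev T2 : Type := AddCircle (1 : ℝ) × AddCircle (1 : ℝ)

/-- The universal covering map π : ℝ² → T². -/
def torusProj (p : ℝ × ℝ) : T2 := (↑p.1, ↑p.2)

/-- `F : ℝ² → ℝ²` is a (continuous) lift of `f : T² → T²` to the universal covering. -/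
def IsLift (f : T2 → T2) (F : ℝ × ℝ → ℝ × ℝ) : Prop :=
  Continuous F ∧ ∀ p, torusProj (F p) = f (torusProj p)

/-- `f` is isotopic to the identity relative to the set `K`:
there is a continuous family of homeomorphisms from the identity to `f`,
each fixing `K` pointwise. -/
def IsotopicToIdRel {X : Type*} [TopologicalSpace X] (f : X → X) (K : Set X) : Prop :=
  ∃ F : ℝ → X → X, Continuous (fun q : ℝ × X => F q.1 q.2) ∧
    (∀ t, IsHomeomorph (F t)) ∧ F 0 = id ∧ F 1 = f ∧
    ∀ t, ∀ x ∈ K, F t x = x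

/-- `f` is (C⁰-)isotopic to the identity. -/
def IsotopicToId {X : Type*} [TopologicalSpace X] (f : X → X) : Prop :=
  IsotopicToIdRel f (∅ : Set X)

/-- A homeomorphism of the torus is a C¹ diffeomorphism if it and its inverse
admit C¹ lifts to the universal covering. -/
def IsDiff1 (f : T2 ≃ₜ T2) : Prop :=
  (∃ F, IsLift (⇑f) F ∧ ContDiff ℝ 1 F) ∧ (∃ F, IsLift (⇑f.symm) F ∧ ContDiff ℝ 1 F)

/-- Membership in Diff¹₀(T²): a C¹ diffeomorphism isotopic to the identity. -/
def InDiff10 (f : T2 ≃ₜ T2) : Prop := IsDiff1 f ∧ IsotopicToId (⇑f)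

/-- The support of a measure: points all whose neighbourhoods have positive measure. -/
def measSupport {X : Type*} [TopologicalSpace X] [MeasurableSpace X] (μ : Measure X) :
    Set X := {x | ∀ U ∈ nhds x, μ U ≠ 0}

/-- The rotation vector of the lift `F` with respect to the measure `μ` is `v`:
the displacement `F - Id` descends to a continuous map `g` on the torus and
`∫ g dμ = v`. -/
def HasRotVec (F : ℝ × ℝ → ℝ × ℝ) (μ : Measure T2) (v : ℝ × ℝ) : Prop :=
  ∃ g : C(T2, ℝ × ℝ), (∀ p : ℝ × ℝ, g (torusProj p) = F p - p) ∧ (∫ x, g x ∂μ) = v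

/-- `φ` is irrotational: it is isotopic to the identity and has a lift whose
rotation vector vanishes for every `φ`-invariant Borel probability measure. -/
def IsIrrotational (φ : T2 ≃ₜ T2) : Prop :=
  IsotopicToId (⇑φ) ∧ ∃ F, IsLift (⇑φ) F ∧
    ∀ μ : Measure T2, IsProbabilityMeasure μ → MeasurePreserving (⇑φ) μ μ →
      HasRotVec F μ (0, 0)

/-- `φ` is irrotational with respect to all measures invariant by every element of `S`. -/
def IsIrrotationalFor (φ : T2 ≃ₜ T2) (S : Set (T2 ≃ₜ T2)) : Prop :=
  IsotopicToId (⇑φ) ∧ ∃ F, IsLift (⇑φ) F ∧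
    ∀ μ : Measure T2, IsProbabilityMeasure μ → (∀ ψ ∈ S, MeasurePreserving (⇑ψ) μ μ) →
      HasRotVec F μ (0, 0)

/-- `A ∈ GL(2,ℤ)` is the mapping class of `f`: some lift `F` of `f` satisfies
`F(p + v) = F(p) + Av` for every `v ∈ ℤ²`. -/
def HasMCG (f : T2 → T2) (A : GL (Fin 2) ℤ) : Prop :=
  ∃ F, IsLift f F ∧ ∀ (p : ℝ × ℝ) (m n : ℤ),
    F (p.1 + (m : ℝ), p.2 + (n : ℝ)) =
      ((F p).1 + ((((A : Matrix (Fin 2) (Fin 2) ℤ) 0 0) * m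
        + ((A : Matrix (Fin 2) (Fin 2) ℤ) 0 1) * n : ℤ) : ℝ),
       (F p).2 + ((((A : Matrix (Fin 2) (Fin 2) ℤ) 1 0) * m
        + ((A : Matrix (Fin 2) (Fin 2) ℤ) 1 1) * n : ℤ) : ℝ))

/-- `f` is orientation preserving iff its mapping class has determinant 1. -/
def OrientationPreserving (f : T2 → T2) : Prop :=
  ∃ A : GL (Fin 2) ℤ, HasMCG f A ∧ (A : Matrix (Fin 2) (Fin 2) ℤ).det = 1

end

namespace TorusNil

/-- the integer vector `(m, n)` in the plane -/
def iv (m n : ℤ) : ℝ × ℝ := ((m : ℝ), (n : ℝ))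

/-- the linear action of an integer matrix on the plane -/
noncomputable def act (A : Matrix (Fin 2) (Fin 2) ℤ) : (ℝ × ℝ) →L[ℝ] (ℝ × ℝ) :=
  ContinuousLinearMap.prod
    ((A 0 0 : ℝ) • ContinuousLinearMap.fst ℝ ℝ ℝ + (A 0 1 : ℝ) • ContinuousLinearMap.snd ℝ ℝ ℝ)
    ((A 1 0 : ℝ) • ContinuousLinearMap.fst ℝ ℝ ℝ + (A 1 1 : ℝ) • ContinuousLinearMap.snd ℝ ℝ ℝ)

lemma act_apply (A : Matrix (Fin 2) (Fin 2) ℤ) (p : ℝ × ℝ) :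
    act A p = ((A 0 0 : ℝ) * p.1 + (A 0 1 : ℝ) * p.2, (A 1 0 : ℝ) * p.1 + (A 1 1 : ℝ) * p.2) := by
  simp [act]

lemma act_one (p : ℝ × ℝ) : act 1 p = p := by
  simp [act_apply]

lemma act_mul (A B : Matrix (Fin 2) (Fin 2) ℤ) (p : ℝ × ℝ) : act (A * B) p = act A (act B p) := by
  simp only [act_apply, Matrix.mul_apply, Fin.sum_univ_two]
  ext <;> push_cast <;> ring

lemma act_iv (A : Matrix (Fin 2) (Fin 2) ℤ) (m n : ℤ) :
    act A (iv m n) = iv (A 0 0 * m + A 0 1 * n) (A 1 0 * m + A 1 1 * n) := by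
  simp [act_apply, iv]

lemma iv_zero : iv 0 0 = 0 := by simp [iv]

/-- equivariance of a lift with respect to the deck group -/
def Equivar (F : ℝ × ℝ → ℝ × ℝ) (A : Matrix (Fin 2) (Fin 2) ℤ) : Prop :=
  ∀ p m n, F (p + iv m n) = F p + act A (iv m n)

lemma proj_add (p q : ℝ × ℝ) : torusProj (p + q) = torusProj p + torusProj q := rfl

lemma proj_sub (p q : ℝ × ℝ) : torusProj (p - q) = torusProj p - torusProj q := rfl

lemma proj_iv (m n : ℤ) : torusProj (iv m n) = 0 := by
  have h : ∀ k : ℤ, (((k : ℝ)) : AddCircle (1 : ℝ)) = 0 := fun k => by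
    rw [AddCircle.coe_eq_zero_iff]; exact ⟨k, by simp⟩
  simp [torusProj, iv, h]

lemma proj_eq_zero {p : ℝ × ℝ} (h : torusProj p = 0) : ∃ m n, p = iv m n := by
  have h1 := congrArg Prod.fst h
  have h2 := congrArg Prod.snd h
  simp only [torusProj, Prod.fst_zero, Prod.snd_zero, AddCircle.coe_eq_zero_iff] at h1 h2
  obtain ⟨m, hm⟩ := h1
  obtain ⟨n, hn⟩ := h2
  exact ⟨m, n, by ext <;> simp [iv, ← hm, ← hn]⟩

lemma proj_surj : Function.Surjective torusProj := by
  rintro ⟨a, b⟩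
  obtain ⟨x, rfl⟩ := QuotientAddGroup.mk_surjective a
  obtain ⟨y, rfl⟩ := QuotientAddGroup.mk_surjective b
  exact ⟨(x, y), rfl⟩

lemma proj_cont : Continuous torusProj :=
  (continuous_quotient_mk'.comp continuous_fst).prodMk (continuous_quotient_mk'.comp continuous_snd)

lemma proj_quot : Topology.IsQuotientMap torusProj := by
  have h : IsOpenMap torusProj :=
    IsOpenMap.prodMap (QuotientAddGroup.isOpenMap_coe) (QuotientAddGroup.isOpenMap_coe)
  exact h.isQuotientMap proj_cont proj_surj

lemma const_real {X : Type*} [TopologicalSpace X] [PreconnectedSpace X] [Nonempty X]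
    (u : X → ℝ) (hu : Continuous u) (h : ∀ x, ∃ m : ℤ, u x = m) : ∃ m : ℤ, ∀ x, u x = m := by
  obtain ⟨x0⟩ := ‹Nonempty X›
  obtain ⟨m, hm⟩ := h x0
  refine ⟨m, fun x => ?_⟩
  choose v hv using h
  have hv' : Continuous v := by
    rw [Int.isClosedEmbedding_coe_real.isEmbedding.continuous_iff]
    convert hu using 1
    ext x; simp [hv]
  have := PreconnectedSpace.constant ‹_› hv' (x := x) (y := x0)
  rw [hv x, this, ← hv, hm]

lemma const_iv {X : Type*} [TopologicalSpace X] [PreconnectedSpace X] [Nonempty X]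
    (u : X → ℝ × ℝ) (hu : Continuous u) (h : ∀ x, torusProj (u x) = 0) :
    ∃ m n : ℤ, ∀ x, u x = iv m n := by
  have h' := fun x => proj_eq_zero (h x)
  obtain ⟨m, hm⟩ := const_real (fun x => (u x).1) (by fun_prop) (fun x => by
    obtain ⟨m, n, e⟩ := h' x; exact ⟨m, by rw [e]; rfl⟩)
  obtain ⟨n, hn⟩ := const_real (fun x => (u x).2) (by fun_prop) (fun x => by
    obtain ⟨m, n, e⟩ := h' x; exact ⟨n, by rw [e]; rfl⟩)
  exact ⟨m, n, fun x => Prod.ext (hm x) (hn x)⟩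

lemma exists_lift_circle {Y : Type*} [TopologicalSpace Y] [SimplyConnectedSpace Y]
    [LocallyPathConnectedSpace Y] (f : C(Y, AddCircle (1 : ℝ))) :
    ∃ F : C(Y, ℝ), ∀ y, ((F y : ℝ) : AddCircle (1 : ℝ)) = f y := by
  obtain ⟨y0⟩ : Nonempty Y := inferInstance
  obtain ⟨e, he⟩ := QuotientAddGroup.mk_surjective (f y0)
  obtain ⟨F, ⟨-, hF⟩, -⟩ :=
    (AddCircle.isCoveringMap_coe (1 : ℝ)).existsUnique_continuousMap_lifts f y0 e he
  exact ⟨F, fun y => congrFun hF y⟩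

lemma exists_lift_gen {Y : Type*} [TopologicalSpace Y] [SimplyConnectedSpace Y]
    [LocallyPathConnectedSpace Y] (f : Y → T2) (hf : Continuous f) :
    ∃ F : Y → ℝ × ℝ, Continuous F ∧ ∀ y, torusProj (F y) = f y := by
  obtain ⟨F, hF⟩ := exists_lift_circle ⟨fun y => (f y).1, by fun_prop⟩
  obtain ⟨F', hF'⟩ := exists_lift_circle ⟨fun y => (f y).2, by fun_prop⟩
  exact ⟨fun y => (F y, F' y), by fun_prop, fun y => Prod.ext (hF y) (hF' y)⟩

lemma exists_lift (f : T2 ≃ₜ T2) : ∃ F, IsLift (⇑f) F := by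
  obtain ⟨F, h1, h2⟩ := exists_lift_gen (fun p : ℝ × ℝ => f (torusProj p))
    (f.continuous.comp proj_cont)
  exact ⟨F, h1, h2⟩

lemma lift_diff {f : T2 → T2} {F F' : ℝ × ℝ → ℝ × ℝ} (h : IsLift f F) (h' : IsLift f F') :
    ∃ m n, ∀ p, F' p = F p + iv m n := by
  obtain ⟨m, n, hmn⟩ := const_iv (fun p => F' p - F p) (h'.1.sub h.1) (fun p => by
    rw [proj_sub, h.2, h'.2, sub_self])
  exact ⟨m, n, fun p => by rw [← hmn p]; abel⟩

lemma lift_trans {f : T2 → T2} {F : ℝ × ℝ → ℝ × ℝ} (h : IsLift f F) (m n : ℤ) :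
    ∃ a b, ∀ p, F (p + iv m n) = F p + iv a b := by
  have hc := h.1
  refine lift_diff h ⟨by fun_prop, fun p => ?_⟩
  rw [h.2, proj_add, proj_iv, add_zero]

lemma lift_equivar {f : T2 → T2} {F : ℝ × ℝ → ℝ × ℝ} (h : IsLift f F) : ∃ A, Equivar F A := by
  obtain ⟨a, c, h1⟩ := lift_trans h 1 0
  obtain ⟨b, d, h2⟩ := lift_trans h 0 1
  have e1 : ∀ (m : ℤ) p, F (p + iv m 0) = F p + (m : ℝ) • iv a c := by
    intro m
    induction m with
    | zero => intro p; simp [iv_zero]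
    | succ k ih =>
      intro p
      have : p + iv (k + 1) 0 = (p + iv k 0) + iv 1 0 := by simp [iv, add_assoc]
      rw [this, h1, ih]; push_cast; rw [add_smul, one_smul, add_assoc]
    | pred k ih =>
      intro p
      have e : p + iv (-k) 0 = (p + iv (-k - 1) 0) + iv 1 0 := by simp [iv, add_assoc]
      have := h1 (p + iv (-k - 1) 0)
      rw [← e, ih] at this
      rw [← sub_eq_iff_eq_add.2 this]; push_cast; rw [sub_smul, one_smul]; abel
  have e2 : ∀ (m : ℤ) p, F (p + iv 0 m) = F p + (m : ℝ) • iv b d := by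
    intro m
    induction m with
    | zero => intro p; simp [iv_zero]
    | succ k ih =>
      intro p
      have : p + iv 0 (k + 1) = (p + iv 0 k) + iv 0 1 := by simp [iv, add_assoc]
      rw [this, h2, ih]; push_cast; rw [add_smul, one_smul, add_assoc]
    | pred k ih =>
      intro p
      have e : p + iv 0 (-k) = (p + iv 0 (-k - 1)) + iv 0 1 := by simp [iv, add_assoc]
      have := h2 (p + iv 0 (-k - 1))
      rw [← e, ih] at this
      rw [← sub_eq_iff_eq_add.2 this]; push_cast; rw [sub_smul, one_smul]; abel
  refine ⟨!![a, b; c, d], fun p m n => ?_⟩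
  have : p + iv m n = (p + iv m 0) + iv 0 n := by simp [iv, add_assoc]
  rw [this, e2, e1, act_apply]
  ext <;> simp [iv] <;> ring

lemma equivar_unique {f : T2 → T2} {F F' : ℝ × ℝ → ℝ × ℝ} (h : IsLift f F) (h' : IsLift f F')
    {A A' : Matrix (Fin 2) (Fin 2) ℤ} (hA : Equivar F A) (hA' : Equivar F' A') : A = A' := by
  obtain ⟨m, n, hd⟩ := lift_diff h h'
  have key : ∀ a b, act A (iv a b) = act A' (iv a b) := by
    intro a b
    have e1 := hA 0 a b
    have e2 := hA' 0 a b
    rw [hd, hd, e1] at e2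
    have : act A (iv a b) + (F 0 + iv m n) = act A' (iv a b) + (F 0 + iv m n) := by
      rw [add_comm (act A' _), ← e2]; abel
    exact add_right_cancel this
  have k1 := key 1 0
  have k2 := key 0 1
  simp only [act_apply, iv, Prod.mk.injEq] at k1 k2
  norm_num at k1 k2
  ext i j; fin_cases i <;> fin_cases j <;> simp [k1, k2]

lemma exists_mcg (f : T2 ≃ₜ T2) : ∃ A, ∀ F, IsLift (⇑f) F → Equivar F A := by
  obtain ⟨F, hF⟩ := exists_lift f
  obtain ⟨A, hA⟩ := lift_equivar hF
  refine ⟨A, fun F' hF' => ?_⟩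
  obtain ⟨A', hA'⟩ := lift_equivar hF'
  rwa [equivar_unique hF hF' hA hA']

/-- the mapping class -/
noncomputable def mcg (f : T2 ≃ₜ T2) : Matrix (Fin 2) (Fin 2) ℤ := (exists_mcg f).choose

lemma mcg_spec {f : T2 ≃ₜ T2} {F : ℝ × ℝ → ℝ × ℝ} (hF : IsLift (⇑f) F) : Equivar F (mcg f) :=
  (exists_mcg f).choose_spec F hF

lemma mcg_eq {f : T2 ≃ₜ T2} {F : ℝ × ℝ → ℝ × ℝ} (hF : IsLift (⇑f) F)
    {A : Matrix (Fin 2) (Fin 2) ℤ} (h : Equivar F A) : mcg f = A :=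
  equivar_unique hF hF (mcg_spec hF) h

lemma lift_mul {f g : T2 ≃ₜ T2} {F F' : ℝ × ℝ → ℝ × ℝ} (hF : IsLift (⇑f) F)
    (hF' : IsLift (⇑g) F') : IsLift (⇑(f * g)) (F ∘ F') :=
  ⟨hF.1.comp hF'.1, fun p => by
    show torusProj (F (F' p)) = f (g (torusProj p)); rw [hF.2, hF'.2]⟩

lemma lift_one : IsLift (⇑(1 : T2 ≃ₜ T2)) id := ⟨continuous_id, fun _ => rfl⟩

lemma mcg_one : mcg 1 = 1 := mcg_eq lift_one (fun p m n => by simp [act_one])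

lemma mcg_mul (f g : T2 ≃ₜ T2) : mcg (f * g) = mcg f * mcg g := by
  obtain ⟨F, hF⟩ := exists_lift f
  obtain ⟨F', hF'⟩ := exists_lift g
  refine mcg_eq (lift_mul hF hF') (fun p m n => ?_)
  simp only [Function.comp]
  rw [mcg_spec hF' p m n, act_iv, mcg_spec hF, act_mul, act_iv (mcg g)]

lemma mcg_isotopic {f : T2 ≃ₜ T2} (h : IsotopicToId (⇑f)) : mcg f = 1 := by
  obtain ⟨I, hI, -, h0, h1, -⟩ := h
  obtain ⟨L, hL, hL'⟩ := exists_lift_gen (fun q : ℝ × (ℝ × ℝ) => I q.1 (torusProj q.2))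
    (hI.comp (continuous_fst.prodMk (proj_cont.comp continuous_snd)))
  have l1 : IsLift (⇑f) (fun p => L (1, p)) := ⟨by fun_prop, fun p => by rw [hL', h1]⟩
  have l0 : IsLift (⇑(1 : T2 ≃ₜ T2)) (fun p => L (0, p)) :=
    ⟨by fun_prop, fun p => by rw [hL', h0]; rfl⟩
  refine mcg_eq l1 (fun p m n => ?_)
  obtain ⟨a, b, hab⟩ := const_iv (fun t : ℝ => L (t, p + iv m n) - L (t, p)) (by fun_prop)
    (fun t => by rw [proj_sub, hL', hL', proj_add, proj_iv, add_zero, sub_self])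
  have := mcg_spec l0 p m n
  rw [mcg_one] at this
  have e1 := hab 1
  have e0 := hab 0
  rw [sub_eq_iff_eq_add] at e1 e0
  simp only at this ⊢
  rw [e1]
  rw [e0, add_comm] at this
  rw [← add_left_cancel this, add_comm]

/-- a periodic function on the plane viewed as a function on the torus -/
noncomputable def desc (u : ℝ × ℝ → ℝ × ℝ) : T2 → ℝ × ℝ := fun x => u (Function.surjInv proj_surj x)

lemma desc_proj {u : ℝ × ℝ → ℝ × ℝ} (hu : ∀ p m n, u (p + iv m n) = u p) (p : ℝ × ℝ) :
    desc u (torusProj p) = u p := by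
  have h : torusProj (Function.surjInv proj_surj (torusProj p) - p) = 0 := by
    rw [proj_sub, Function.surjInv_eq proj_surj, sub_self]
  obtain ⟨m, n, e⟩ := proj_eq_zero h
  rw [sub_eq_iff_eq_add, add_comm] at e
  unfold desc
  rw [e, hu]

lemma desc_cont {u : ℝ × ℝ → ℝ × ℝ} (hc : Continuous u) (hu : ∀ p m n, u (p + iv m n) = u p) :
    Continuous (desc u) := by
  rw [proj_quot.continuous_iff]
  convert hc using 1
  ext1 p; exact desc_proj hu p

lemma cont_integrable {E : Type*} [NormedAddCommGroup E] [NormedSpace ℝ E]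
    [SecondCountableTopologyEither T2 E] {g : T2 → E} (hg : Continuous g)
    (μ : Measure T2) [IsFiniteMeasure μ] : Integrable g μ :=
  hg.integrable_of_hasCompactSupport (HasCompactSupport.of_compactSpace g)

/-- the displacement of a lift -/
noncomputable def disp (F : ℝ × ℝ → ℝ × ℝ) : T2 → ℝ × ℝ := desc (fun p => F p - p)

/-- `F` is a lift of a map in the trivial mapping class. -/
def Lift1 (f : T2 ≃ₜ T2) (F : ℝ × ℝ → ℝ × ℝ) : Prop := IsLift (⇑f) F ∧ Equivar F 1

lemma disp_proj {f : T2 ≃ₜ T2} {F : ℝ × ℝ → ℝ × ℝ} (h : Lift1 f F) (p : ℝ × ℝ) :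
    disp F (torusProj p) = F p - p := by
  unfold disp
  rw [desc_proj]
  intro p m n
  rw [h.2, act_one]; abel

lemma disp_cont {f : T2 ≃ₜ T2} {F : ℝ × ℝ → ℝ × ℝ} (h : Lift1 f F) : Continuous (disp F) := by
  have := h.1.1
  refine desc_cont (by fun_prop) ?_
  intro p m n
  rw [h.2, act_one]; abel

/-- rotation vector -/
noncomputable def rot (F : ℝ × ℝ → ℝ × ℝ) (μ : Measure T2) : ℝ × ℝ := ∫ x, disp F x ∂μ

lemma hasRotVec_iff {f : T2 ≃ₜ T2} {F : ℝ × ℝ → ℝ × ℝ} (h : Lift1 f F) (μ : Measure T2)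
    (v : ℝ × ℝ) : HasRotVec F μ v ↔ rot F μ = v := by
  constructor
  · rintro ⟨g, hg, rfl⟩
    unfold rot
    congr 1
    ext1 x
    obtain ⟨p, rfl⟩ := proj_surj x
    rw [hg, disp_proj h]
  · intro e
    exact ⟨⟨disp F, disp_cont h⟩, disp_proj h, e⟩

lemma rot_bound {f : T2 ≃ₜ T2} {F : ℝ × ℝ → ℝ × ℝ} (h : Lift1 f F) :
    ∃ C : ℝ, ∀ μ : Measure T2, IsProbabilityMeasure μ → ‖rot F μ‖ ≤ C := by
  let g : C(T2, ℝ × ℝ) := ⟨disp F, disp_cont h⟩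
  refine ⟨‖g‖, fun μ hμ => ?_⟩
  have := norm_integral_le_of_norm_le_const (μ := μ) (f := disp F) (C := ‖g‖)
    (Filter.Eventually.of_forall fun x => g.norm_coe_le_norm x)
  simpa [rot] using this

lemma rot_comp {f g : T2 ≃ₜ T2} {F F' : ℝ × ℝ → ℝ × ℝ} (h : Lift1 f F) (h' : Lift1 g F')
    {μ : Measure T2} [IsProbabilityMeasure μ] (hμ : MeasurePreserving (⇑g) μ μ)
    (h'' : Lift1 (f * g) (F ∘ F')) : rot (F ∘ F') μ = rot F μ + rot F' μ := by
  unfold rot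
  have e : disp (F ∘ F') = fun x => disp F (g x) + disp F' x := by
    ext1 x
    obtain ⟨p, rfl⟩ := proj_surj x
    rw [disp_proj h'', disp_proj h', ← h'.1.2, disp_proj h]
    simp
  have i1 : Integrable (fun x => disp F (g x)) μ :=
    cont_integrable ((disp_cont h).comp g.continuous) μ
  rw [e, integral_add i1 (cont_integrable (disp_cont h') μ)]
  congr 1
  exact hμ.integral_comp g.measurableEmbedding (disp F)

lemma rot_add_const {f : T2 ≃ₜ T2} {F : ℝ × ℝ → ℝ × ℝ} (h : Lift1 f F) (m n : ℤ) :
    Lift1 f (fun p => F p + iv m n) ∧ ∀ μ : Measure T2, IsProbabilityMeasure μ →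
      rot (fun p => F p + iv m n) μ = rot F μ + iv m n := by
  have hc := h.1.1
  have h' : Lift1 f (fun p => F p + iv m n) :=
    ⟨⟨by fun_prop, fun p => by rw [proj_add, proj_iv, add_zero, h.1.2]⟩,
      fun p a b => by simp only [h.2 p a b]; abel⟩
  refine ⟨h', fun μ hμ => ?_⟩
  have e : disp (fun p => F p + iv m n) = fun x => disp F x + iv m n := by
    ext1 x
    obtain ⟨p, rfl⟩ := proj_surj x
    rw [disp_proj h', disp_proj h]; abel
  unfold rot
  rw [e, integral_add (cont_integrable (disp_cont h) μ) (integrable_const _)]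
  simp

lemma rot_conj {f f' g : T2 ≃ₜ T2} {F F' Γ : ℝ × ℝ → ℝ × ℝ} (h : Lift1 f F) (h' : Lift1 f' F')
    (hg : IsLift (⇑g) Γ) {μ : Measure T2} [IsProbabilityMeasure μ]
    (hμ : MeasurePreserving (⇑f) μ μ) (w : ℝ × ℝ) (hw : ∀ p, F' (Γ p) = Γ (F p) + w) :
    rot F' (μ.map g) = act (mcg g) (rot F μ) + w := by
  have hA := mcg_spec hg
  have hc := hg.1
  set u : ℝ × ℝ → ℝ × ℝ := fun p => Γ p - act (mcg g) p with hu
  have huc : Continuous u := by fun_prop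
  have hup : ∀ p m n, u (p + iv m n) = u p := by
    intro p m n
    simp only [hu]; rw [hA, map_add]; abel
  have hdc := desc_cont huc hup
  have e : ∀ x, disp F' (g x) = act (mcg g) (disp F x) + (desc u (f x) - desc u x) + w := by
    intro x
    obtain ⟨p, rfl⟩ := proj_surj x
    rw [← hg.2, disp_proj h', disp_proj h, ← h.1.2, desc_proj hup, desc_proj hup, hw, map_sub]
    simp only [hu]
    abel
  unfold rot
  rw [integral_map g.measurable.aemeasurable (disp_cont h').aestronglyMeasurable]
  simp_rw [e]
  have i1 : Integrable (fun x => act (mcg g) (disp F x)) μ :=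
    cont_integrable ((act (mcg g)).continuous.comp (disp_cont h)) μ
  have i2 : Integrable (fun x => desc u (f x)) μ := cont_integrable (hdc.comp f.continuous) μ
  have i3 : Integrable (fun x => desc u x) μ := cont_integrable hdc μ
  have i4 : ∫ x, desc u (f x) ∂μ = ∫ x, desc u x ∂μ :=
    hμ.integral_comp f.measurableEmbedding (desc u)
  have i5 : Integrable (fun x => desc u (f x) - desc u x) μ := i2.sub i3
  have i6 : Integrable (fun x => act (mcg g) (disp F x) + (desc u (f x) - desc u x)) μ :=
    i1.add i5
  rw [integral_add i6 (integrable_const _), integral_add i1 i5,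
    integral_sub i2 i3, i4, sub_self, add_zero,
    ContinuousLinearMap.integral_comp_comm _ (cont_integrable (disp_cont h) μ)]
  simp

/-- bounded two-sided orbits of the linear map are fixed points -/
lemma bdd_fixed (A : Matrix (Fin 2) (Fin 2) ℤ) (B : Matrix (Fin 2) (Fin 2) ℤ)
    (hB : ∀ i j, A i j = (1 : Matrix (Fin 2) (Fin 2) ℤ) i j + 3 * B i j) (hdet : A.det = 1 ∨ A.det = -1) (d : ℤ → ℝ × ℝ)
    (hd : ∀ n, d (n + 1) = act A (d n)) (C : ℝ) (hC : ∀ n, ‖d n‖ ≤ C) (n : ℤ) :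
    d (n + 1) = d n := by
  have a00 : A 0 0 = 1 + 3 * B 0 0 := by rw [hB]; simp
  have a01 : A 0 1 = 3 * B 0 1 := by rw [hB]; simp
  have a10 : A 1 0 = 3 * B 1 0 := by rw [hB]; simp
  have a11 : A 1 1 = 1 + 3 * B 1 1 := by rw [hB]; simp
  rw [Matrix.det_fin_two] at hdet
  have hdet1 : A 0 0 * A 1 1 - A 0 1 * A 1 0 = 1 := by
    rcases hdet with h | h
    · exact h
    · exfalso
      rw [a00, a01, a10, a11] at h
      ring_nf at h
      omega
  set t := A 0 0 + A 1 1 with ht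
  have ht9 : ∃ k : ℤ, t = 2 - 9 * k := by
    refine ⟨B 0 0 * B 1 1 - B 0 1 * B 1 0, ?_⟩
    have h := hdet1
    rw [a00, a01, a10, a11] at h
    rw [ht, a00, a11]
    linarith
  have hdetR : (A 0 0 : ℝ) * A 1 1 - A 0 1 * A 1 0 = 1 := by exact_mod_cast hdet1
  have hch : ∀ n, d (n + 1 + 1) + d n = (t : ℝ) • d (n + 1) := by
    intro n
    rw [hd (n + 1), hd n, ht]
    simp only [act_apply]
    ext
    · simp only [Prod.fst_add, Prod.smul_fst, smul_eq_mul]; push_cast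
      linear_combination (-(d n).1) * hdetR
    · simp only [Prod.snd_add, Prod.smul_snd, smul_eq_mul]; push_cast
      linear_combination (-(d n).2) * hdetR
  by_cases h2 : t = 2
  · -- arithmetic progression
    have hstep : ∀ n, d (n + 1 + 1) - d (n + 1) = d (n + 1) - d n := by
      intro n
      have := hch n
      rw [h2] at this
      push_cast at this
      rw [two_smul] at this
      rw [sub_eq_sub_iff_add_eq_add, this]
    have hlin : ∀ k : ℕ, d (n + k) = d n + (k : ℝ) • (d (n + 1) - d n) ∧
        d (n + k + 1) - d (n + k) = d (n + 1) - d n := by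
      intro k
      induction k with
      | zero => simp
      | succ k ih =>
        have h3 := hstep (n + k)
        push_cast
        rw [← add_assoc]
        refine ⟨?_, by rw [h3, ih.2]⟩
        rw [add_smul, one_smul, ← add_assoc, ← ih.1]
        rw [← ih.2]; abel
    by_contra hne
    have hpos : 0 < ‖d (n + 1) - d n‖ := norm_pos_iff.2 (sub_ne_zero.2 hne)
    obtain ⟨k, hk⟩ := exists_nat_gt ((2 * C) / ‖d (n + 1) - d n‖)
    rw [div_lt_iff₀ hpos] at hk
    have h5 : ‖(k : ℝ) • (d (n + 1) - d n)‖ ≤ 2 * C := by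
      have : (k : ℝ) • (d (n + 1) - d n) = d (n + k) - d n := by rw [(hlin k).1]; abel
      rw [this]
      calc _ ≤ ‖d (n + k)‖ + ‖d n‖ := norm_sub_le _ _
        _ ≤ _ := by linarith [hC n, hC (n + k)]
    rw [norm_smul] at h5
    simp at h5
    linarith
  · have h3 : 3 ≤ |t| := by
      obtain ⟨k, hk⟩ := ht9
      rw [le_abs]; omega
    have h3R : (3 : ℝ) ≤ |(t : ℝ)| := by exact_mod_cast h3
    have hdec : ∀ j : ℕ, ∀ n, ‖d n‖ ≤ (2 / 3) ^ j * C := by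
      intro j
      induction j with
      | zero => simpa using hC
      | succ j ih =>
        intro n
        have := hch (n - 1)
        rw [sub_add_cancel] at this
        have h6 : |(t : ℝ)| * ‖d n‖ ≤ 2 * ((2 / 3) ^ j * C) := by
          rw [← Real.norm_eq_abs, ← norm_smul, ← this]
          calc _ ≤ ‖d (n + 1)‖ + ‖d (n - 1)‖ := norm_add_le _ _
            _ ≤ _ := by linarith [ih (n + 1), ih (n - 1)]
        have h7 : 3 * ‖d n‖ ≤ |(t : ℝ)| * ‖d n‖ := by gcongr
        rw [pow_succ]
        linarith
    have hz : ∀ n, d n = 0 := by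
      intro n
      have hlim : Filter.Tendsto (fun j : ℕ => ((2 : ℝ) / 3) ^ j * C) Filter.atTop (nhds (0 * C)) :=
        (tendsto_pow_atTop_nhds_zero_of_lt_one (by norm_num) (by norm_num)).mul_const C
      have := ge_of_tendsto' hlim (fun j => hdec j n)
      rw [zero_mul] at this
      exact norm_le_zero_iff.1 this
    rw [hz, hz]

lemma bdd_affine (A : Matrix (Fin 2) (Fin 2) ℤ) (B : Matrix (Fin 2) (Fin 2) ℤ)
    (hB : ∀ i j, A i j = (1 : Matrix (Fin 2) (Fin 2) ℤ) i j + 3 * B i j) (hdet : A.det = 1 ∨ A.det = -1) (s : ℤ → ℝ × ℝ) (b : ℝ × ℝ)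
    (hs : ∀ n, s (n + 1) = act A (s n) + b) (C : ℝ) (hC : ∀ n, ‖s n‖ ≤ C) :
    s 1 = s 0 := by
  have hfix := bdd_fixed A B hB hdet (fun n => s (n + 1) - s n)
    (fun n => by
      rw [hs (n + 1), hs n, map_sub, map_add]
      have := hs n
      have e : act A (act A (s n) + b) = act A (act A (s n)) + act A b := map_add _ _ _
      rw [add_sub_add_right_eq_sub])
    (2 * C) (fun n => (norm_sub_le _ _).trans (by linarith [hC n, hC (n + 1)]))
  have hlin : ∀ k : ℕ, s k = s 0 + (k : ℝ) • (s 1 - s 0) ∧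
      s ((k : ℤ) + 1) - s k = s 1 - s 0 := by
    intro k
    induction k with
    | zero => simp
    | succ k ih =>
      have h3 := hfix k
      push_cast
      refine ⟨?_, by rw [h3, ih.2]⟩
      rw [add_smul, one_smul, ← add_assoc, ← ih.1, ← ih.2]; abel
  by_contra hne
  have hpos : 0 < ‖s 1 - s 0‖ := norm_pos_iff.2 (sub_ne_zero.2 hne)
  obtain ⟨k, hk⟩ := exists_nat_gt ((2 * C) / ‖s 1 - s 0‖)
  rw [div_lt_iff₀ hpos] at hk
  have h5 : ‖(k : ℝ) • (s 1 - s 0)‖ ≤ 2 * C := by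
    have : (k : ℝ) • (s 1 - s 0) = s k - s 0 := by rw [(hlin k).1]; abel
    rw [this]
    calc _ ≤ ‖s k‖ + ‖s 0‖ := norm_sub_le _ _
      _ ≤ _ := by linarith [hC 0, hC k]
  rw [norm_smul] at h5
  simp at h5
  linarith

/-- the mapping class homomorphism -/
noncomputable def mcgHom : (T2 ≃ₜ T2) →* Matrix (Fin 2) (Fin 2) ℤ where
  toFun := mcg
  map_one' := mcg_one
  map_mul' := mcg_mul

lemma mcg_inv_of_one {f : T2 ≃ₜ T2} (h : mcg f = 1) : mcg f⁻¹ = 1 := by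
  have := mcg_mul f f⁻¹
  rw [mul_inv_cancel, mcg_one, h, one_mul] at this
  exact this.symm

lemma mcg_conj_of_one {f : T2 ≃ₜ T2} (g : T2 ≃ₜ T2) (h : mcg f = 1) : mcg (g * f * g⁻¹) = 1 := by
  rw [mcg_mul, mcg_mul, h, mul_one, ← mcg_mul, mul_inv_cancel, mcg_one]

lemma mcg_det (f : T2 ≃ₜ T2) : (mcg f).det = 1 ∨ (mcg f).det = -1 := by
  have : IsUnit (mcg f) := (Group.isUnit f).map mcgHom
  rw [Matrix.isUnit_iff_isUnit_det] at this
  exact Int.isUnit_iff.1 this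

lemma lift1_of {f : T2 ≃ₜ T2} {F : ℝ × ℝ → ℝ × ℝ} (h : IsLift (⇑f) F) (h1 : mcg f = 1) :
    Lift1 f F := ⟨h, h1 ▸ mcg_spec h⟩

/-- the mapping class is trivial mod 3 -/
def Good (f : T2 ≃ₜ T2) : Prop :=
  ∃ B : Matrix (Fin 2) (Fin 2) ℤ, ∀ i j, mcg f i j = (1 : Matrix (Fin 2) (Fin 2) ℤ) i j + 3 * B i j

/-- the group of homeomorphisms preserving a measure -/
def stab (μ : Measure T2) : Subgroup (T2 ≃ₜ T2) where
  carrier := {f | MeasurePreserving (⇑f) μ μ}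
  one_mem' := MeasurePreserving.id μ
  mul_mem' := fun {f g} hf hg => MeasurePreserving.comp (g := ⇑f) (f := ⇑g) hf hg
  inv_mem' := fun {f} hf => MeasurePreserving.symm f.toMeasurableEquiv hf

lemma mem_stab {μ : Measure T2} {f : T2 ≃ₜ T2} : f ∈ stab μ ↔ MeasurePreserving (⇑f) μ μ := Iff.rfl

lemma mem_stab' {μ : Measure T2} {f : T2 ≃ₜ T2} : f ∈ stab μ ↔ μ.map f = μ :=
  ⟨fun h => h.map_eq, fun h => ⟨f.measurable, h⟩⟩

lemma map_mul (f g : T2 ≃ₜ T2) (μ : Measure T2) : μ.map (⇑(f * g)) = (μ.map g).map f :=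
  (Measure.map_map f.measurable g.measurable).symm

lemma map_one (μ : Measure T2) : μ.map (⇑(1 : T2 ≃ₜ T2)) = μ := Measure.map_id

lemma stab_map {L : Subgroup (T2 ≃ₜ T2)} {μ : Measure T2} (h : L ≤ stab μ) {g : T2 ≃ₜ T2}
    (hg : g ∈ Subgroup.normalizer (L : Set (T2 ≃ₜ T2))) : L ≤ stab (μ.map g) := by
  intro x hx
  rw [mem_stab', ← map_mul]
  have : x * g = g * (g⁻¹ * x * g) := by group
  rw [this, map_mul, mem_stab'.1 (h ((Subgroup.mem_normalizer_iff''.1 hg x).1 hx))]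

lemma prob_map (μ : Measure T2) [IsProbabilityMeasure μ] (g : T2 ≃ₜ T2) :
    IsProbabilityMeasure (μ.map g) := Measure.isProbabilityMeasure_map g.measurable.aemeasurable

lemma inv_rot (G : Subgroup (T2 ≃ₜ T2)) (N : ℕ) (hN : G.lowerCentralSeries N = ⊥)
    (L : Subgroup (T2 ≃ₜ T2)) (g : T2 ≃ₜ T2) (hgG : g ∈ G) (hgood : Good g)
    (hg : g ∈ Subgroup.normalizer (L : Set (T2 ≃ₜ T2))) (k : ℕ) :
    ∀ j, j + k = N → ∀ μ : Measure T2, IsProbabilityMeasure μ → L ≤ stab μ →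
      ∀ x ∈ L, x ∈ G.lowerCentralSeries j → mcg x = 1 → ∀ X, IsLift (⇑x) X →
        rot X (μ.map g) = rot X μ := by
  induction k with
  | zero =>
    intro j hj μ hμ hL x hxL hx hx1 X hX
    rw [add_zero] at hj
    rw [hj, hN, Subgroup.mem_bot] at hx
    subst hx
    obtain ⟨m, n, hmn⟩ := lift_diff lift_one hX
    have e : X = fun p => id p + iv m n := funext hmn
    have hr := (rot_add_const (lift1_of lift_one mcg_one) m n).2
    have := prob_map μ g
    have h0 : ∀ ν : Measure T2, rot id ν = 0 := by
      intro ν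
      simp [rot, disp, desc]
    rw [e, hr μ hμ, hr (μ.map g) this, h0, h0]
  | succ k ih =>
    intro j hj μ hμ hL x hxL hx hx1 X hX
    obtain ⟨Γ, hΓ⟩ := exists_lift g
    have hyL : x⁻¹ * (g⁻¹ * x * g) ∈ L :=
      L.mul_mem (L.inv_mem hxL) ((Subgroup.mem_normalizer_iff''.1 hg x).1 hxL)
    have hy : x⁻¹ * (g⁻¹ * x * g) ∈ G.lowerCentralSeries (j + 1) := by
      have := Subgroup.commutator_mem_commutator ((G.lowerCentralSeries j).inv_mem hx)
        (G.inv_mem hgG)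
      rw [Subgroup.lowerCentralSeries_succ]
      convert this using 1
      rw [commutatorElement_def]; group
    have hy1 : mcg (x⁻¹ * (g⁻¹ * x * g)) = 1 := by
      have := mcg_conj_of_one g⁻¹ hx1
      rw [inv_inv] at this
      rw [mcg_mul, this, mcg_inv_of_one hx1, one_mul]
    have hxy : g * (x * (x⁻¹ * (g⁻¹ * x * g))) = x * g := by group
    set y := x⁻¹ * (g⁻¹ * x * g) with hydef
    obtain ⟨Y, hY⟩ := exists_lift y
    have hxy1 : mcg (x * y) = 1 := by rw [mcg_mul, hx1, hy1, one_mul]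
    have hXY := lift1_of (lift_mul hX hY) hxy1
    obtain ⟨m, n, hw⟩ := lift_diff (lift_mul hΓ (lift_mul hX hY)) (hxy ▸ lift_mul hX hΓ)
    have hμn : ∀ n : ℤ, IsProbabilityMeasure (μ.map (⇑(g ^ n))) := fun n => prob_map μ _
    have hLn : ∀ n : ℤ, L ≤ stab (μ.map (⇑(g ^ n))) := fun n =>
      stab_map hL (Subgroup.zpow_mem _ hg n)
    have hsucc : ∀ n : ℤ, μ.map (⇑(g ^ (n + 1))) = (μ.map (⇑(g ^ n))).map g := by
      intro n
      rw [← map_mul, add_comm, zpow_one_add]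
    have hYc : ∀ n : ℤ, rot Y (μ.map (⇑(g ^ n))) = rot Y μ := by
      have hst : ∀ n : ℤ, rot Y (μ.map (⇑(g ^ (n + 1)))) = rot Y (μ.map (⇑(g ^ n))) := by
        intro n
        rw [hsucc]
        exact ih (j + 1) (by omega) _ (hμn n) (hLn n) y hyL hy hy1 Y hY
      intro n
      induction n with
      | zero => rw [zpow_zero, map_one]
      | succ k ihk => rw [hst, ihk]
      | pred k ihk => rw [← ihk, ← hst, sub_add_cancel]
    obtain ⟨B, hB⟩ := hgood
    obtain ⟨C, hC⟩ := rot_bound (lift1_of hX hx1)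
    have hfin := bdd_affine (mcg g) B hB (mcg_det g) (fun n => rot X (μ.map (⇑(g ^ n))))
      (act (mcg g) (rot Y μ) + iv m n) (fun k => by
        have := hμn k
        have hst := hLn k
        rw [hsucc, rot_conj hXY (lift1_of hX hx1) hΓ (hst (L.mul_mem hxL hyL)) (iv m n) hw,
          rot_comp (lift1_of hX hx1) (lift1_of hY hy1) (hst hyL) hXY, hYc, _root_.map_add,
          add_assoc])
      C (fun n => hC _ (hμn n))
    simpa [zpow_one, map_one] using hfin

lemma rot_continuous {f : T2 ≃ₜ T2} {F : ℝ × ℝ → ℝ × ℝ} (h : Lift1 f F) :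
    Continuous (fun μ : ProbabilityMeasure T2 => rot F (μ : Measure T2)) := by
  have hc := disp_cont h
  have e : (fun μ : ProbabilityMeasure T2 => rot F (μ : Measure T2)) =
      fun μ : ProbabilityMeasure T2 =>
        (∫ x, (disp F x).1 ∂(μ : Measure T2), ∫ x, (disp F x).2 ∂(μ : Measure T2)) := by
    ext1 μ
    have hi := cont_integrable hc (μ : Measure T2)
    exact Prod.ext (fst_integral hi) (snd_integral hi)
  rw [e]
  exact (ProbabilityMeasure.continuous_integral_continuousMap
      (⟨fun x => (disp F x).1, continuous_fst.comp hc⟩ : C(T2, ℝ))).prodMk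
    (ProbabilityMeasure.continuous_integral_continuousMap
      (⟨fun x => (disp F x).2, continuous_snd.comp hc⟩ : C(T2, ℝ)))

/-- the invariant probability measures with prescribed rotation vector -/
def KK (L : Subgroup (T2 ≃ₜ T2)) (F : ℝ × ℝ → ℝ × ℝ) (v : ℝ × ℝ) : Set (ProbabilityMeasure T2) :=
  {μ | L ≤ stab (μ : Measure T2) ∧ rot F (μ : Measure T2) = v}

lemma mem_stab_prob {μ : ProbabilityMeasure T2} {f : T2 ≃ₜ T2} :
    f ∈ stab (μ : Measure T2) ↔ μ.map f.continuous.measurable.aemeasurable = μ := by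
  rw [mem_stab', ← ProbabilityMeasure.toMeasure_injective.eq_iff, ProbabilityMeasure.toMeasure_map]

lemma KK_closed (L : Subgroup (T2 ≃ₜ T2)) {f : T2 ≃ₜ T2} {F : ℝ × ℝ → ℝ × ℝ} (h : Lift1 f F)
    (v : ℝ × ℝ) : IsClosed (KK L F v) := by
  have e : KK L F v = (⋂ x ∈ L, {μ : ProbabilityMeasure T2 |
      μ.map x.continuous.measurable.aemeasurable = μ}) ∩
      {μ : ProbabilityMeasure T2 | rot F (μ : Measure T2) = v} := by
    ext μ
    simp only [KK, Set.mem_ofPred_eq, mem_inter_iff, mem_iInter, ← mem_stab_prob]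
    rfl
  rw [e]
  refine IsClosed.inter (isClosed_biInter fun x _ => ?_) (isClosed_eq (rot_continuous h)
    continuous_const)
  exact isClosed_eq (ProbabilityMeasure.continuous_map x.continuous) continuous_id

/-- averaged measure -/
noncomputable def avg (μ : Measure T2) (g : T2 ≃ₜ T2) (n : ℕ) : Measure T2 :=
  ((n : ENNReal) + 1)⁻¹ • ∑ k ∈ Finset.range (n + 1), μ.map (⇑(g ^ k))

lemma avg_prob (μ : Measure T2) [IsProbabilityMeasure μ] (g : T2 ≃ₜ T2) (n : ℕ) :
    IsProbabilityMeasure (avg μ g n) := by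
  constructor
  have : ∀ k : ℕ, (μ.map (⇑(g ^ k))) univ = 1 := fun k => (prob_map μ (g ^ k)).measure_univ
  simp only [avg, Measure.smul_apply, Measure.finsetSum_apply, this]
  simp only [Finset.sum_const, Finset.card_range, smul_eq_mul, nsmul_eq_mul, mul_one]
  push_cast
  exact ENNReal.inv_mul_cancel (by simp) (by finiteness)

lemma avg_integral {E : Type*} [NormedAddCommGroup E] [NormedSpace ℝ E]
    [SecondCountableTopologyEither T2 E] (μ : Measure T2) [IsProbabilityMeasure μ]
    (g : T2 ≃ₜ T2) (n : ℕ) {u : T2 → E} (hu : Continuous u) :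
    ∫ x, u x ∂(avg μ g n) =
      ((n : ℝ) + 1)⁻¹ • ∑ k ∈ Finset.range (n + 1), ∫ x, u x ∂(μ.map (⇑(g ^ k))) := by
  have := fun k : ℕ => prob_map μ (g ^ k)
  rw [avg, integral_smul_measure, integral_finsetSum_measure]
  · congr 1
    rw [ENNReal.toReal_inv, ENNReal.toReal_add (by simp) (by simp)]
    simp
  · intro k _
    exact cont_integrable hu _

lemma avg_stab {L : Subgroup (T2 ≃ₜ T2)} {μ : Measure T2} (g : T2 ≃ₜ T2)
    (h : ∀ k : ℕ, L ≤ stab (μ.map (⇑(g ^ k)))) (n : ℕ) : L ≤ stab (avg μ g n) := by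
  intro x hx
  rw [mem_stab', avg, Measure.map_smul, Measure.map_finset_sum x.measurable.aemeasurable]
  congr 1
  exact Finset.sum_congr rfl fun k _ => mem_stab'.1 (h k hx)

lemma exists_fixed (L : Subgroup (T2 ≃ₜ T2)) {f : T2 ≃ₜ T2} {F : ℝ × ℝ → ℝ × ℝ} (h : Lift1 f F)
    (v : ℝ × ℝ) (g : T2 ≃ₜ T2) (hg : g ∈ Subgroup.normalizer (L : Set (T2 ≃ₜ T2)))
    (hinv : ∀ μ : Measure T2, IsProbabilityMeasure μ → L ≤ stab μ → rot F (μ.map g) = rot F μ)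
    (hne : (KK L F v).Nonempty) : (KK (L ⊔ Subgroup.zpowers g) F v).Nonempty := by
  obtain ⟨μ, hμL, hμv⟩ := hne
  have hLk : ∀ k : ℕ, L ≤ stab ((μ : Measure T2).map (⇑(g ^ k))) := fun k =>
    stab_map hμL (Subgroup.pow_mem _ hg k)
  have hrk : ∀ k : ℕ, rot F ((μ : Measure T2).map (⇑(g ^ k))) = v := by
    intro k
    induction k with
    | zero => rw [pow_zero, map_one, hμv]
    | succ k ih => rw [pow_succ', map_mul, hinv _ (prob_map _ _) (hLk k), ih]
  let ν : ℕ → ProbabilityMeasure T2 := fun n => ⟨avg μ g n, avg_prob _ g n⟩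
  have hν : ∀ n, ν n ∈ KK L F v := by
    intro n
    refine ⟨avg_stab g hLk n, ?_⟩
    show rot F (avg μ g n) = v
    have h2 := avg_integral (μ : Measure T2) g n (disp_cont h)
    unfold rot at hrk ⊢
    rw [h2, Finset.sum_congr rfl (fun k _ => hrk k)]
    simp only [Finset.sum_const, Finset.card_range, ← Nat.cast_smul_eq_nsmul ℝ]
    push_cast
    exact inv_smul_smul₀ (by positivity) v
  let U : Ultrafilter ℕ := Ultrafilter.of Filter.atTop
  have hU : (U : Filter ℕ) ≤ Filter.atTop := Ultrafilter.of_le _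
  obtain ⟨νlim, hKmem, hlim⟩ := (KK_closed L h v).isCompact.ultrafilter_le_nhds' (U.map ν)
    (Ultrafilter.mem_map.2 (Filter.mem_of_superset Filter.univ_mem fun n _ => hν n))
  have hlim : Filter.Tendsto ν U (nhds νlim) := hlim
  refine ⟨νlim, sup_le hKmem.1 ?_, hKmem.2⟩
  rw [Subgroup.zpowers_le, mem_stab_prob]
  have l1 := ProbabilityMeasure.tendsto_map_of_tendsto_of_continuous ν νlim hlim g.continuous
  refine tendsto_nhds_unique l1 ?_
  rw [ProbabilityMeasure.tendsto_iff_forall_integral_tendsto] at hlim ⊢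
  intro u
  have hd : ∀ n, ∫ x, u x ∂((ν n).map g.continuous.measurable.aemeasurable : Measure T2) =
      ∫ x, u x ∂(ν n : Measure T2) + ((n : ℝ) + 1)⁻¹ *
        (∫ x, u x ∂((μ : Measure T2).map (⇑(g ^ (n + 1)))) - ∫ x, u x ∂(μ : Measure T2)) := by
    intro n
    rw [ProbabilityMeasure.toMeasure_map, integral_map g.measurable.aemeasurable
      u.continuous.aestronglyMeasurable]
    show ∫ x, u (g x) ∂(avg μ g n) = ∫ x, u x ∂(avg μ g n) + _
    rw [avg_integral (u := fun x => u (g x)) _ g n (u.continuous.comp g.continuous), avg_integral _ g n u.continuous]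
    have e : ∀ k : ℕ, ∫ x, u (g x) ∂((μ : Measure T2).map (⇑(g ^ k))) =
        ∫ x, u x ∂((μ : Measure T2).map (⇑(g ^ (k + 1)))) := by
      intro k
      rw [pow_succ', map_mul, integral_map g.measurable.aemeasurable
        u.continuous.aestronglyMeasurable]
    simp only [smul_eq_mul]
    rw [Finset.sum_congr rfl (fun k _ => e k), ← mul_add]
    congr 1
    have h1 := Finset.sum_range_succ (fun k => ∫ x, u x ∂((μ : Measure T2).map (⇑(g ^ k)))) (n + 1)
    have h2 := Finset.sum_range_succ' (fun k => ∫ x, u x ∂((μ : Measure T2).map (⇑(g ^ k)))) (n + 1)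
    rw [pow_zero, map_one] at h2
    linarith
  simp_rw [hd]
  have hz : Filter.Tendsto (fun n : ℕ => ((n : ℝ) + 1)⁻¹ *
        (∫ x, u x ∂((μ : Measure T2).map (⇑(g ^ (n + 1)))) - ∫ x, u x ∂(μ : Measure T2)))
      U (nhds 0) := by
    refine Filter.Tendsto.mono_left ?_ hU
    refine squeeze_zero_norm (a := fun n : ℕ => (1 / ((n : ℝ) + 1)) * (2 * ‖u‖)) ?_ ?_
    · intro n
      have hp := prob_map (μ : Measure T2) (g ^ (n + 1))
      have b1 := u.norm_integral_le_norm ((μ : Measure T2).map (⇑(g ^ (n + 1))))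
      have b2 := u.norm_integral_le_norm (μ : Measure T2)
      rw [norm_mul, one_div, norm_inv, Real.norm_of_nonneg (by positivity : (0 : ℝ) ≤ (n : ℝ) + 1)]
      gcongr
      exact (norm_sub_le _ _).trans (by linarith)
    · simpa using (tendsto_one_div_add_atTop_nhds_zero_nat (𝕜 := ℝ)).mul_const (2 * ‖u‖)
  simpa using (hlim u).add hz

lemma normalizer_grows {H L : Subgroup (T2 ≃ₜ T2)} (hH : Group.IsNilpotent H) (hLH : L ≤ H)
    (hne : ¬ H ≤ L) : ∃ g ∈ H, g ∈ Subgroup.normalizer (L : Set (T2 ≃ₜ T2)) ∧ g ∉ L := by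
  have hc := Group.normalizerCondition_of_isNilpotent (G := H)
  have hlt : L.subgroupOf H < ⊤ := by
    rw [lt_top_iff_ne_top]
    intro h
    exact hne (Subgroup.subgroupOf_eq_top.1 h)
  obtain ⟨g, hg, hgn⟩ := SetLike.exists_of_lt (hc _ hlt)
  refine ⟨g, g.2, ?_, fun h => hgn (Subgroup.mem_subgroupOf.2 h)⟩
  rw [Subgroup.mem_normalizer_iff] at hg ⊢
  intro x
  constructor
  · intro hx
    exact Subgroup.mem_subgroupOf.1 ((hg ⟨x, hLH hx⟩).1 (Subgroup.mem_subgroupOf.2 hx))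
  · intro hx
    have hxH : x ∈ H := by
      have := H.mul_mem (H.mul_mem (H.inv_mem g.2) (hLH hx)) g.2
      convert this using 1
      group
    exact Subgroup.mem_subgroupOf.1 ((hg ⟨x, hxH⟩).2 (Subgroup.mem_subgroupOf.2 hx))

lemma main_exists (G H : Subgroup (T2 ≃ₜ T2)) (hG : Group.IsNilpotent G) (hHG : H ≤ G)
    (hgood : ∀ g ∈ H, Good g) (f : T2 ≃ₜ T2) (hf : f ∈ H) (hf1 : mcg f = 1)
    (F : ℝ × ℝ → ℝ × ℝ) (hF : IsLift (⇑f) F) (μ : Measure T2) (hμ : IsProbabilityMeasure μ)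
    (hμf : f ∈ stab μ) :
    ∃ ν : Measure T2, IsProbabilityMeasure ν ∧ H ≤ stab ν ∧ rot F ν = rot F μ := by
  obtain ⟨N, hN⟩ := (Subgroup.isNilpotent_iff_lowerCentralSeries G).1 hG
  have hHn : Group.IsNilpotent H := by
    rw [Subgroup.isNilpotent_iff_lowerCentralSeries]
    refine ⟨N, ?_⟩
    have hmono : ∀ n, H.lowerCentralSeries n ≤ G.lowerCentralSeries n := by
      intro n
      induction n with
      | zero => simpa using hHG
      | succ n ih =>
        rw [Subgroup.lowerCentralSeries_succ, Subgroup.lowerCentralSeries_succ]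
        exact Subgroup.commutator_mono ih hHG
    rw [← le_bot_iff, ← hN]
    exact hmono N
  have h1 := lift1_of hF hf1
  set v := rot F μ with hv
  obtain ⟨L, hfL, hmax⟩ := zorn_le_nonempty₀
    {L : Subgroup (T2 ≃ₜ T2) | L ≤ H ∧ (KK L F v).Nonempty} (by
      intro c hc hchain L0 hL0
      have hdir : DirectedOn (· ≤ ·) c := hchain.directedOn
      have hne : Nonempty c := ⟨⟨L0, hL0⟩⟩
      refine ⟨sSup c, ⟨sSup_le fun L hL => (hc hL).1, ?_⟩, fun z hz => le_sSup hz⟩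
      have := IsCompact.nonempty_iInter_of_directed_nonempty_isCompact_isClosed
        (fun L : c => KK (L : Subgroup (T2 ≃ₜ T2)) F v) (by
          intro a b
          obtain ⟨d, hd, had, hbd⟩ := hdir a a.2 b b.2
          exact ⟨⟨d, hd⟩, fun μ hμ => ⟨had.trans hμ.1, hμ.2⟩, fun μ hμ => ⟨hbd.trans hμ.1, hμ.2⟩⟩)
        (fun L => (hc L.2).2) (fun L => (KK_closed _ h1 v).isCompact)
        (fun L => KK_closed _ h1 v)
      obtain ⟨ν, hν⟩ := this
      rw [mem_iInter] at hν
      exact ⟨ν, sSup_le fun L hL => (hν ⟨L, hL⟩).1, (hν ⟨L0, hL0⟩).2⟩)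
    (Subgroup.zpowers f)
    ⟨by rwa [Subgroup.zpowers_le], ⟨⟨μ, hμ⟩, by rwa [Subgroup.zpowers_le], rfl⟩⟩
  have hfL' : f ∈ L := hfL (Subgroup.mem_zpowers f)
  obtain ⟨hLH, hLne⟩ := hmax.prop
  have hHL : H ≤ L := by
    by_contra hcon
    obtain ⟨g, hgH, hgn, hgL⟩ := normalizer_grows hHn hLH hcon
    have hK := exists_fixed L h1 v g hgn (fun μ hμ hμL =>
      inv_rot G N hN L g (hHG hgH) (hgood g hgH) hgn N 0 (zero_add N) μ hμ hμL f hfL'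
        (hHG hf) hf1 F hF) hLne
    have hle := hmax.le_of_ge
      (⟨sup_le hLH (by rwa [Subgroup.zpowers_le]), hK⟩ :
        (L ⊔ Subgroup.zpowers g) ∈ {L : Subgroup (T2 ≃ₜ T2) | L ≤ H ∧ (KK L F v).Nonempty})
      le_sup_left
    exact hgL (hle (le_sup_right (a := L) (Subgroup.mem_zpowers g)))
  obtain ⟨ν, hν, hνv⟩ := hLne
  exact ⟨ν, ν.2, hHL.trans hν, hνv⟩

/-- reduction mod 3 of the mapping class -/
noncomputable def redHom : (T2 ≃ₜ T2) →* (Matrix (Fin 2) (Fin 2) (ZMod 3))ˣ :=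
  (((Int.castRingHom (ZMod 3)).mapMatrix (m := Fin 2)).toMonoidHom.comp mcgHom).toHomUnits

lemma redHom_good {f : T2 ≃ₜ T2} (h : f ∈ redHom.ker) : Good f := by
  rw [MonoidHom.mem_ker] at h
  have h' : (mcg f).map (Int.castRingHom (ZMod 3)) = 1 := congrArg Units.val h
  have key : ∀ i j, ∃ b : ℤ, mcg f i j = (1 : Matrix (Fin 2) (Fin 2) ℤ) i j + 3 * b := by
    intro i j
    have e := congrFun (congrFun h' i) j
    have e2 : ((mcg f i j : ℤ) : ZMod 3) = (((1 : Matrix (Fin 2) (Fin 2) ℤ) i j : ℤ) : ZMod 3) := by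
      have e' : ((mcg f i j : ℤ) : ZMod 3) = (1 : Matrix (Fin 2) (Fin 2) (ZMod 3)) i j := e
      rw [e']
      by_cases hij : i = j <;> simp [Matrix.one_apply, hij]
    have e3 := (ZMod.intCast_eq_intCast_iff_dvd_sub _ _ 3).1 e2
    obtain ⟨b, hb⟩ := e3
    exact ⟨-b, by push_cast at hb; linarith⟩
  choose B hB using key
  exact ⟨Matrix.of B, fun i j => by simpa using hB i j⟩

lemma redHom_of_one {f : T2 ≃ₜ T2} (h : mcg f = 1) : f ∈ redHom.ker := by
  rw [MonoidHom.mem_ker]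
  ext1
  show (Int.castRingHom (ZMod 3)).mapMatrix (mcg f) = 1
  rw [h, _root_.map_one]

lemma iso_one : IsotopicToId (⇑(1 : T2 ≃ₜ T2)) :=
  ⟨fun _ => id, continuous_snd, fun _ => IsHomeomorph.id, rfl, rfl, fun _ _ _ => rfl⟩

lemma iso_mul {f g : T2 ≃ₜ T2} (hf : IsotopicToId (⇑f)) (hg : IsotopicToId (⇑g)) :
    IsotopicToId (⇑(f * g)) := by
  obtain ⟨I, hI, hI1, hI2, hI3, -⟩ := hf
  obtain ⟨J, hJ, hJ1, hJ2, hJ3, -⟩ := hg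
  refine ⟨fun t => I t ∘ J t, hI.comp (continuous_fst.prodMk hJ), fun t => (hI1 t).comp (hJ1 t),
    by beta_reduce; rw [hI2, hJ2]; rfl, by beta_reduce; rw [hI3, hJ3]; rfl, fun _ _ h => h.elim⟩

lemma iso_inv {f : T2 ≃ₜ T2} (hf : IsotopicToId (⇑f)) : IsotopicToId (⇑f⁻¹) := by
  obtain ⟨I, hI, hI1, hI2, hI3, -⟩ := hf
  refine ⟨fun t => I (1 - t) ∘ ⇑f⁻¹, ?_, fun t => (hI1 _).comp f⁻¹.isHomeomorph, ?_, ?_,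
    fun _ _ h => h.elim⟩
  · exact hI.comp ((continuous_const.sub continuous_fst).prodMk
      (f⁻¹.continuous.comp continuous_snd))
  · beta_reduce; rw [sub_zero, hI3]; ext1 x; exact f.apply_symm_apply x
  · beta_reduce; rw [sub_self, hI2]; rfl

lemma iso_conj {f : T2 ≃ₜ T2} (g : T2 ≃ₜ T2) (hf : IsotopicToId (⇑f)) :
    IsotopicToId (⇑(g * f * g⁻¹)) := by
  obtain ⟨I, hI, hI1, hI2, hI3, -⟩ := hf
  refine ⟨fun t => ⇑g ∘ I t ∘ ⇑g⁻¹, ?_,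
    fun t => g.isHomeomorph.comp ((hI1 _).comp g⁻¹.isHomeomorph), ?_, ?_, fun _ _ h => h.elim⟩
  · exact g.continuous.comp (hI.comp (continuous_fst.prodMk (g⁻¹.continuous.comp continuous_snd)))
  · beta_reduce; rw [hI2]; ext1 x; exact g.apply_symm_apply x
  · beta_reduce; rw [hI3]; rfl

lemma irrot_iff {f : T2 ≃ₜ T2} : IsIrrotational f ↔ IsotopicToId (⇑f) ∧ ∃ F, IsLift (⇑f) F ∧
    ∀ μ : Measure T2, IsProbabilityMeasure μ → f ∈ stab μ → rot F μ = 0 := by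
  refine and_congr_right fun hi => exists_congr fun F => and_congr_right fun hF => ?_
  refine forall_congr' fun μ => forall_congr' fun hμ => forall_congr' fun _ => ?_
  exact hasRotVec_iff (lift1_of hF (mcg_isotopic hi)) μ _

lemma irrotFor_iff {f : T2 ≃ₜ T2} {S : Subgroup (T2 ≃ₜ T2)} :
    IsIrrotationalFor f (S : Set (T2 ≃ₜ T2)) ↔ IsotopicToId (⇑f) ∧ ∃ F, IsLift (⇑f) F ∧
    ∀ μ : Measure T2, IsProbabilityMeasure μ → S ≤ stab μ → rot F μ = 0 := by
  refine and_congr_right fun hi => exists_congr fun F => and_congr_right fun hF => ?_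
  refine forall_congr' fun μ => forall_congr' fun hμ => forall_congr' fun _ => ?_
  exact hasRotVec_iff (lift1_of hF (mcg_isotopic hi)) μ _

lemma irrot_inv {f : T2 ≃ₜ T2} (h : IsIrrotational f) : IsIrrotational f⁻¹ := by
  rw [irrot_iff] at h ⊢
  obtain ⟨hi, F, hF, hr⟩ := h
  have h1 := mcg_isotopic hi
  obtain ⟨F', hF'⟩ := exists_lift f⁻¹
  have hl := lift1_of hF' (mcg_inv_of_one h1)
  have hm := lift_mul hF' hF
  rw [inv_mul_cancel] at hm
  obtain ⟨m, n, hmn⟩ := lift_diff lift_one hm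
  refine ⟨iso_inv hi, fun p => F' p + iv (-m) (-n), (rot_add_const hl _ _).1.1, fun μ hμ hs => ?_⟩
  rw [(rot_add_const hl _ _).2 μ hμ]
  have hs' : f ∈ stab μ := by simpa using (stab μ).inv_mem hs
  have hc := rot_comp hl (lift1_of hF h1) hs' (by
    rw [inv_mul_cancel]; exact lift1_of hm mcg_one)
  rw [hr μ hμ hs', add_zero] at hc
  have e : F' ∘ F = fun p => id p + iv m n := funext hmn
  rw [← hc, e, (rot_add_const (lift1_of lift_one mcg_one) m n).2 μ hμ]
  simp [rot, disp, desc, iv]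

lemma irrot_conj {f : T2 ≃ₜ T2} (g : T2 ≃ₜ T2) (h : IsIrrotational f) :
    IsIrrotational (g * f * g⁻¹) := by
  rw [irrot_iff] at h ⊢
  obtain ⟨hi, F, hF, hr⟩ := h
  have h1 := mcg_isotopic hi
  obtain ⟨F', hF'⟩ := exists_lift (g * f * g⁻¹)
  obtain ⟨Γ, hΓ⟩ := exists_lift g
  have hl := lift1_of hF' (mcg_conj_of_one g h1)
  have hm := lift_mul hF' hΓ
  rw [inv_mul_cancel_right] at hm
  obtain ⟨m, n, hmn⟩ := lift_diff (lift_mul hΓ hF) hm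
  refine ⟨iso_conj g hi, fun p => F' p + iv (-m) (-n), (rot_add_const hl _ _).1.1,
    fun μ hμ hs => ?_⟩
  rw [(rot_add_const hl _ _).2 μ hμ]
  have hp := prob_map μ g⁻¹
  have hback : (μ.map (⇑g⁻¹)).map g = μ := by rw [← map_mul, mul_inv_cancel, map_one]
  have hs' : f ∈ stab (μ.map (⇑g⁻¹)) := by
    rw [mem_stab', ← map_mul]
    have : f * g⁻¹ = g⁻¹ * (g * f * g⁻¹) := by group
    rw [this, map_mul, mem_stab'.1 hs]
  have hc := rot_conj (lift1_of hF h1) hl hΓ hs' (iv m n) hmn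
  rw [hback, hr _ hp hs'] at hc
  rw [hc]
  simp [iv]

end TorusNil

open TorusNil

/-- **Theorem (main6).** Let `G` be a nilpotent subgroup of `Homeo(T²)`. Then there
is a finite index normal subgroup `H` of `G` containing `G₀` such that for every
`φ ∈ G₀` and every lift `φ̃`, the set of rotation vectors of `φ̃` with respect to
`φ`-invariant measures coincides with the set of rotation vectors with respect to
`H`-invariant measures. In particular the set `I_G` of irrotational elements of `G`
is a normal subgroup of `G`, and if `G = G₀` then `I_G = G_I`. -/
theorem stmt_4
    (G : Subgroup (T2 ≃ₜ T2))
    (hnilp : Group.IsNilpotent G) :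
    (∃ H : Subgroup (T2 ≃ₜ T2), H ≤ G ∧
      (∀ ψ ∈ G, IsotopicToId (⇑ψ) → ψ ∈ H) ∧
      (∀ g ∈ G, ∀ h ∈ H, g * h * g⁻¹ ∈ H) ∧
      (H.subgroupOf G).FiniteIndex ∧
      (∀ φ ∈ G, IsotopicToId (⇑φ) → ∀ F, IsLift (⇑φ) F →
        {v : ℝ × ℝ | ∃ μ : Measure T2, IsProbabilityMeasure μ ∧
            MeasurePreserving (⇑φ) μ μ ∧ HasRotVec F μ v} =
        {v : ℝ × ℝ | ∃ ν : Measure T2, IsProbabilityMeasure ν ∧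
            (∀ h ∈ H, MeasurePreserving (⇑h) ν ν) ∧ HasRotVec F ν v})) ∧
    (∃ N : Subgroup (T2 ≃ₜ T2),
      (N : Set (T2 ≃ₜ T2)) = {ψ : T2 ≃ₜ T2 | ψ ∈ G ∧ IsIrrotational ψ} ∧
      ∀ g ∈ G, ∀ n ∈ N, g * n * g⁻¹ ∈ N) ∧
    ((∀ ψ ∈ G, IsotopicToId (⇑ψ)) →
      {ψ : T2 ≃ₜ T2 | ψ ∈ G ∧ IsIrrotational ψ} =
      {ψ : T2 ≃ₜ T2 | ψ ∈ G ∧ IsIrrotationalFor ψ (G : Set (T2 ≃ₜ T2))}) := by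
  have hnilp' := hnilp
  let H : Subgroup (T2 ≃ₜ T2) := G ⊓ redHom.ker
  have hHG : H ≤ G := inf_le_left
  have hgood : ∀ g ∈ H, Good g := fun g hg => redHom_good hg.2
  have h0 : ∀ ψ ∈ G, IsotopicToId (⇑ψ) → ψ ∈ H := fun ψ hψ hi =>
    ⟨hψ, redHom_of_one (mcg_isotopic hi)⟩
  have key : ∀ φ ∈ G, IsotopicToId (⇑φ) → ∀ F, IsLift (⇑φ) F → ∀ μ : Measure T2,
      IsProbabilityMeasure μ → φ ∈ stab μ →
      ∃ ν : Measure T2, IsProbabilityMeasure ν ∧ H ≤ stab ν ∧ rot F ν = rot F μ :=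
    fun φ hφ hi F hF μ hμ hs =>
      main_exists G H hnilp hHG hgood φ (h0 φ hφ hi) (mcg_isotopic hi) F hF μ hμ hs
  refine ⟨⟨H, hHG, h0, ?_, ?_, ?_⟩, ⟨⟨⟨⟨{ψ | ψ ∈ G ∧ IsIrrotational ψ}, ?_⟩, ?_⟩, ?_⟩, rfl, ?_⟩, ?_⟩
  · intro g hg h hh
    exact ⟨G.mul_mem (G.mul_mem hg hh.1) (G.inv_mem hg), (redHom.normal_ker).conj_mem h hh.2 g⟩
  · have e : H.subgroupOf G = redHom.ker.subgroupOf G := Subgroup.inf_subgroupOf_left _ _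
    rw [e]
    infer_instance
  · intro φ hφ hi F hF
    have hl := lift1_of hF (mcg_isotopic hi)
    ext v
    constructor
    · rintro ⟨μ, hμ, hs, hr⟩
      obtain ⟨ν, hν, hνs, hνr⟩ := key φ hφ hi F hF μ hμ hs
      refine ⟨ν, hν, fun h hh => hνs hh, ?_⟩
      rw [hasRotVec_iff hl] at hr ⊢
      rw [hνr, hr]
    · rintro ⟨ν, hν, hs, hr⟩
      exact ⟨ν, hν, hs φ (h0 φ hφ hi), hr⟩
  · rintro f g ⟨hfG, hf⟩ ⟨hgG, hg⟩
    refine ⟨G.mul_mem hfG hgG, ?_⟩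
    rw [irrot_iff] at hf hg ⊢
    obtain ⟨hfi, F, hF, hFr⟩ := hf
    obtain ⟨hgi, F', hF', hFr'⟩ := hg
    refine ⟨iso_mul hfi hgi, F ∘ F', lift_mul hF hF', fun μ hμ hs => ?_⟩
    obtain ⟨ν, hν, hνs, hνr⟩ := key (f * g) (G.mul_mem hfG hgG) (iso_mul hfi hgi) (F ∘ F')
      (lift_mul hF hF') μ hμ hs
    rw [← hνr, rot_comp (lift1_of hF (mcg_isotopic hfi)) (lift1_of hF' (mcg_isotopic hgi))
      (hνs (h0 g hgG hgi)) (lift1_of (lift_mul hF hF') (mcg_isotopic (iso_mul hfi hgi))),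
      hFr ν hν (hνs (h0 f hfG hfi)), hFr' ν hν (hνs (h0 g hgG hgi)), add_zero]
  · refine ⟨G.one_mem, irrot_iff.2 ⟨iso_one, id, lift_one, fun μ hμ _ => ?_⟩⟩
    simp [rot, disp, desc]
  · rintro f ⟨hfG, hf⟩
    exact ⟨G.inv_mem hfG, irrot_inv hf⟩
  · rintro g hg f ⟨hfG, hf⟩
    exact ⟨G.mul_mem (G.mul_mem hg hfG) (G.inv_mem hg), irrot_conj g hf⟩
  · intro hall
    have hGH : G ≤ H := fun ψ hψ => h0 ψ hψ (hall ψ hψ)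
    ext f
    refine and_congr_right fun hfG => ?_
    rw [irrot_iff, irrotFor_iff]
    refine and_congr_right fun hi => exists_congr fun F => and_congr_right fun hF => ?_
    constructor
    · intro h μ hμ hs
      exact h μ hμ (hs hfG)
    · intro h μ hμ hs
      obtain ⟨ν, hν, hνs, hνr⟩ := key f hfG hi F hF μ hμ hs
      rw [← hνr]
      exact h ν hν (hGH.trans hνs)
end

section
/- Let 𝒢 be a nilpotent subgroup of GL(2,ℤ). Then 𝒢 is either of the form ⟨N⟩ or ⟨N, −N⟩ for some N ∈ 𝒢, or 𝒢 is conjugate by a matrix in GL(2,ℚ) to the 8-element group ℋ = {Id, −Id, diag(1,−1), diag(−1,1), [[0,−1],[1,0]], [[0,1],[−1,0]], [[0,1],[1,0]], [[0,−1],[−1,0]]} (a group isomorphic to the dihedral group D₄ of order 8). -/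
noncomputable section

/-- The eight-element dihedral group ℋ ≅ D₄ inside GL(2,ℚ), given as a set of
matrices. -/
def dihedralH : Set (Matrix (Fin 2) (Fin 2) ℚ) :=
  {1, -1, !![1, 0; 0, -1], !![-1, 0; 0, 1], !![0, -1; 1, 0], !![0, 1; -1, 0],
    !![0, 1; 1, 0], !![0, -1; -1, 0]}


abbrev M2 := Matrix (Fin 2) (Fin 2) ℤ

/-- a matrix commuting with two non-commuting matrices is scalar -/
lemma scalar_of_comm (g h X : M2) (hgh : g * h ≠ h * g) (h1 : X * g = g * X) (h2 : X * h = h * X) :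
    ∃ s : ℤ, X = s • (1 : M2) := by
  have key : X 0 1 = 0 ∧ X 1 0 = 0 ∧ X 0 0 = X 1 1 := by
    by_contra hne
    apply hgh
    have a00 := congrFun (congrFun h1 0) 0
    have a01 := congrFun (congrFun h1 0) 1
    have a10 := congrFun (congrFun h1 1) 0
    have b00 := congrFun (congrFun h2 0) 0
    have b01 := congrFun (congrFun h2 0) 1
    have b10 := congrFun (congrFun h2 1) 0
    simp only [Matrix.mul_apply, Fin.sum_univ_two] at a00 a01 a10 b00 b01 b10
    have e1 : g 0 1 * h 1 0 = g 1 0 * h 0 1 ∧ g 0 1 * (h 0 0 - h 1 1) = h 0 1 * (g 0 0 - g 1 1) ∧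
        g 1 0 * (h 0 0 - h 1 1) = h 1 0 * (g 0 0 - g 1 1) := by
      by_cases hx : X 0 1 = 0
      · by_cases hy : X 1 0 = 0
        · have hz : X 0 0 - X 1 1 ≠ 0 := fun hz => hne ⟨hx, hy, by linarith⟩
          refine ⟨?_, ?_, ?_⟩ <;> apply mul_left_cancel₀ hz
          · linear_combination (h 1 0) * a01 + h 0 1 * a10 + (g 0 0 - g 1 1) * h 1 0 * hx - (g 0 0 - g 1 1) * h 0 1 * hy
          · linear_combination (h 0 0 - h 1 1) * a01 - (g 0 0 - g 1 1) * b01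
          · linear_combination -(h 0 0 - h 1 1) * a10 + (g 0 0 - g 1 1) * b10
        · refine ⟨?_, ?_, ?_⟩ <;> apply mul_left_cancel₀ hy
          · linear_combination - (h 1 0) * a00 + (g 1 0) * b00
          · linear_combination (-(h 0 0 - h 1 1)) * a00 + (g 0 0 - g 1 1) * b00 + (g 1 0 * (h 0 0 - h 1 1) - h 1 0 * (g 0 0 - g 1 1)) * hx
          · linear_combination g 1 0 * b10 - h 1 0 * a10
      · have e2 : g 0 1 * (h 0 0 - h 1 1) = h 0 1 * (g 0 0 - g 1 1) := by
          apply mul_left_cancel₀ hx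
          linear_combination  -g 0 1 * b01 + h 0 1 * a01
        refine ⟨?_, e2, ?_⟩ <;> apply mul_left_cancel₀ hx
        · linear_combination -(h 0 1) * a00 + (g 0 1) * b00
        · linear_combination (h 0 0 - h 1 1) * a00 - (g 0 0 - g 1 1) * b00 + X 1 0 * e2
    obtain ⟨e1, e2, e3⟩ := e1
    ext i j
    fin_cases i <;> fin_cases j <;> simp [Matrix.mul_apply, Fin.sum_univ_two] <;> linarith
  refine ⟨X 0 0, ?_⟩
  ext i j
  fin_cases i <;> fin_cases j <;> simp [key]

lemma det_pm (c : GL (Fin 2) ℤ) : (c : M2).det = 1 ∨ (c : M2).det = -1 := by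
  have : IsUnit (c : M2).det := (Matrix.isUnit_iff_isUnit_det _).1 c.isUnit
  exact Int.isUnit_iff.1 this

lemma scalar_unit (c : GL (Fin 2) ℤ) (s : ℤ) (h : (c : M2) = s • (1 : M2)) : c = 1 ∨ c = -1 := by
  have hd := det_pm c
  rw [h, Matrix.det_fin_two] at hd
  simp at hd
  have : s = 1 ∨ s = -1 := by
    have : IsUnit s := by
      rcases hd with hd | hd
      · exact IsUnit.of_mul_eq_one _ hd
      · exact IsUnit.of_mul_eq_one (-s) (by linarith)
    exact Int.isUnit_iff.1 this
  rcases this with rfl | rfl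
  · left; ext1; simpa using h
  · right; ext1; simpa using h

lemma central_pm (g h c : GL (Fin 2) ℤ) (hgh : g * h ≠ h * g) (h1 : c * g = g * c)
    (h2 : c * h = h * c) : c = 1 ∨ c = -1 := by
  obtain ⟨s, hs⟩ := scalar_of_comm g h c (fun H => hgh (Units.ext H))
    (congrArg Units.val h1) (congrArg Units.val h2)
  exact scalar_unit c s hs

lemma num1 (B C u v : ℤ) (hB : 0 < B) (hC : 0 < C) (hCB : C ≤ B)
    (h : u ^ 2 - v ^ 2 = -4 * (B ^ 2 + C ^ 2)) (hu : B ≤ u) (hv : 2 * B < v - u) : False := by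
  have h1 : 2 * B * (4 * B) < (v - u) * (v + u) :=
    mul_lt_mul'' hv (by linarith) (by linarith) (by linarith)
  nlinarith

lemma num2 (B C u v : ℤ) (hB : 0 < B) (hC : 0 < C) (hCB : C < B)
    (h : u ^ 2 - v ^ 2 = 4 * (B ^ 2 + C ^ 2)) (hu : 3 * B ≤ u) (hv0 : 0 ≤ v)
    (hv : 2 * B ≤ u - v) : False := by
  have hC2 : C ^ 2 < B ^ 2 := by nlinarith
  have hu2 : 9 * B ^ 2 ≤ u ^ 2 := by nlinarith
  have hvB : B ≤ v := by
    by_contra! hc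
    have : v ^ 2 < B ^ 2 := by nlinarith
    linarith
  have h1 : 2 * B * (4 * B) ≤ (u - v) * (v + u) :=
    mul_le_mul hv (by linarith) (by linarith) (by linarith)
  nlinarith

/-- numeric descent lemma -/
lemma descent (b β T U d n : ℤ) (hb : b ≠ 0) (hβ : β ≠ 0) (hd : d = 1 ∨ d = -1)
    (hn : n = 1 ∨ n = -1) (hrel : β ^ 2 * (T ^ 2 - 4 * d) = b ^ 2 * (U ^ 2 - 4 * n))
    (hm : 4 * |β| + n ≤ 4 * |b| + d) :
    (|T * β + b * U| < 2 * |b| ∨ |b * U - T * β| < 2 * |b|) ∨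
    (d = 1 ∧ n = -1 ∧ (|T * β + b * U| ≤ 2 * |b| ∨ |b * U - T * β| ≤ 2 * |b|)) := by
  have hb0 : 0 < |b| := abs_pos.2 hb
  have hβ0 : 0 < |β| := abs_pos.2 hβ
  have hpq : (T * β + b * U) * (b * U - T * β) = 4 * (n * b ^ 2 - d * β ^ 2) := by
    linear_combination -hrel
  have sb : |b| ^ 2 = b ^ 2 := sq_abs b
  have sβ : |β| ^ 2 = β ^ 2 := sq_abs β
  have hle : |β| ≤ |b| := by rcases hd with rfl | rfl <;> rcases hn with rfl | rfl <;> omega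
  by_cases hnd : n = d
  · left
    by_contra! hc
    have h1 : 4 * |b| ^ 2 ≤ |(T * β + b * U) * (b * U - T * β)| := by
      rw [abs_mul]; nlinarith [hc.1, hc.2]
    have h2 : |(T * β + b * U) * (b * U - T * β)| < 4 * |b| ^ 2 := by
      rw [hpq, hnd, sb, abs_lt]
      have : β ^ 2 ≤ b ^ 2 := by nlinarith
      have : 0 < β ^ 2 := by positivity
      rcases hd with rfl | rfl <;> constructor <;> nlinarith
    omega
  have hmin : min |T * β + b * U| |b * U - T * β| = abs (|b * U| - |T * β|) := by
    rcases abs_cases (T * β + b * U) with h | h <;> rcases abs_cases (b * U - T * β) with h' | h' <;>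
    rcases abs_cases (b * U) with h1 | h1 <;> rcases abs_cases (T * β) with h2 | h2 <;>
    rcases abs_cases (|b * U| - |T * β|) with h3 | h3 <;> omega
  have hdiff : |b * U| ^ 2 - |T * β| ^ 2 = 4 * (n * b ^ 2 - d * β ^ 2) := by
    rw [sq_abs, sq_abs]; linear_combination hpq
  have hβb : β ^ 2 ≤ b ^ 2 := by nlinarith
  have hu0 := abs_nonneg (b * U)
  have hv0 := abs_nonneg (T * β)
  have hbu : |b * U| = |b| * |U| := abs_mul _ _
  rcases hd with rfl | rfl <;> rcases hn with rfl | rfl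
  · exact absurd rfl hnd
  · right
    refine ⟨rfl, rfl, ?_⟩
    rw [← min_le_iff, hmin]
    by_contra! hc
    have hU : U ≠ 0 := by
      rintro rfl
      have h1 : β ^ 2 ∣ (2 * b) ^ 2 := ⟨T ^ 2 - 4 * 1, by linear_combination -hrel⟩
      obtain ⟨m, hmm⟩ := (Int.pow_dvd_pow_iff two_ne_zero).1 h1
      have h2 : T ^ 2 - 4 = m ^ 2 := by
        apply mul_left_cancel₀ (pow_ne_zero 2 hβ)
        linear_combination hrel + (2 * b + β * m) * hmm
      have hm0 : m ≠ 0 := by rintro rfl; simp at hmm; exact hb hmm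
      have h3 : |T| ^ 2 - 4 = |m| ^ 2 := by rw [sq_abs, sq_abs, h2]
      have h4 : 0 < |m| := abs_pos.2 hm0
      have h5 : |m| < |T| := by nlinarith [abs_nonneg T]
      have h6 : |m| < 2 := by nlinarith
      have h7 : |m| = 1 := by omega
      rw [h7] at h3
      have h8 : |T| < 3 := by nlinarith
      have h9 : |T| = 2 := by omega
      rw [h9] at h3; omega
    have hU1 : 1 ≤ |U| := Int.one_le_abs hU
    have hub : |b| ≤ |b * U| := by rw [hbu]; nlinarith
    have hlt : |b * U| < |T * β| := by
      have : 0 < b ^ 2 := by positivity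
      nlinarith
    rw [abs_of_neg (sub_neg.2 hlt)] at hc
    exact num1 |b| |β| |b * U| |T * β| hb0 hβ0 hle (by rw [sb, sβ]; linear_combination hdiff) hub (by linarith)
  · left
    rw [← min_lt_iff, hmin]
    by_contra! hc
    have hlt' : |β| < |b| := by omega
    have hU2 : 4 < U ^ 2 := by
      have : 0 < b ^ 2 := by positivity
      have : 0 < β ^ 2 := by positivity
      by_contra! h
      nlinarith [sq_nonneg T, mul_nonneg (sq_nonneg β) (sq_nonneg T)]
    have hU1 : 3 ≤ |U| := by
      have := sq_abs U
      by_contra! h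
      have : |U| ≤ 2 := by omega
      nlinarith [abs_nonneg U]
    have hub : 3 * |b| ≤ |b * U| := by rw [hbu]; nlinarith
    have hlt : |T * β| < |b * U| := by
      have : 0 < b ^ 2 := by positivity
      nlinarith
    rw [abs_of_pos (sub_pos.2 hlt)] at hc
    exact num2 |b| |β| |b * U| |T * β| hb0 hβ0 hlt' (by rw [sb, sβ]; linear_combination hdiff) hub hv0 hc
  · exact absurd rfl hnd

/-- the linear functional attached to a fixed matrix `g`, vanishing on scalars -/
def lf (g c : M2) : ℤ := g 0 1 * c 0 1 + g 1 0 * c 1 0 + (g 0 0 - g 1 1) * (c 0 0 - c 1 1)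

lemma comm_entries (g c : M2) (h1 : c * g = g * c) :
    c 0 1 * g 1 0 = g 0 1 * c 1 0 ∧ c 0 1 * (g 0 0 - g 1 1) = g 0 1 * (c 0 0 - c 1 1) ∧
    c 1 0 * (g 0 0 - g 1 1) = g 1 0 * (c 0 0 - c 1 1) := by
  have a00 := congrFun (congrFun h1 0) 0
  have a01 := congrFun (congrFun h1 0) 1
  have a10 := congrFun (congrFun h1 1) 0
  simp only [Matrix.mul_apply, Fin.sum_univ_two] at a00 a01 a10
  refine ⟨by linarith, by linarith, by linarith⟩

lemma lf_prop (g c : M2) (h1 : c * g = g * c) :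
    lf g g * c 0 1 = lf g c * g 0 1 ∧ lf g g * c 1 0 = lf g c * g 1 0 ∧
    lf g g * (c 0 0 - c 1 1) = lf g c * (g 0 0 - g 1 1) := by
  obtain ⟨e1, e2, e3⟩ := comm_entries g c h1
  unfold lf
  refine ⟨?_, ?_, ?_⟩
  · linear_combination g 1 0 * e1 + (g 0 0 - g 1 1) * e2
  · linear_combination -g 0 1 * e1 + (g 0 0 - g 1 1) * e3
  · linear_combination -g 0 1 * e2 - g 1 0 * e3

lemma lf_disc (g c : M2) (h1 : c * g = g * c) :
    lf g g ^ 2 * (c.trace ^ 2 - 4 * c.det) = (lf g c) ^ 2 * (g.trace ^ 2 - 4 * g.det) := by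
  obtain ⟨e1, e2, e3⟩ := lf_prop g c h1
  simp only [Matrix.trace_fin_two, Matrix.det_fin_two]
  linear_combination 4 * lf g g * c 1 0 * e1 + 4 * lf g c * g 0 1 * e2 +
    (lf g g * (c 0 0 - c 1 1) + lf g c * (g 0 0 - g 1 1)) * e3

lemma lf_mul (g c e : M2) (h : c * e = e * c) :
    2 * lf g (c * e) = c.trace * lf g e + lf g c * e.trace := by
  obtain ⟨e1, e2, e3⟩ := comm_entries e c h
  simp only [lf, Matrix.trace_fin_two, Matrix.mul_apply, Fin.sum_univ_two]
  linear_combination 2 * (g 0 0 - g 1 1) * e1 - g 0 1 * e2 + g 1 0 * e3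

lemma lf_adj (g c : M2) : lf g c.adjugate = - lf g c := by
  simp [lf, Matrix.adjugate_fin_two]; ring

lemma lf_smul (g c : M2) (s : ℤ) : lf g (s • c) = s * lf g c := by
  simp [lf]; ring

lemma inv_eq (c : GL (Fin 2) ℤ) :
    ((c⁻¹ : GL (Fin 2) ℤ) : M2) = (c : M2).det • (c : M2).adjugate := by
  have h : (c : M2) * ((c : M2).det • (c : M2).adjugate) = 1 := by
    rw [Matrix.mul_smul, Matrix.mul_adjugate, smul_smul]
    rcases det_pm c with h | h <;> simp [h]
  calc ((c⁻¹ : GL (Fin 2) ℤ) : M2) = (c⁻¹ : GL (Fin 2) ℤ) * ((c : M2) * ((c : M2).det • (c : M2).adjugate)) := by rw [h, mul_one]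
    _ = _ := by rw [← mul_assoc]; simp

lemma lf_mul_inv (g : M2) (c e : GL (Fin 2) ℤ) (h : c * e = e * c) :
    2 * lf g ((c * e⁻¹ : GL (Fin 2) ℤ) : M2) =
      (e : M2).det * (lf g c * (e : M2).trace - (c : M2).trace * lf g e) := by
  have hc : c * e⁻¹ = e⁻¹ * c := (Commute.inv_right (show Commute c e from h)).eq
  rw [Units.val_mul, lf_mul g _ _ (congrArg Units.val hc), inv_eq, lf_smul, lf_adj,
    Matrix.trace_smul, Matrix.adjugate_fin_two]
  simp [Matrix.trace_fin_two]; ring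

lemma abelian_core (G : Subgroup (GL (Fin 2) ℤ)) (hab : ∀ x ∈ G, ∀ y ∈ G, x * y = y * x) :
    ∃ N ∈ G, ∀ c ∈ G, ∃ k : ℤ, c = N ^ k ∨ c = - N ^ k := by
  by_cases hs : ∀ c ∈ G, c = 1 ∨ c = -1
  · exact ⟨1, G.one_mem, fun c hc => ⟨0, by simpa using hs c hc⟩⟩
  push Not at hs
  obtain ⟨g, hg, hg1, hg2⟩ := hs
  have scal : ∀ c : GL (Fin 2) ℤ, (c : M2) 0 1 = 0 → (c : M2) 1 0 = 0 → (c : M2) 0 0 - (c : M2) 1 1 = 0 →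
      c = 1 ∨ c = -1 := by
    intro c h1 h2 h3
    apply scalar_unit c ((c : M2) 0 0)
    ext i j
    fin_cases i <;> fin_cases j <;> simp [h1, h2]
    linarith
  have hgg : lf g g ≠ 0 := by
    intro h0
    have h0' := h0
    unfold lf at h0'
    rcases scal g (by nlinarith [sq_nonneg ((g : M2) 0 1), sq_nonneg ((g : M2) 1 0), sq_nonneg ((g : M2) 0 0 - (g : M2) 1 1)])
      (by nlinarith [sq_nonneg ((g : M2) 0 1), sq_nonneg ((g : M2) 1 0), sq_nonneg ((g : M2) 0 0 - (g : M2) 1 1)])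
      (by nlinarith [sq_nonneg ((g : M2) 0 1), sq_nonneg ((g : M2) 1 0), sq_nonneg ((g : M2) 0 0 - (g : M2) 1 1)]) with h | h
    · exact hg1 h
    · exact hg2 h
  have hcomm : ∀ x ∈ G, ∀ y ∈ G, (x : M2) * y = y * x := fun x hx y hy =>
    congrArg Units.val (hab x hx y hy)
  have hz : ∀ c ∈ G, lf g c = 0 → c = 1 ∨ c = -1 := by
    intro c hc h0
    obtain ⟨e1, e2, e3⟩ := lf_prop g c (hcomm c hc g hg)
    rw [h0, zero_mul] at e1 e2 e3
    exact scal c ((mul_eq_zero.1 e1).resolve_left hgg) ((mul_eq_zero.1 e2).resolve_left hgg)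
      ((mul_eq_zero.1 e3).resolve_left hgg)
  let μ : GL (Fin 2) ℤ → ℕ := fun c => (4 * |lf g c| + (c : M2).det + 1).toNat
  have hμ : ∀ c, (μ c : ℤ) = 4 * |lf g c| + (c : M2).det + 1 := by
    intro c
    apply Int.toNat_of_nonneg
    have := abs_nonneg (lf g c)
    rcases det_pm c with h | h <;> omega
  obtain ⟨N, ⟨hN, hN0⟩, hmin⟩ := exists_minimalFor_of_wellFoundedLT
    (fun c : GL (Fin 2) ℤ => c ∈ G ∧ lf g c ≠ 0) μ ⟨g, hg, hgg⟩
  refine ⟨N, hN, ?_⟩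
  suffices H : ∀ m : ℕ, ∀ c ∈ G, μ c = m → ∃ k : ℤ, c = N ^ k ∨ c = - N ^ k from
    fun c hc => H _ c hc rfl
  intro m
  induction m using Nat.strong_induction_on with
  | _ m ih =>
  rintro c hc rfl
  by_cases hb : lf g c = 0
  · exact ⟨0, by simpa using hz c hc hb⟩
  have hle : μ N ≤ μ c := by
    by_contra! h
    exact absurd (hmin ⟨hc, hb⟩ h.le) (by omega)
  have hrel : (lf g N) ^ 2 * ((c : M2).trace ^ 2 - 4 * (c : M2).det) =
      (lf g c) ^ 2 * ((N : M2).trace ^ 2 - 4 * (N : M2).det) := by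
    apply mul_left_cancel₀ (pow_ne_zero 2 hgg)
    linear_combination (lf g N) ^ 2 * lf_disc g c (hcomm c hc g hg) -
      (lf g c) ^ 2 * lf_disc g N (hcomm N hN g hg)
  have p1 := lf_mul g c N (hcomm c hc N hN)
  have p2 := lf_mul_inv g c N (hab c hc N hN)
  have hdN := det_pm N
  have hdc := det_pm c
  have d1 : ((c * N : GL (Fin 2) ℤ) : M2).det = (c : M2).det * (N : M2).det := by
    rw [Units.val_mul, Matrix.det_mul]
  have d2 : ((c * N⁻¹ : GL (Fin 2) ℤ) : M2).det = (c : M2).det * (N : M2).det := by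
    have : ((c * N⁻¹ : GL (Fin 2) ℤ) : M2).det * (N : M2).det = (c : M2).det := by
      rw [← Matrix.det_mul, ← Units.val_mul]; simp
    rw [← this, mul_assoc]
    rcases hdN with h | h <;> simp [h]
  have a1 : 2 * |lf g (c * N : GL (Fin 2) ℤ)| = |(c : M2).trace * lf g N + lf g c * (N : M2).trace| := by
    rw [← p1, abs_mul]; simp
  have a2 : 2 * |lf g (c * N⁻¹ : GL (Fin 2) ℤ)| = |lf g c * (N : M2).trace - (c : M2).trace * lf g N| := by
    have : |2 * lf g (c * N⁻¹ : GL (Fin 2) ℤ)| = |lf g c * (N : M2).trace - (c : M2).trace * lf g N| := by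
      rw [p2, abs_mul]
      rcases hdN with h | h <;> simp [h]
    rw [← this, abs_mul]; simp
  have key : μ (c * N) < μ c ∨ μ (c * N⁻¹) < μ c := by
    have m1 := hμ c
    have m2 := hμ N
    have m3 := hμ (c * N)
    have m4 := hμ (c * N⁻¹)
    rw [d1] at m3
    rw [d2] at m4
    rcases descent (lf g c) (lf g N) (c : M2).trace (N : M2).trace (c : M2).det (N : M2).det
      hb hN0 hdc hdN hrel (by omega) with h | ⟨h1, h2, h⟩
    · rw [← a1, ← a2] at h
      rcases hdc with hd | hd <;> rcases hdN with hn | hn <;> rw [hd, hn] at m3 m4 <;>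
        rw [hd] at m1 <;> omega
    · rw [← a1, ← a2] at h
      rw [h1, h2] at m3 m4
      rw [h1] at m1
      omega
  rcases key with h | h
  · obtain ⟨k, hk⟩ := ih _ h (c * N) (G.mul_mem hc hN) rfl
    refine ⟨k - 1, ?_⟩
    rw [zpow_sub_one, ← neg_mul]
    exact hk.imp eq_mul_inv_of_mul_eq eq_mul_inv_of_mul_eq
  · obtain ⟨k, hk⟩ := ih _ h (c * N⁻¹) (G.mul_mem hc (G.inv_mem hN)) rfl
    refine ⟨k + 1, ?_⟩
    rw [zpow_add_one, ← neg_mul]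
    exact hk.imp eq_mul_of_mul_inv_eq eq_mul_of_mul_inv_eq

lemma abelian_case (G : Subgroup (GL (Fin 2) ℤ)) (hab : ∀ x ∈ G, ∀ y ∈ G, x * y = y * x) :
    (∃ N ∈ G, G = Subgroup.closure {N}) ∨ (∃ N ∈ G, G = Subgroup.closure {N, -N}) := by
  obtain ⟨N, hN, H⟩ := abelian_core G hab
  by_cases h1 : (-1 : GL (Fin 2) ℤ) ∈ G
  · right
    refine ⟨N, hN, le_antisymm ?_ ?_⟩
    · intro c hc
      have hNc : N ∈ Subgroup.closure {N, -N} := Subgroup.subset_closure (by simp)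
      have hNc' : -N ∈ Subgroup.closure {N, -N} := Subgroup.subset_closure (by simp)
      have hm : (-1 : GL (Fin 2) ℤ) ∈ Subgroup.closure {N, -N} := by
        have := Subgroup.mul_mem _ hNc' (Subgroup.inv_mem _ hNc)
        simpa using this
      obtain ⟨k, rfl | rfl⟩ := H c hc
      · exact Subgroup.zpow_mem _ hNc k
      · rw [← neg_one_mul (N ^ k)]; exact Subgroup.mul_mem _ hm (Subgroup.zpow_mem _ hNc k)
    · rw [Subgroup.closure_le]
      rintro x (rfl | rfl)
      · exact hN
      · rw [← neg_one_mul]; exact G.mul_mem h1 hN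
  · left
    refine ⟨N, hN, le_antisymm ?_ ?_⟩
    · intro c hc
      have hNc : N ∈ Subgroup.closure {N} := Subgroup.subset_closure (by simp)
      obtain ⟨k, rfl | rfl⟩ := H c hc
      · exact Subgroup.zpow_mem _ hNc k
      · exfalso
        apply h1
        have := G.mul_mem hc (G.inv_mem (G.zpow_mem hN k))
        simpa using this
    · rw [Subgroup.closure_le]
      rintro x rfl
      exact hN

lemma bad (g h c : M2) (hg : g * g = -1) (hgh : g * h = -(h * g)) (hne : g * h ≠ h * g)
    (hcg : c * g = g * c) (hch : c * h = g * h * c)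
    (dg : g.det = 1 ∨ g.det = -1) (dc : c.det = 1 ∨ c.det = -1) : False := by
  have hhg : h * g = -(g * h) := by rw [hgh, neg_neg]
  obtain ⟨s, hs⟩ := scalar_of_comm g h ((1 - g) * c) hne (by
      rw [mul_assoc, hcg]; noncomm_ring) (by
      have e1 : (1 - g) * c * h = g * h * c - (g * g) * h * c := by
        rw [mul_assoc, hch]; noncomm_ring
      have e2 : h * ((1 - g) * c) = h * c - (h * g) * c := by noncomm_ring
      rw [e1, e2, hg, hhg]; noncomm_ring)
  have h2 : ((1 - g) * c) * ((1 - g) * c) = (-2 : ℤ) • (g * (c * c)) := by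
    have : ((1 - g) * c) * ((1 - g) * c) = c * c - g * (c * c) - (c * g) * c + g * (c * g) * c := by
      noncomm_ring
    rw [this, hcg]
    have e : g * (g * c) * c = (g * g) * (c * c) := by noncomm_ring
    rw [e, hg]; noncomm_ring
  have h3 := congrArg Matrix.det h2
  rw [hs] at h3
  have h4 : (s • (1 : M2)) * (s • (1 : M2)) = (s * s) • (1 : M2) := by simp [smul_smul]
  rw [h4, Matrix.det_smul, Matrix.det_smul, Matrix.det_mul, Matrix.det_mul] at h3
  simp at h3
  have h5 : (s ^ 2) ^ 2 = 4 * g.det := by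
    rcases dc with d | d <;> rw [d] at h3 <;> linarith
  rcases dg with d | d
  · rw [d] at h5
    have h6 : s ^ 2 = 2 := by nlinarith [sq_nonneg s]
    have h7 : s < 2 := by nlinarith
    have h8 : -2 < s := by nlinarith
    interval_cases s <;> omega
  · rw [d] at h5; nlinarith [sq_nonneg (s ^ 2)]

lemma noQ8 (g h : M2) (hg : g * g = -1) (hh : h * h = -1) (hgh : g * h = -(h * g)) : False := by
  have a00 := congrFun (congrFun hg 0) 0
  have a01 := congrFun (congrFun hg 0) 1
  have a10 := congrFun (congrFun hg 1) 0
  have a11 := congrFun (congrFun hg 1) 1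
  have b00 := congrFun (congrFun hh 0) 0
  have b01 := congrFun (congrFun hh 0) 1
  have b10 := congrFun (congrFun hh 1) 0
  have b11 := congrFun (congrFun hh 1) 1
  have c00 := congrFun (congrFun hgh 0) 0
  simp [Matrix.mul_apply, Fin.sum_univ_two] at a00 a01 a10 a11 b00 b01 b10 b11 c00
  have h1 : (g 0 1 * h 1 0 + g 1 0 * h 0 1) ^ 2 = 4 * (g 0 0) ^ 2 * (h 0 0) ^ 2 := by
    have : g 0 1 * h 1 0 + g 1 0 * h 0 1 = - (2 * g 0 0 * h 0 0) := by linarith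
    rw [this]; ring
  have h2 : (g 0 1 * h 1 0) * (g 1 0 * h 0 1) = (1 + g 0 0 ^ 2) * (1 + h 0 0 ^ 2) := by
    have e1 : g 0 1 * g 1 0 = -(1 + g 0 0 ^ 2) := by linarith
    have e2 : h 0 1 * h 1 0 = -(1 + h 0 0 ^ 2) := by linarith
    calc _ = (g 0 1 * g 1 0) * (h 0 1 * h 1 0) := by ring
      _ = _ := by rw [e1, e2]; ring
  nlinarith [sq_nonneg (g 0 1 * h 1 0 - g 1 0 * h 0 1), sq_nonneg (g 0 0), sq_nonneg (h 0 0)]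

lemma exists_anti (G : Subgroup (GL (Fin 2) ℤ)) (hn : Group.IsNilpotent G)
    (hna : ¬ ∀ x ∈ G, ∀ y ∈ G, x * y = y * x) :
    ∃ g ∈ G, ∃ h ∈ G, g * h = -(h * g) ∧ ∀ y ∈ G, g * y = y * g ∨ g * y = -(y * g) := by
  have hcen : ∀ z : G, z ∈ Subgroup.center G → (z : GL (Fin 2) ℤ) = 1 ∨ (z : GL (Fin 2) ℤ) = -1 := by
    push Not at hna
    obtain ⟨x, hx, y, hy, hxy⟩ := hna
    intro z hz
    rw [Subgroup.mem_center_iff] at hz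
    exact central_pm x y z hxy (congrArg Subtype.val (hz ⟨x, hx⟩)).symm
      (congrArg Subtype.val (hz ⟨y, hy⟩)).symm
  have hex : ∃ x ∈ Subgroup.upperCentralSeries G 2, x ∉ Subgroup.upperCentralSeries G 1 := by
    by_contra! hc
    have hall : ∀ n, ∀ x ∈ Subgroup.upperCentralSeries G n, x ∈ Subgroup.upperCentralSeries G 1 := by
      intro n
      induction n with
      | zero =>
        intro x hx
        rw [Subgroup.upperCentralSeries_zero, Subgroup.mem_bot] at hx
        rw [hx]; exact Subgroup.one_mem _
      | succ n ih =>
        intro x hx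
        apply hc
        rw [Subgroup.mem_upperCentralSeries_succ_iff] at hx ⊢
        exact fun y => ih _ (hx y)
    obtain ⟨n, hn⟩ := hn.nilpotent'
    apply hna
    intro x hx y hy
    have := hall n ⟨x, hx⟩ (by rw [hn]; trivial)
    rw [Subgroup.upperCentralSeries_one, Subgroup.mem_center_iff] at this
    exact (congrArg Subtype.val (this ⟨y, hy⟩)).symm
  obtain ⟨g, hg2, hg1⟩ := hex
  have hall : ∀ y ∈ G, (g : GL (Fin 2) ℤ) * y = y * g ∨ (g : GL (Fin 2) ℤ) * y = -(y * g) := by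
    intro y hy
    rw [Subgroup.mem_upperCentralSeries_succ_iff] at hg2
    have h1 := hg2 ⟨y, hy⟩
    rw [Subgroup.upperCentralSeries_one] at h1
    have h2 := hcen _ h1
    simp only [commutatorElement_def, Subgroup.coe_mul, Subgroup.coe_inv] at h2
    rcases h2 with h2 | h2
    · left
      rw [mul_inv_eq_iff_eq_mul, mul_inv_eq_iff_eq_mul] at h2
      rw [h2, one_mul]
    · right
      rw [mul_inv_eq_iff_eq_mul, mul_inv_eq_iff_eq_mul] at h2
      rw [h2, neg_mul, neg_mul, one_mul]
  refine ⟨g, g.2, ?_⟩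
  rw [Subgroup.upperCentralSeries_one, Subgroup.mem_center_iff] at hg1
  push Not at hg1
  obtain ⟨h, hh⟩ := hg1
  refine ⟨h, h.2, ?_, hall⟩
  exact (hall h h.2).resolve_left (fun H => hh (Subtype.ext H.symm))

lemma ne_neg_gl (x : GL (Fin 2) ℤ) : x ≠ -x := by
  intro h
  have h1 : (1 : GL (Fin 2) ℤ) = -1 := by
    have := congrArg (· * x⁻¹) h
    simpa using this
  have h3 : ((1 : GL (Fin 2) ℤ) : M2) = ((-1 : GL (Fin 2) ℤ) : M2) := by rw [← h1]
  have h2 := congrFun (congrFun h3 0) 0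
  simp at h2

section
variable {G : Subgroup (GL (Fin 2) ℤ)} {g h : GL (Fin 2) ℤ}

lemma anti_ne (hgh : g * h = -(h * g)) : g * h ≠ h * g := by
  intro H; rw [H] at hgh; exact ne_neg_gl _ hgh

lemma anti_sq (hgh : g * h = -(h * g)) : g * g = 1 ∨ g * g = -1 := by
  apply central_pm g h _ (anti_ne hgh) (mul_assoc _ _ _)
  rw [mul_assoc, hgh, mul_neg, ← mul_assoc, hgh, neg_mul, neg_neg, mul_assoc]

lemma anti_symm (hgh : g * h = -(h * g)) : h * g = -(g * h) := by rw [hgh, neg_neg]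

set_option maxHeartbeats 2000000 in
lemma comm_list (hh : h ∈ G) (hgh : g * h = -(h * g)) (n : ℕ) :
    ∀ c : G, c ∈ Subgroup.upperCentralSeries G n → (c : GL (Fin 2) ℤ) * g = g * c →
      (c : GL (Fin 2) ℤ) = 1 ∨ (c : GL (Fin 2) ℤ) = -1 ∨ (c : GL (Fin 2) ℤ) = g ∨
        (c : GL (Fin 2) ℤ) = -g := by
  have hne := anti_ne hgh
  have hhg := anti_symm hgh
  induction n with
  | zero =>
    intro c hc _
    rw [Subgroup.upperCentralSeries_zero, Subgroup.mem_bot] at hc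
    left; rw [hc]; rfl
  | succ n ih =>
    rintro ⟨c, hcG⟩ hc hcg
    rw [Subgroup.mem_upperCentralSeries_succ_iff] at hc
    have h1 := ih _ (hc ⟨h, hh⟩)
    simp only [commutatorElement_def, Subgroup.coe_mul, Subgroup.coe_inv] at h1 hcg ⊢
    have hcig : c⁻¹ * g = g * c⁻¹ := (Commute.inv_left (show Commute c g from hcg)).eq
    have hhig : h⁻¹ * g = -(g * h⁻¹) := by
      rw [inv_mul_eq_iff_eq_mul, mul_neg, ← mul_assoc, hhg, neg_mul, neg_neg, mul_assoc,
        mul_inv_cancel, mul_one]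
    have h2 := h1 (by
      calc c * h * c⁻¹ * h⁻¹ * g = c * h * c⁻¹ * (h⁻¹ * g) := by group
        _ = -(c * h * (c⁻¹ * g) * h⁻¹) := by rw [hhig]; simp only [mul_neg, mul_assoc]
        _ = -(c * (h * g) * c⁻¹ * h⁻¹) := by rw [hcig]; simp only [mul_assoc]
        _ = (c * g) * h * c⁻¹ * h⁻¹ := by rw [hhg]; simp only [mul_neg, neg_mul, neg_neg, mul_assoc]
        _ = _ := by rw [hcg]; simp only [mul_assoc])
    simp only [mul_inv_eq_iff_eq_mul] at h2
    have hsq := anti_sq hhg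
    have main : ∀ e : GL (Fin 2) ℤ, e * h = -(h * e) → c * e = e * c → c * h = e * h * c → False := by
      intro e he hce hch
      have hee : e * e = -1 := by
        have k1 : c * (h * h) = -(e * e) * (h * h) * c := by
          calc c * (h * h) = e * h * (c * h) := by rw [← mul_assoc, ← mul_assoc, ← hch]
            _ = e * (h * e) * h * c := by rw [hch]; simp only [mul_assoc]
            _ = _ := by
              rw [anti_symm he]; simp only [mul_neg, neg_mul, mul_assoc]
        have k2 : c = -(e * e) * c := by
          rcases hsq with q | q <;> rw [q] at k1
          · simpa using k1
          · simp only [mul_neg, neg_mul, neg_neg, mul_one] at k1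
            rw [neg_mul, ← k1, neg_neg]
        have k3 : -(e * e) = 1 := by
          have := congrArg (· * c⁻¹) k2
          simpa using this.symm
        rw [← k3, neg_neg]
      have nn := anti_ne he
      exact bad e h c (by simpa using congrArg Units.val hee) (by simpa using congrArg Units.val he)
        (fun H => nn (Units.ext H)) (congrArg Units.val hce) (congrArg Units.val hch)
        (det_pm e) (det_pm c)
    rcases h2 with h2 | h2 | h2 | h2
    · rcases central_pm g h c hne hcg (by rw [h2, one_mul]) with h3 | h3 <;> simp [h3]
    · have h4 : c * h = -(h * c) := by rw [h2]; simp
      have h3 := central_pm g h (c * g) hne (by rw [hcg, mul_assoc, hcg])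
        (by rw [mul_assoc, hgh, mul_neg, ← mul_assoc, h4, neg_mul, neg_neg, mul_assoc])
      have h5 : c * (g * g) = g ∨ c * (g * g) = -g := by
        rw [← mul_assoc]
        rcases h3 with h3 | h3 <;> rw [h3] <;> simp
      rcases anti_sq hgh with q | q <;> rw [q] at h5 <;> simp only [mul_one, mul_neg] at h5
      · tauto
      · rw [neg_inj, neg_eq_iff_eq_neg] at h5; tauto
    · exact (main g hgh hcg h2).elim
    · exact (main (-g) (by simp [hgh]) (by simp [hcg]) h2).elim

lemma full_list (hn : Group.IsNilpotent G) (hg : g ∈ G) (hh : h ∈ G) (hgh : g * h = -(h * g))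
    (hall : ∀ y ∈ G, g * y = y * g ∨ g * y = -(y * g)) (c : GL (Fin 2) ℤ) :
    c ∈ G ↔ c = 1 ∨ c = -1 ∨ c = g ∨ c = -g ∨ c = h ∨ c = -h ∨ c = g * h ∨ c = -(g * h) := by
  have hm1 : (-1 : GL (Fin 2) ℤ) ∈ G := by
    have : g * h * g⁻¹ * h⁻¹ = -1 := by
      rw [mul_inv_eq_iff_eq_mul, mul_inv_eq_iff_eq_mul, hgh]; simp
    rw [← this]
    exact G.mul_mem (G.mul_mem (G.mul_mem hg hh) (G.inv_mem hg)) (G.inv_mem hh)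
  have hneg : ∀ x ∈ G, -x ∈ G := fun x hx => by
    rw [← neg_one_mul]; exact G.mul_mem hm1 hx
  constructor
  · obtain ⟨n, hn⟩ := hn.nilpotent'
    have L : ∀ d ∈ G, d * g = g * d → d = 1 ∨ d = -1 ∨ d = g ∨ d = -g := fun d hd hdg =>
      comm_list hh hgh n ⟨d, hd⟩ (by rw [hn]; trivial) hdg
    intro hc
    rcases hall c hc with H | H
    · have := L c hc H.symm; tauto
    · have h1 := L (c * h) (G.mul_mem hc hh) (by
        rw [mul_assoc, anti_symm hgh, mul_neg, ← mul_assoc, ← mul_assoc, H, neg_mul])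
      have h2 : c * (h * h) = h ∨ c * (h * h) = -h ∨ c * (h * h) = g * h ∨ c * (h * h) = -(g * h) := by
        rw [← mul_assoc]
        rcases h1 with h1 | h1 | h1 | h1 <;> rw [h1] <;> simp
      rcases anti_sq (anti_symm hgh) with q | q <;> rw [q] at h2 <;> simp only [mul_one, mul_neg] at h2
      · tauto
      · simp only [neg_eq_iff_eq_neg, neg_neg] at h2; tauto
  · rintro (rfl | rfl | rfl | rfl | rfl | rfl | rfl | rfl)
    · exact G.one_mem
    · exact hm1
    · exact hg
    · exact hneg _ hg
    · exact hh
    · exact hneg _ hh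
    · exact G.mul_mem hg hh
    · exact hneg _ (G.mul_mem hg hh)

/-- normalised form: two anticommuting involutions -/
lemma nonab_list (hn : Group.IsNilpotent G) (hna : ¬ ∀ x ∈ G, ∀ y ∈ G, x * y = y * x) :
    ∃ x y : GL (Fin 2) ℤ, x * x = 1 ∧ y * y = 1 ∧ x * y = -(y * x) ∧ ∀ c, c ∈ G ↔
      c = 1 ∨ c = -1 ∨ c = x ∨ c = -x ∨ c = y ∨ c = -y ∨ c = x * y ∨ c = -(x * y) := by
  obtain ⟨g, hg, h, hh, hgh, hall⟩ := exists_anti G hn hna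
  have L := full_list hn hg hh hgh hall
  have hhg := anti_symm hgh
  have hp : (g * h) * (g * h) = -((g * g) * (h * h)) := by
    calc (g * h) * (g * h) = g * (h * g) * h := by simp only [mul_assoc]
      _ = _ := by rw [hhg]; simp only [mul_neg, neg_mul, mul_assoc]
  rcases anti_sq hgh with q1 | q1 <;> rcases anti_sq hhg with q2 | q2
  · exact ⟨g, h, q1, q2, hgh, L⟩
  · refine ⟨g, g * h, q1, by rw [hp, q1, q2]; simp, ?_, ?_⟩
    · rw [mul_assoc, hhg]; simp
    · intro c
      rw [L c, ← mul_assoc, q1, one_mul]; tauto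
  · refine ⟨h, g * h, q2, by rw [hp, q1, q2]; simp, ?_, ?_⟩
    · rw [← mul_assoc, hhg]; simp
    · intro c
      rw [L c, ← mul_assoc, hhg, neg_mul, mul_assoc, q2, mul_one, neg_neg]; tauto
  · exact (noQ8 g h (by simpa using congrArg Units.val q1) (by simpa using congrArg Units.val q2)
      (by simpa using congrArg Units.val hgh)).elim
end

lemma exists_conj (X Y : Matrix (Fin 2) (Fin 2) ℚ) (hX : X * X = 1) (hY : Y * Y = 1)
    (hXY : X * Y = -(Y * X)) : ∃ M : Matrix (Fin 2) (Fin 2) ℚ, IsUnit M ∧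
      M * X * M⁻¹ = !![1, 0; 0, -1] ∧ M * Y * M⁻¹ = !![0, 1; 1, 0] := by
  have hv : ∃ v : Fin 2 → ℚ, v ≠ 0 ∧ X.mulVec v = v := by
    by_contra! hc
    have h1 : ∀ w : Fin 2 → ℚ, (1 + X).mulVec w = 0 := by
      intro w
      by_contra hw
      apply hc _ hw
      rw [Matrix.mulVec_mulVec, mul_add, hX, mul_one, add_comm]
    have h2 : 1 + X = 0 := by
      ext i j
      have := congrFun (h1 (Pi.single j 1)) i
      simpa using this
    have h3 : X = -1 := by rw [add_comm] at h2; exact eq_neg_of_add_eq_zero_left h2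
    rw [h3] at hXY
    simp only [neg_mul, one_mul, mul_neg, mul_one, neg_neg] at hXY
    have h4 : Y = 0 := by
      ext i j
      have := congrFun (congrFun hXY i) j
      simp at this ⊢
      linarith
    rw [h4] at hY
    have := congrFun (congrFun hY 0) 0
    simp at this
  obtain ⟨v, hv0, hXv⟩ := hv
  obtain ⟨w, hw⟩ : ∃ w, w = Y.mulVec v := ⟨_, rfl⟩
  have hXw : X.mulVec w = -w := by
    rw [hw, Matrix.mulVec_mulVec, hXY, Matrix.neg_mulVec, ← Matrix.mulVec_mulVec, hXv]
  have hYw : Y.mulVec w = v := by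
    rw [hw, Matrix.mulVec_mulVec, hY, Matrix.one_mulVec]
  have a0 := congrFun hXv 0
  have a1 := congrFun hXv 1
  have b0 := congrFun hXw 0
  have b1 := congrFun hXw 1
  have c0 := congrFun hYw 0
  have c1 := congrFun hYw 1
  have d0 := congrFun hw 0
  have d1 := congrFun hw 1
  simp only [Matrix.mulVec, dotProduct, Fin.sum_univ_two, Pi.neg_apply] at a0 a1 b0 b1 c0 c1 d0 d1
  let P : Matrix (Fin 2) (Fin 2) ℚ := !![v 0, w 0; v 1, w 1]
  have hdet : P.det ≠ 0 := by
    intro hd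
    have hd' : v 0 * w 1 = w 0 * v 1 := by
      simp [P, Matrix.det_fin_two] at hd; linarith
    have k1 : v 0 * w 1 = 0 := by
      have : v 0 * w 1 = - (v 0 * w 1) := by
        linear_combination v 0 * b1 - w 0 * a1 - X 1 1 * hd' + hd'
      linarith
    have k2 : v 0 * w 0 = 0 := by
      have : v 0 * w 0 = - (v 0 * w 0) := by
        linear_combination v 0 * b0 - w 0 * a0 - X 0 1 * hd'
      linarith
    have k3 : v 1 * w 1 = 0 := by
      have : v 1 * w 1 = - (v 1 * w 1) := by
        linear_combination v 1 * b1 - w 1 * a1 + X 1 0 * hd'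
      linarith
    have k4 : v 1 * w 0 = 0 := by linarith
    have w0 : w 0 = 0 ∧ w 1 = 0 := by
      by_cases z0 : v 0 = 0
      · have z1 : v 1 ≠ 0 := by
          intro z1; apply hv0; ext i; fin_cases i <;> simp [z0, z1]
        exact ⟨(mul_eq_zero.1 k4).resolve_left z1, (mul_eq_zero.1 k3).resolve_left z1⟩
      · exact ⟨(mul_eq_zero.1 k2).resolve_left z0, (mul_eq_zero.1 k1).resolve_left z0⟩
    apply hv0
    rw [w0.1, w0.2] at c0 c1
    ext i; fin_cases i <;> simp <;> linarith
  have hu : IsUnit P.det := isUnit_iff_ne_zero.2 hdet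
  have hPX : X * P = P * !![1, 0; 0, -1] := by
    ext i j
    fin_cases i <;> fin_cases j <;> simp [P, Matrix.mul_apply, Fin.sum_univ_two] <;> linarith
  have hPY : Y * P = P * !![0, 1; 1, 0] := by
    ext i j
    fin_cases i <;> fin_cases j <;> simp [P, Matrix.mul_apply, Fin.sum_univ_two] <;> linarith
  refine ⟨P⁻¹, ?_, ?_, ?_⟩
  · rw [Matrix.isUnit_nonsing_inv_iff]; exact (Matrix.isUnit_iff_isUnit_det _).2 hu
  · rw [Matrix.nonsing_inv_nonsing_inv _ hu, mul_assoc, hPX, ← mul_assoc, Matrix.nonsing_inv_mul _ hu,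
      one_mul]
  · rw [Matrix.nonsing_inv_nonsing_inv _ hu, mul_assoc, hPY, ← mul_assoc, Matrix.nonsing_inv_mul _ hu,
      one_mul]

theorem stmt_6 (𝒢 : Subgroup (GL (Fin 2) ℤ)) (hnilp : Group.IsNilpotent 𝒢) :
    (∃ N ∈ 𝒢, 𝒢 = Subgroup.closure {N}) ∨
    (∃ N ∈ 𝒢, 𝒢 = Subgroup.closure {N, -N}) ∨
    (∃ M : Matrix (Fin 2) (Fin 2) ℚ, IsUnit M ∧
      ((fun A : Matrix (Fin 2) (Fin 2) ℚ => M * A * M⁻¹) ''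
        ((fun g : GL (Fin 2) ℤ =>
            ((g : Matrix (Fin 2) (Fin 2) ℤ)).map (Int.cast : ℤ → ℚ)) ''
          (𝒢 : Set (GL (Fin 2) ℤ)))) = dihedralH) := by
  by_cases hab : ∀ x ∈ 𝒢, ∀ y ∈ 𝒢, x * y = y * x
  · rcases abelian_case 𝒢 hab with h | h
    · exact Or.inl h
    · exact Or.inr (Or.inl h)
  right; right
  obtain ⟨x, y, hx, hy, hxy, L⟩ := nonab_list hnilp hab
  let F : Matrix (Fin 2) (Fin 2) ℤ →+* Matrix (Fin 2) (Fin 2) ℚ := (Int.castRingHom ℚ).mapMatrix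
  have hF : ∀ A : Matrix (Fin 2) (Fin 2) ℤ, A.map (Int.cast : ℤ → ℚ) = F A := fun A => rfl
  have ex : F x * F x = 1 := by
    rw [← map_mul, ← Units.val_mul, hx, Units.val_one, map_one]
  have ey : F y * F y = 1 := by
    rw [← map_mul, ← Units.val_mul, hy, Units.val_one, map_one]
  have exy : F x * F y = -(F y * F x) := by
    rw [← map_mul, ← map_mul, ← Units.val_mul, hxy, Units.val_neg, map_neg, Units.val_mul]
  obtain ⟨M, hM, m1, m2⟩ := exists_conj (F x) (F y) ex ey exy
  refine ⟨M, hM, ?_⟩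
  have hMM : M * M⁻¹ = 1 := Matrix.mul_nonsing_inv _ ((Matrix.isUnit_iff_isUnit_det _).1 hM)
  have hMM' : M⁻¹ * M = 1 := Matrix.nonsing_inv_mul _ ((Matrix.isUnit_iff_isUnit_det _).1 hM)
  have m3 : M * (F x * F y) * M⁻¹ = !![0, 1; -1, 0] := by
    have : M * (F x * F y) * M⁻¹ = (M * F x * M⁻¹) * (M * F y * M⁻¹) := by
      calc M * (F x * F y) * M⁻¹ = M * F x * 1 * F y * M⁻¹ := by simp only [mul_one, mul_assoc]
        _ = _ := by rw [← hMM']; simp only [mul_assoc]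
    rw [this, m1, m2]
    ext i j
    fin_cases i <;> fin_cases j <;> simp
  have hset : (𝒢 : Set (GL (Fin 2) ℤ)) = {1, -1, x, -x, y, -y, x * y, -(x * y)} := by
    ext c
    simp only [SetLike.mem_coe, Set.mem_insert_iff, Set.mem_singleton_iff]
    exact L c
  rw [hset]
  simp only [Set.image_insert_eq, Set.image_singleton, hF, Units.val_neg, Units.val_mul,
    Units.val_one, map_neg, map_mul, map_one, mul_neg, neg_mul, mul_one, hMM, m1, m2, m3]
  have n1 : -(!![1, 0; 0, -1] : Matrix (Fin 2) (Fin 2) ℚ) = !![-1, 0; 0, 1] := by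
    ext i j; fin_cases i <;> fin_cases j <;> simp
  have n2 : -(!![0, 1; 1, 0] : Matrix (Fin 2) (Fin 2) ℚ) = !![0, -1; -1, 0] := by
    ext i j; fin_cases i <;> fin_cases j <;> simp
  have n3 : -(!![0, 1; -1, 0] : Matrix (Fin 2) (Fin 2) ℚ) = !![0, -1; 1, 0] := by
    ext i j; fin_cases i <;> fin_cases j <;> simp
  rw [n1, n2, n3]
  ext A
  simp only [dihedralH, Set.mem_insert_iff, Set.mem_singleton_iff]
  tauto
end
end

section
/- Let G be a nilpotent subgroup of Homeo(T²). Then there exists a normal subgroup H of G of index 1, 2, 3, 4, 6 or 8 containing G₀ such that {ρ_μ(φ̃) : μ ∈ P(φ)} = {ρ_ν(φ̃) : ν ∈ P(H)} for every φ ∈ G₀ and every lift φ̃ of φ. In particular I_G = I_H = H_I, and I_G is a normal subgroup of G. -/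
open MeasureTheory Set

section helpers
open Filter Topology

/-- integer matrix acting on the plane -/
noncomputable def mact (A : Matrix (Fin 2) (Fin 2) ℤ) (p : ℝ × ℝ) : ℝ × ℝ :=
  ((A 0 0 : ℝ) * p.1 + (A 0 1 : ℝ) * p.2, (A 1 0 : ℝ) * p.1 + (A 1 1 : ℝ) * p.2)

/-- lift with given action on the deck group -/
def IsLM (f : T2 → T2) (F : ℝ × ℝ → ℝ × ℝ) (A : Matrix (Fin 2) (Fin 2) ℤ) : Prop :=
  IsLift f F ∧ ∀ (p : ℝ × ℝ) (m n : ℤ), F (p + ((m : ℝ), (n : ℝ))) = F p + mact A ((m : ℝ), (n : ℝ))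

lemma coe_eq_iff (x y : ℝ) : (x : AddCircle (1 : ℝ)) = y ↔ ∃ m : ℤ, y = x + m := by
  refine QuotientAddGroup.eq.trans ?_
  rw [AddSubgroup.mem_zmultiples_iff]
  constructor
  · rintro ⟨k, hk⟩
    refine ⟨k, ?_⟩
    rw [zsmul_one] at hk
    linarith
  · rintro ⟨k, hk⟩
    refine ⟨k, ?_⟩
    rw [zsmul_one]
    linarith

lemma torusProj_eq_iff (p q : ℝ × ℝ) :
    torusProj p = torusProj q ↔ ∃ m n : ℤ, q = p + ((m : ℝ), (n : ℝ)) := by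
  simp only [torusProj, Prod.ext_iff, coe_eq_iff]
  constructor
  · rintro ⟨⟨m, hm⟩, n, hn⟩
    exact ⟨m, n, hm, hn⟩
  · rintro ⟨m, n, hm, hn⟩
    exact ⟨⟨m, hm⟩, n, hn⟩

lemma torusProj_add_int (p : ℝ × ℝ) (m n : ℤ) :
    torusProj (p + ((m : ℝ), (n : ℝ))) = torusProj p :=
  ((torusProj_eq_iff _ _).2 ⟨m, n, rfl⟩).symm

lemma torusProj_add (p q : ℝ × ℝ) : torusProj (p + q) = torusProj p + torusProj q := by
  simp [torusProj]

lemma continuous_torusProj : Continuous torusProj := by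
  unfold torusProj
  have : Continuous ((↑) : ℝ → AddCircle (1 : ℝ)) := AddCircle.continuous_mk' _
  fun_prop

lemma surjective_torusProj : Function.Surjective torusProj := by
  rintro ⟨x, y⟩
  obtain ⟨a, rfl⟩ := QuotientAddGroup.mk_surjective x
  obtain ⟨b, rfl⟩ := QuotientAddGroup.mk_surjective y
  exact ⟨(a, b), rfl⟩

lemma isOpenMap_torusProj : IsOpenMap torusProj := by
  have h : IsOpenMap ((↑) : ℝ → AddCircle (1 : ℝ)) := QuotientAddGroup.isOpenMap_coe
  exact h.prodMap h

lemma isQuotientMap_torusProj : Topology.IsQuotientMap torusProj :=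
  isOpenMap_torusProj.isQuotientMap continuous_torusProj surjective_torusProj

lemma lifts_unique {X : Type*} [TopologicalSpace X] [PreconnectedSpace X] [Nonempty X]
    {U V : X → ℝ × ℝ} (hU : Continuous U) (hV : Continuous V)
    (h : ∀ x, torusProj (U x) = torusProj (V x)) :
    ∃ m n : ℤ, ∀ x, V x = U x + ((m : ℝ), (n : ℝ)) := by
  obtain ⟨x0⟩ := ‹Nonempty X›
  obtain ⟨m, n, h0⟩ := (torusProj_eq_iff _ _).1 (h x0)
  refine ⟨m, n, ?_⟩
  have cov := AddCircle.isCoveringMap_coe (1 : ℝ)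
  have e1 := cov.eq_of_comp_eq (g₁ := fun x => (V x).1) (g₂ := fun x => (U x).1 + m)
    (by fun_prop) (by fun_prop) (by
      funext x
      have := h x
      have := congrArg Prod.fst this
      have h2 := congrArg Prod.fst (torusProj_add_int (U x) m n)
      simp only [Function.comp]
      exact this.symm.trans h2.symm) x0 (by simp [h0])
  have e2 := cov.eq_of_comp_eq (g₁ := fun x => (V x).2) (g₂ := fun x => (U x).2 + n)
    (by fun_prop) (by fun_prop) (by
      funext x
      have := h x
      have := congrArg Prod.snd this
      have h2 := congrArg Prod.snd (torusProj_add_int (U x) m n)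
      simp only [Function.comp]
      exact this.symm.trans h2.symm) x0 (by simp [h0])
  intro x
  exact Prod.ext (congrFun e1 x) (congrFun e2 x)

lemma exists_lift_gen {X : Type*} [TopologicalSpace X] [SimplyConnectedSpace X]
    [LocallyPathConnectedSpace X] {f : X → T2} (hf : Continuous f) :
    ∃ F : X → ℝ × ℝ, Continuous F ∧ ∀ x, torusProj (F x) = f x := by
  obtain ⟨x0⟩ : Nonempty X := inferInstance
  have cov := AddCircle.isCoveringMap_coe (1 : ℝ)
  obtain ⟨p, hp⟩ := surjective_torusProj (f x0)
  obtain ⟨F1, ⟨-, h1⟩, -⟩ := cov.existsUnique_continuousMap_lifts ⟨fun x => (f x).1, by fun_prop⟩ x0 p.1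
    (congrArg Prod.fst hp)
  obtain ⟨F2, ⟨-, h2⟩, -⟩ := cov.existsUnique_continuousMap_lifts ⟨fun x => (f x).2, by fun_prop⟩ x0 p.2
    (congrArg Prod.snd hp)
  refine ⟨fun x => (F1 x, F2 x), by fun_prop, fun x => Prod.ext (congrFun h1 x) (congrFun h2 x)⟩

lemma exists_lm {f : T2 → T2} (hf : Continuous f) : ∃ F A, IsLM f F A := by
  obtain ⟨F, hF, hl⟩ := exists_lift_gen (hf.comp continuous_torusProj)
  have key : ∀ m n : ℤ, ∃ a b : ℤ, ∀ p, F (p + ((m : ℝ), (n : ℝ))) = F p + ((a : ℝ), (b : ℝ)) := by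
    intro m n
    refine lifts_unique hF (V := fun p => F (p + ((m : ℝ), (n : ℝ)))) (by fun_prop) ?_
    intro p
    rw [hl, hl]
    simp only [Function.comp, torusProj_add_int]
  obtain ⟨a, b, h1⟩ := key 1 0
  obtain ⟨c, d, h2⟩ := key 0 1
  have g1 : ∀ (m : ℤ) p, F (p + ((m : ℝ), 0)) = F p + ((m * a : ℝ), (m * b : ℝ)) := by
    intro m
    induction m using Int.induction_on with
    | zero => intro p; ext <;> simp [show p + ((0 : ℝ), (0 : ℝ)) = p from by ext <;> simp]
    | succ i ih =>
      intro p
      have := h1 (p + (((i : ℤ) : ℝ), 0))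
      rw [ih] at this
      have e : p + (((i : ℤ) : ℝ), 0) + (((1 : ℤ) : ℝ), ((0 : ℤ) : ℝ)) = p + (((i + 1 : ℤ) : ℝ), 0) := by
        ext <;> simp [add_assoc]
      rw [e] at this
      rw [this]
      ext <;> simp <;> ring
    | pred i ih =>
      intro p
      have := h1 (p + (((-i - 1 : ℤ) : ℝ), 0))
      have e : p + (((-i - 1 : ℤ) : ℝ), 0) + (((1 : ℤ) : ℝ), ((0 : ℤ) : ℝ)) = p + (((-i : ℤ) : ℝ), 0) := by
        ext <;> simp [add_assoc]
      rw [e, ih] at this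
      have t1 := congrArg Prod.fst this
      have t2 := congrArg Prod.snd this
      simp at t1 t2
      ext <;> simp <;> linarith
  have g2 : ∀ (m : ℤ) p, F (p + (0, (m : ℝ))) = F p + ((m * c : ℝ), (m * d : ℝ)) := by
    intro m
    induction m using Int.induction_on with
    | zero => intro p; ext <;> simp [show p + ((0 : ℝ), (0 : ℝ)) = p from by ext <;> simp]
    | succ i ih =>
      intro p
      have := h2 (p + (0, ((i : ℤ) : ℝ)))
      rw [ih] at this
      have e : p + (0, ((i : ℤ) : ℝ)) + (((0 : ℤ) : ℝ), ((1 : ℤ) : ℝ)) = p + (0, ((i + 1 : ℤ) : ℝ)) := by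
        ext <;> simp [add_assoc]
      rw [e] at this
      rw [this]
      ext <;> simp <;> ring
    | pred i ih =>
      intro p
      have := h2 (p + (0, ((-i - 1 : ℤ) : ℝ)))
      have e : p + (0, ((-i - 1 : ℤ) : ℝ)) + (((0 : ℤ) : ℝ), ((1 : ℤ) : ℝ)) = p + (0, ((-i : ℤ) : ℝ)) := by
        ext <;> simp [add_assoc]
      rw [e, ih] at this
      have t1 := congrArg Prod.fst this
      have t2 := congrArg Prod.snd this
      simp at t1 t2
      ext <;> simp <;> linarith
  refine ⟨F, !![a, c; b, d], ⟨hF, fun p => hl p⟩, ?_⟩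
  intro p m n
  have e : p + ((m : ℝ), (n : ℝ)) = p + ((m : ℝ), 0) + (0, (n : ℝ)) := by
    ext <;> simp
  rw [e, g2, g1]
  ext <;> simp [mact] <;> ring

lemma mact_add (A) (p q : ℝ × ℝ) : mact A (p + q) = mact A p + mact A q := by
  ext <;> simp [mact] <;> ring
lemma mact_sub (A) (p q : ℝ × ℝ) : mact A (p - q) = mact A p - mact A q := by
  ext <;> simp [mact] <;> ring
lemma mact_one (p : ℝ × ℝ) : mact 1 p = p := by
  ext <;> simp [mact]
lemma mact_mul (A B) (p : ℝ × ℝ) : mact (A * B) p = mact A (mact B p) := by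
  ext <;> simp [mact, Matrix.mul_apply, Fin.sum_univ_two] <;> ring
lemma mact_int (A) (m n : ℤ) : mact A ((m : ℝ), (n : ℝ)) =
   (((A 0 0 * m + A 0 1 * n : ℤ) : ℝ), ((A 1 0 * m + A 1 1 * n : ℤ) : ℝ)) := by
  ext <;> simp [mact]
lemma continuous_mact (A) : Continuous (mact A) := by
  unfold mact; fun_prop

lemma IsLM.comp {f g : T2 → T2} {F G A B} (h1 : IsLM f F A) (h2 : IsLM g G B) :
    IsLM (f ∘ g) (F ∘ G) (A * B) := by
  refine ⟨⟨h1.1.1.comp h2.1.1, fun p => ?_⟩, fun p m n => ?_⟩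
  · simp [h1.1.2, h2.1.2]
  · simp only [Function.comp]
    rw [h2.2, mact_int, h1.2, mact_mul, mact_int B]

lemma IsLift.unique {f F G} (h1 : IsLift f F) (h2 : IsLift f G) :
    ∃ m n : ℤ, ∀ x, G x = F x + ((m : ℝ), (n : ℝ)) :=
  lifts_unique h1.1 h2.1 (fun x => by rw [h1.2, h2.2])

lemma IsLM.add_int {f F A} (h : IsLM f F A) (m n : ℤ) :
    IsLM f (fun p => F p + ((m : ℝ), (n : ℝ))) A := by
  refine ⟨⟨h.1.1.add continuous_const, fun p => ?_⟩, fun p a b => ?_⟩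
  · rw [torusProj_add_int, h.1.2]
  · simp only [h.2]; abel

lemma IsLM.of_lift {f F G A} (h : IsLM f F A) (h2 : IsLift f G) : IsLM f G A := by
  obtain ⟨m, n, hh⟩ := h.1.unique h2
  have : G = fun p => F p + ((m : ℝ), (n : ℝ)) := funext hh
  rw [this]
  exact h.add_int m n

lemma IsLM.mat_unique {f F G A B} (h1 : IsLM f F A) (h2 : IsLM f G B) : A = B := by
  have h3 := h1.of_lift h2.1
  have a1 := (h3.2 0 1 0).symm.trans (h2.2 0 1 0)
  have a2 := (h3.2 0 0 1).symm.trans (h2.2 0 0 1)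
  simp [mact] at a1 a2
  ext i j
  fin_cases i <;> fin_cases j <;> simp [a1, a2]

lemma isLM_id : IsLM id id 1 :=
  ⟨⟨continuous_id, fun _ => rfl⟩, fun p m n => by simp [mact_one]⟩

lemma isotopic_lm {f : T2 → T2} (h : IsotopicToId f) : ∃ F, IsLM f F 1 := by
  obtain ⟨Φ, hc, -, h0, h1, -⟩ := h
  obtain ⟨U, hU, hl⟩ := exists_lift_gen (X := ℝ × (ℝ × ℝ)) (f := fun q => Φ q.1 (torusProj q.2))
    (hc.comp (continuous_fst.prodMk (continuous_torusProj.comp continuous_snd)))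
  have l0 : IsLift id (fun p => U (0, p)) := ⟨by fun_prop, fun p => by rw [hl]; simp [h0]⟩
  have l1 : IsLift f (fun p => U (1, p)) := ⟨by fun_prop, fun p => by rw [hl]; simp [h1]⟩
  have m0 := isLM_id.of_lift l0
  refine ⟨_, l1, fun p m n => ?_⟩
  obtain ⟨a, b, hab⟩ := lifts_unique (U := fun t : ℝ => U (t, p))
    (V := fun t : ℝ => U (t, p + ((m : ℝ), (n : ℝ)))) (by fun_prop) (by fun_prop)
    (fun t => by rw [hl, hl]; simp only [torusProj_add_int])
  have := (hab 0).symm.trans (m0.2 p m n)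
  rw [add_left_cancel_iff] at this
  rw [hab 1, this]

lemma descends {E : Type*} [TopologicalSpace E] {u : ℝ × ℝ → E} (hu : Continuous u)
    (h : ∀ p (m n : ℤ), u (p + ((m : ℝ), (n : ℝ))) = u p) :
    ∃ g : C(T2, E), ∀ p, g (torusProj p) = u p := by
  have hf : Function.FactorsThrough u torusProj := by
    intro p q hpq
    obtain ⟨m, n, rfl⟩ := (torusProj_eq_iff _ _).1 hpq
    exact (h _ _ _).symm
  have hq : Topology.IsQuotientMap (⟨torusProj, continuous_torusProj⟩ : C(ℝ × ℝ, T2)) :=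
    isQuotientMap_torusProj
  refine ⟨hq.lift ⟨u, hu⟩ hf, fun p => ?_⟩
  exact congrArg (fun k : C(ℝ × ℝ, E) => k p) (hq.lift_comp ⟨u, hu⟩ hf)


lemma count_anti : ∀ p q r : ZMod 3,
  (-(p*p) - q*r = 1 →
    ((Finset.univ : Finset (ZMod 3 × ZMod 3 × ZMod 3 × ZMod 3)).filter (fun h =>
     (h.1 * p + h.2.1 * r = p * h.1 + q * h.2.2.1 ∧ h.1 * q - h.2.1 * p = p * h.2.1 + q * h.2.2.2 ∧
      h.2.2.1 * p + h.2.2.2 * r = r * h.1 - p * h.2.2.1 ∧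
      h.2.2.1 * q - h.2.2.2 * p = r * h.2.1 - p * h.2.2.2 ∧ h.1 * h.2.2.2 - h.2.1 * h.2.2.1 = 1) ∨
     (h.1 * p + h.2.1 * r = -(p * h.1 + q * h.2.2.1) ∧
      h.1 * q - h.2.1 * p = -(p * h.2.1 + q * h.2.2.2) ∧
      h.2.2.1 * p + h.2.2.2 * r = -(r * h.1 - p * h.2.2.1) ∧
      h.2.2.1 * q - h.2.2.2 * p = -(r * h.2.1 - p * h.2.2.2) ∧
      h.1 * h.2.2.2 - h.2.1 * h.2.2.1 = -1))).card ≤ 8) ∧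
  (-(p*p) - q*r = -1 →
    ((Finset.univ : Finset (ZMod 3 × ZMod 3 × ZMod 3 × ZMod 3)).filter (fun h =>
     ((h.1 * p + h.2.1 * r = p * h.1 + q * h.2.2.1 ∧ h.1 * q - h.2.1 * p = p * h.2.1 + q * h.2.2.2 ∧
      h.2.2.1 * p + h.2.2.2 * r = r * h.1 - p * h.2.2.1 ∧
      h.2.2.1 * q - h.2.2.2 * p = r * h.2.1 - p * h.2.2.2) ∨
     (h.1 * p + h.2.1 * r = -(p * h.1 + q * h.2.2.1) ∧
      h.1 * q - h.2.1 * p = -(p * h.2.1 + q * h.2.2.2) ∧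
      h.2.2.1 * p + h.2.2.2 * r = -(r * h.1 - p * h.2.2.1) ∧
      h.2.2.1 * q - h.2.2.2 * p = -(r * h.2.1 - p * h.2.2.2))) ∧
      h.1 * h.2.2.2 - h.2.1 * h.2.2.1 ≠ 0)).card ≤ 8) := by
  decide +kernel

lemma count_comm : ∀ p q r s : ZMod 3, ¬ (q = 0 ∧ r = 0 ∧ p = s) →
    ((Finset.univ : Finset (ZMod 3 × ZMod 3 × ZMod 3 × ZMod 3)).filter (fun h =>
     (h.2.1 * r = q * h.2.2.1 ∧ h.1 * q + h.2.1 * s = p * h.2.1 + q * h.2.2.2 ∧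
      h.2.2.1 * p + h.2.2.2 * r = r * h.1 + s * h.2.2.1) ∧
      h.1 * h.2.2.2 - h.2.1 * h.2.2.1 ≠ 0)).card ≤ 8 := by
  decide +kernel

lemma count_scalar :
    ((Finset.univ : Finset (ZMod 3 × ZMod 3 × ZMod 3 × ZMod 3)).filter (fun h =>
     (h.2.1 = 0 ∧ h.2.2.1 = 0 ∧ h.1 = h.2.2.2))).card ≤ 8 := by
  decide +kernel


lemma nilp_dichotomy (Γ : Type*) [Group Γ] [hn : Group.IsNilpotent Γ] :
    (∀ a b : Γ, a * b = b * a) ∨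
    ∃ z g : Γ, (∀ h, z * h * z⁻¹ * h⁻¹ ∈ Subgroup.center Γ) ∧ z * g ≠ g * z := by
  by_contra hcon
  push Not at hcon
  obtain ⟨⟨a, b, hab⟩, h2⟩ := hcon
  have key : ∀ n, Subgroup.upperCentralSeries Γ n ≤ Subgroup.center Γ := by
    intro n
    induction n with
    | zero => simp
    | succ n ih =>
      intro z hz
      rw [Subgroup.mem_upperCentralSeries_succ_iff] at hz
      rw [Subgroup.mem_center_iff]
      intro g
      exact (h2 z g (fun h => ih (hz h))).symm
  obtain ⟨n, hn⟩ := hn.nilpotent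
  have : a ∈ Subgroup.center Γ := key n (by rw [hn]; trivial)
  exact hab ((Subgroup.mem_center_iff.1 this b).symm)

lemma scalar_of_comm_s9 {C Z W : Matrix (Fin 2) (Fin 2) ℤ} (h1 : C * Z = Z * C) (h2 : C * W = W * C)
    (h3 : Z * W ≠ W * Z) : C 0 1 = 0 ∧ C 1 0 = 0 ∧ C 0 0 = C 1 1 := by
  have E : ∀ X Y : Matrix (Fin 2) (Fin 2) ℤ, X * Y = Y * X ↔
      (X 0 1 * Y 1 0 = Y 0 1 * X 1 0 ∧ X 0 1 * (Y 0 0 - Y 1 1) = Y 0 1 * (X 0 0 - X 1 1) ∧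
        X 1 0 * (Y 0 0 - Y 1 1) = Y 1 0 * (X 0 0 - X 1 1)) := by
    intro X Y
    simp only [← Matrix.ext_iff, Fin.forall_fin_two, Matrix.mul_apply, Fin.sum_univ_two]
    constructor
    · rintro ⟨⟨a, b⟩, c, d⟩
      refine ⟨?_, ?_, ?_⟩ <;> linarith
    · rintro ⟨a, b, c⟩
      refine ⟨⟨?_, ?_⟩, ?_, ?_⟩ <;> linarith
  rw [E] at h1 h2
  rw [Ne, E] at h3
  set c0 := C 0 1
  set c1 := C 1 0
  have hc2 : C 0 0 = C 1 1 ↔ C 0 0 - C 1 1 = 0 := by rw [sub_eq_zero]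
  rw [hc2]
  generalize C 0 0 - C 1 1 = c2 at *
  generalize c0 = c0 at *
  generalize c1 = c1 at *
  generalize Z 0 1 = z0 at *
  generalize Z 1 0 = z1 at *
  generalize Z 0 0 - Z 1 1 = z2 at *
  generalize W 0 1 = w0 at *
  generalize W 1 0 = w1 at *
  generalize W 0 0 - W 1 1 = w2 at *
  obtain ⟨a1, a2, a3⟩ := h1
  obtain ⟨b1, b2, b3⟩ := h2
  have x01 : z0 * w1 - w0 * z1 ≠ 0 ∨ z0 * w2 - w0 * z2 ≠ 0 ∨ z1 * w2 - w1 * z2 ≠ 0 := by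
    by_contra hh
    push Not at hh
    exact h3 ⟨by linarith [hh.1], by linarith [hh.2.1], by linarith [hh.2.2]⟩
  rcases x01 with h | h | h
  · refine ⟨?_, ?_, ?_⟩ <;> refine (mul_eq_zero.1 (?_ : _ * (z0 * w1 - w0 * z1) = 0)).resolve_right h
    · linear_combination (-w0) * a1 + z0 * b1
    · linear_combination (-w1) * a1 + z1 * b1
    · grind
  · refine ⟨?_, ?_, ?_⟩ <;> refine (mul_eq_zero.1 (?_ : _ * (z0 * w2 - w0 * z2) = 0)).resolve_right h
    · grind
    · grind
    · grind
  · refine ⟨?_, ?_, ?_⟩ <;> refine (mul_eq_zero.1 (?_ : _ * (z1 * w2 - w1 * z2) = 0)).resolve_right h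
    · grind
    · grind
    · grind

abbrev GLZ := GL (Fin 2) ℤ

lemma detcast (h : GLZ) : (h : Matrix (Fin 2) (Fin 2) ℤ).det = 1 ∨ (h : Matrix (Fin 2) (Fin 2) ℤ).det = -1 := by
  have := (Matrix.isUnit_iff_isUnit_det _).1 h.isUnit
  exact Int.isUnit_iff.1 this

/-- reduction of an integer matrix as a quadruple mod 3 -/
def quad (h : GLZ) : ZMod 3 × ZMod 3 × ZMod 3 × ZMod 3 :=
  (((h : Matrix (Fin 2) (Fin 2) ℤ) 0 0 : ℤ), ((h : Matrix (Fin 2) (Fin 2) ℤ) 0 1 : ℤ),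
   ((h : Matrix (Fin 2) (Fin 2) ℤ) 1 0 : ℤ), ((h : Matrix (Fin 2) (Fin 2) ℤ) 1 1 : ℤ))

lemma comm_det {p q r a b c d : ℤ} (hz : -(p*p) - q*r = 1)
    (e1 : a * p + b * r = p * a + q * c) (e2 : a * q - b * p = p * b + q * d)
    (hd : a * d - b * c = 1 ∨ a * d - b * c = -1) : a * d - b * c = 1 := by
  rcases hd with hd | hd
  · exact hd
  exfalso
  have hq : q ≠ 0 := by rintro rfl; nlinarith [mul_self_nonneg p]
  have : 4 * (q*q) * (a * d - b * c) = (q * (a + d)) ^ 2 + 4 * (b * b) := by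
    have f1 : q * c = b * r := by linarith
    have f2 : q * (a - d) = 2 * (p * b) := by linarith
    have : 4 * (q*q) * (a * d - b * c) = (q * (a + d)) ^ 2 - (q * (a - d))^2 - 4 * q * b * (q * c) := by ring
    rw [this, f1, f2]
    linear_combination (4 * b * b) * hz
  rw [hd] at this
  nlinarith [sq_nonneg (q * (a + d)), mul_self_nonneg b, mul_self_pos.2 hq]

lemma anti_det {p q r a b c d : ℤ} (hz : -(p*p) - q*r = 1)
    (e1 : a * p + b * r = -(p * a + q * c)) (e2 : a * q - b * p = -(p * b + q * d))
    (hd : a * d - b * c = 1 ∨ a * d - b * c = -1) : a * d - b * c = -1 := by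
  rcases hd with hd | hd
  swap
  · exact hd
  exfalso
  have hq : q ≠ 0 := by rintro rfl; nlinarith [mul_self_nonneg p]
  have hda : d = - a := by
    have : q * (d + a) = 0 := by linarith
    have := (mul_eq_zero.1 this).resolve_left hq
    linarith
  subst hda
  have : (q*q) * (a * -a - b * c) = -((q * a - p * b) ^ 2 + b * b) := by
    have f1 : q * c = -(2 * (p * a) + b * r) := by linarith
    have : (q*q) * (a * -a - b * c) = - (q * a)^2 - q * b * (q * c) := by ring
    rw [this, f1]
    linear_combination (-b * b) * hz
  rw [hd] at this
  nlinarith [sq_nonneg (q * a - p * b), mul_self_nonneg b, mul_self_pos.2 hq]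

lemma quad_subset (Γ : Subgroup GLZ) [Group.IsNilpotent Γ] :
    ∃ S : Finset (ZMod 3 × ZMod 3 × ZMod 3 × ZMod 3), S.card ≤ 8 ∧ ∀ h ∈ Γ, quad h ∈ S := by
  rcases nilp_dichotomy Γ with hab | ⟨z, g, hz, hg⟩
  · by_cases hs : ∀ h ∈ Γ, (quad h).2.1 = 0 ∧ (quad h).2.2.1 = 0 ∧ (quad h).1 = (quad h).2.2.2
    · exact ⟨_, count_scalar, fun h hh => by simpa using hs h hh⟩
    push Not at hs
    obtain ⟨b, hb, hns⟩ := hs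
    refine ⟨_, count_comm (quad b).1 (quad b).2.1 (quad b).2.2.1 (quad b).2.2.2 (fun hh => hns hh.1 hh.2.1 hh.2.2), ?_⟩
    intro h hh
    have e : h * b = b * h := congrArg Subtype.val (hab ⟨h, hh⟩ ⟨b, hb⟩)
    have e' := congrArg (fun x : GLZ => (x : Matrix (Fin 2) (Fin 2) ℤ)) e
    have hd := detcast h
    rw [Matrix.det_fin_two] at hd
    simp only [Units.val_mul, ← Matrix.ext_iff, Fin.forall_fin_two, Matrix.mul_apply, Fin.sum_univ_two] at e'
    obtain ⟨⟨e1, e2⟩, e3, e4⟩ := e'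
    refine Finset.mem_filter.2 ⟨Finset.mem_univ _, ?_⟩
    simp only [quad]
    refine ⟨⟨?_, ?_, ?_⟩, ?_⟩
    · have : (h : Matrix (Fin 2) (Fin 2) ℤ) 0 1 * (b : Matrix (Fin 2) (Fin 2) ℤ) 1 0 = (b : Matrix (Fin 2) (Fin 2) ℤ) 0 1 * (h : Matrix (Fin 2) (Fin 2) ℤ) 1 0 := by linarith
      exact_mod_cast congrArg (Int.cast : ℤ → ZMod 3) this
    · exact_mod_cast congrArg (Int.cast : ℤ → ZMod 3) e2
    · exact_mod_cast congrArg (Int.cast : ℤ → ZMod 3) e3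
    · rcases hd with hd | hd
      · have := congrArg (Int.cast : ℤ → ZMod 3) hd
        push_cast at this
        rw [this]; decide
      · have := congrArg (Int.cast : ℤ → ZMod 3) hd
        push_cast at this
        rw [this]; decide
  · have hzg : (z : GLZ).1 * (g : GLZ).1 ≠ (g : GLZ).1 * (z : GLZ).1 := by
      intro h
      apply hg
      apply Subtype.ext
      apply Units.ext
      exact h
    -- every element commutes or anticommutes with z
    have pm : ∀ h : Γ, (h : GLZ).1 * (z : GLZ).1 = (z : GLZ).1 * (h : GLZ).1 ∨
        (h : GLZ).1 * (z : GLZ).1 = - ((z : GLZ).1 * (h : GLZ).1) := by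
      intro h
      have hc := Subgroup.mem_center_iff.1 (hz h)
      set c := z * h * z⁻¹ * h⁻¹ with hcdef
      have c1 : (c : GLZ).1 * (z : GLZ).1 = (z : GLZ).1 * (c : GLZ).1 :=
        (congrArg (fun x : Γ => (x : GLZ).1) (hc z)).symm
      have c2 : (c : GLZ).1 * (g : GLZ).1 = (g : GLZ).1 * (c : GLZ).1 :=
        (congrArg (fun x : Γ => (x : GLZ).1) (hc g)).symm
      obtain ⟨s1, s2, s3⟩ := scalar_of_comm_s9 c1 c2 hzg
      have hd := detcast (c : GLZ)
      rw [Matrix.det_fin_two, s1, s3] at hd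
      have hs : (c : GLZ).1 1 1 = 1 ∨ (c : GLZ).1 1 1 = -1 := by
        rcases hd with hd | hd
        · exact mul_self_eq_one_iff.1 (by linarith)
        · nlinarith [mul_self_nonneg ((c : GLZ).1 1 1)]
      have hzh : c * (h * z) = z * h := by rw [hcdef]; group
      have hzh' : (c : GLZ).1 * ((h : GLZ).1 * (z : GLZ).1) = (z : GLZ).1 * (h : GLZ).1 :=
        congrArg (fun x : Γ => (x : GLZ).1) hzh
      rcases hs with hs | hs
      · left
        have : (c : GLZ).1 = 1 := by
          ext i j; fin_cases i <;> fin_cases j <;> simp [s1, s2, s3, hs]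
        rw [← hzh', this, one_mul]
      · right
        have : (c : GLZ).1 = -1 := by
          ext i j; fin_cases i <;> fin_cases j <;> simp [s1, s2, s3, hs]
        rw [← hzh', this]; simp
    have anti := (pm g).resolve_left (fun h => hzg h.symm)
    have tr : (z : GLZ).1 0 0 + (z : GLZ).1 1 1 = 0 := by
      have h1 : (z : GLZ).1 = - ((g⁻¹ : GLZ).1 * ((z : GLZ).1 * (g : GLZ).1)) := by
        rw [← mul_neg, ← anti, ← mul_assoc]; simp
      have h2 : Matrix.trace ((g⁻¹ : GLZ).1 * ((z : GLZ).1 * (g : GLZ).1)) = Matrix.trace (z : GLZ).1 := by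
        rw [Matrix.trace_mul_comm, mul_assoc]; simp
      have h3 := congrArg Matrix.trace h1
      rw [Matrix.trace_neg, h2, Matrix.trace_fin_two] at h3
      linarith
    have hz11 : (z : GLZ).1 1 1 = - (z : GLZ).1 0 0 := by linarith
    have hdz := detcast (z : GLZ)
    rw [Matrix.det_fin_two, hz11] at hdz
    obtain ⟨p, hp⟩ : ∃ p, p = (z : GLZ).1 0 0 := ⟨_, rfl⟩
    obtain ⟨q, hq⟩ : ∃ p, p = (z : GLZ).1 0 1 := ⟨_, rfl⟩
    obtain ⟨r, hr⟩ : ∃ p, p = (z : GLZ).1 1 0 := ⟨_, rfl⟩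
    have pm' : ∀ h ∈ Γ, h.1 * (z : GLZ).1 = (z : GLZ).1 * h.1 ∨ h.1 * (z : GLZ).1 = - ((z : GLZ).1 * h.1) := fun h hh => pm ⟨h, hh⟩
    simp only [← Matrix.ext_iff, Fin.forall_fin_two, Matrix.mul_apply, Fin.sum_univ_two,
      Matrix.neg_apply, hz11] at pm'
    rw [← hp, ← hq, ← hr] at pm' hdz
    rcases hdz with hdz | hdz
    · have hdz : -(p*p) - q*r = 1 := by linarith
      refine ⟨_, (count_anti (p : ZMod 3) (q : ZMod 3) (r : ZMod 3)).1 ?_, ?_⟩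
      · exact_mod_cast congrArg (Int.cast : ℤ → ZMod 3) hdz
      intro h hh
      have hd := detcast h
      rw [Matrix.det_fin_two] at hd
      refine Finset.mem_filter.2 ⟨Finset.mem_univ _, ?_⟩
      simp only [quad]
      rcases pm' h hh with ⟨⟨e1, e2⟩, e3, e4⟩ | ⟨⟨e1, e2⟩, e3, e4⟩
      · left
        have hd' := comm_det hdz e1 (by linarith) hd
        refine ⟨?_, ?_, ?_, ?_, ?_⟩
        · exact_mod_cast congrArg (Int.cast : ℤ → ZMod 3) e1
        · have := congrArg (Int.cast : ℤ → ZMod 3) e2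
          push_cast at this; linear_combination this
        · have := congrArg (Int.cast : ℤ → ZMod 3) e3
          push_cast at this; linear_combination this
        · have := congrArg (Int.cast : ℤ → ZMod 3) e4
          push_cast at this; linear_combination this
        · exact_mod_cast congrArg (Int.cast : ℤ → ZMod 3) hd'
      · right
        have hd' := anti_det hdz e1 (by linarith) hd
        refine ⟨?_, ?_, ?_, ?_, ?_⟩
        · exact_mod_cast congrArg (Int.cast : ℤ → ZMod 3) e1
        · have := congrArg (Int.cast : ℤ → ZMod 3) e2
          push_cast at this; linear_combination this
        · have := congrArg (Int.cast : ℤ → ZMod 3) e3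
          push_cast at this; linear_combination this
        · have := congrArg (Int.cast : ℤ → ZMod 3) e4
          push_cast at this; linear_combination this
        · exact_mod_cast congrArg (Int.cast : ℤ → ZMod 3) hd'
    · have hdz : -(p*p) - q*r = -1 := by linarith
      refine ⟨_, (count_anti (p : ZMod 3) (q : ZMod 3) (r : ZMod 3)).2 ?_, ?_⟩
      · exact_mod_cast congrArg (Int.cast : ℤ → ZMod 3) hdz
      intro h hh
      have hd := detcast h
      rw [Matrix.det_fin_two] at hd
      refine Finset.mem_filter.2 ⟨Finset.mem_univ _, ?_⟩
      simp only [quad]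
      refine ⟨?_, ?_⟩
      · rcases pm' h hh with ⟨⟨e1, e2⟩, e3, e4⟩ | ⟨⟨e1, e2⟩, e3, e4⟩
        · left
          refine ⟨?_, ?_, ?_, ?_⟩
          · exact_mod_cast congrArg (Int.cast : ℤ → ZMod 3) e1
          · have := congrArg (Int.cast : ℤ → ZMod 3) e2
            push_cast at this; linear_combination this
          · have := congrArg (Int.cast : ℤ → ZMod 3) e3
            push_cast at this; linear_combination this
          · have := congrArg (Int.cast : ℤ → ZMod 3) e4
            push_cast at this; linear_combination this
        · right
          refine ⟨?_, ?_, ?_, ?_⟩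
          · exact_mod_cast congrArg (Int.cast : ℤ → ZMod 3) e1
          · have := congrArg (Int.cast : ℤ → ZMod 3) e2
            push_cast at this; linear_combination this
          · have := congrArg (Int.cast : ℤ → ZMod 3) e3
            push_cast at this; linear_combination this
          · have := congrArg (Int.cast : ℤ → ZMod 3) e4
            push_cast at this; linear_combination this
      · rcases hd with hd | hd
        · have := congrArg (Int.cast : ℤ → ZMod 3) hd
          push_cast at this
          rw [this]; decide
        · have := congrArg (Int.cast : ℤ → ZMod 3) hd
          push_cast at this
          rw [this]; decide

/-- reduction mod 3 -/
noncomputable def red3 : GLZ →* GL (Fin 2) (ZMod 3) := Matrix.GeneralLinearGroup.map (Int.castRingHom (ZMod 3))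

lemma index_lemma {Q : Type*} [Group Q] [Group.IsNilpotent Q] (ρ : Q →* GLZ) :
    (red3.comp ρ).ker.index ∈ ({1, 2, 3, 4, 6, 8} : Set ℕ) := by
  rw [Subgroup.index_ker]
  have : Group.IsNilpotent ρ.range := Group.nilpotent_of_surjective ρ.rangeRestrict ρ.rangeRestrict_surjective
  obtain ⟨S, hS, hm⟩ := quad_subset ρ.range
  have hle : Nat.card (red3.comp ρ).range ≤ 8 := by
    refine le_trans ?_ hS
    have hmem : ∀ x : (red3.comp ρ).range, ((x.1.1 0 0, x.1.1 0 1, x.1.1 1 0, x.1.1 1 1) : ZMod 3 × ZMod 3 × ZMod 3 × ZMod 3) ∈ S := by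
      rintro ⟨x, y, rfl⟩
      exact hm (ρ y) ⟨y, rfl⟩
    have := Nat.card_le_card_of_injective (fun x : (red3.comp ρ).range => (⟨_, hmem x⟩ : S)) (by
      rintro ⟨x, hx⟩ ⟨y, hy⟩ h
      simp only [Subtype.mk.injEq, Prod.mk.injEq] at h
      apply Subtype.ext
      apply Units.ext
      ext i j
      fin_cases i <;> fin_cases j <;> simp [h])
    simpa using this
  have hdvd : Nat.card (red3.comp ρ).range ∣ 48 := by
    have h := Subgroup.card_subgroup_dvd_card (red3.comp ρ).range
    have : Nat.card (GL (Fin 2) (ZMod 3)) = 48 := by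
      have : Fact (Nat.Prime 3) := ⟨by norm_num⟩
      rw [Matrix.card_GL_field]
      simp [Fin.prod_univ_two]
    rwa [this] at h
  generalize Nat.card (red3.comp ρ).range = k at *
  interval_cases k <;> simp_all


lemma int_const {w : ℤ → ℝ} (h : ∀ n, w (n + 1) = w n) (n : ℤ) : w n = w 0 := by
  induction n using Int.induction_on with
  | zero => rfl
  | succ i ih => rw [h, ih]
  | pred i ih => rw [← ih, ← h (-i - 1)]; congr 1; ring

lemma lin_bounded {x : ℤ → ℝ} {C e : ℝ} (hb : ∀ n, |x n| ≤ C) (h : ∀ n, x (n + 1) = x n + e) :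
    e = 0 := by
  have h1 : ∀ n : ℤ, x n - n * e = x 0 := by
    intro n
    have := int_const (w := fun n : ℤ => x n - n * e) (fun n => by simp only [h]; push_cast; ring) n
    simpa using this
  by_contra he
  have hpos : 0 < |e| := abs_pos.2 he
  obtain ⟨N, hN⟩ := exists_nat_gt ((2 * C) / |e|)
  rw [div_lt_iff₀ hpos] at hN
  have h2 := h1 N
  have h3 : |(N : ℝ) * e| = N * |e| := by rw [abs_mul, Nat.abs_cast]
  have h4 : (N : ℝ) * e = x N - x 0 := by push_cast at h2; linarith
  have h5 : |x N - x 0| ≤ |x N| + |x 0| := abs_sub _ _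
  rw [← h4, h3] at h5
  linarith [hb N, hb 0]

lemma rec_bounded {y : ℤ → ℝ} {C t : ℝ} (hb : ∀ n, |y n| ≤ C) (ht : 2 < |t|)
    (h : ∀ n, y (n + 1 + 1) = t * y (n + 1) - y n) (n : ℤ) : y n = 0 := by
  have bdd : BddAbove (range fun n => |y n|) := ⟨C, by rintro _ ⟨n, rfl⟩; exact hb n⟩
  set S := ⨆ n, |y n| with hS
  have hle : ∀ n, |y n| ≤ S := fun n => le_ciSup bdd n
  have hS0 : 0 ≤ S := (abs_nonneg _).trans (hle 0)
  have h1 : ∀ n, |y n| ≤ 2 * S / |t| := by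
    intro n
    rw [le_div_iff₀ (by linarith), mul_comm, ← abs_mul]
    have e := h (n - 1)
    rw [sub_add_cancel] at e
    have : t * y n = y (n + 1) + y (n - 1) := by linarith
    rw [this]
    refine (abs_add_le _ _).trans ?_
    linarith [hle (n + 1), hle (n - 1)]
  have h2 : S ≤ 2 * S / |t| := ciSup_le h1
  rw [le_div_iff₀ (by linarith)] at h2
  have : S = 0 := by nlinarith
  have := hle n
  exact abs_eq_zero.1 (le_antisymm (by linarith) (abs_nonneg _))

lemma scal_good {x : ℤ → ℝ} {C t : ℝ} (hb : ∀ n, |x n| ≤ C) (ht : t = 2 ∨ 2 < |t|)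
    (h : ∀ n, x (n + 1 + 1 + 1) - x (n + 1 + 1) = t * (x (n + 1 + 1) - x (n + 1)) - (x (n + 1) - x n)) (n : ℤ) :
    x (n + 1) = x n := by
  have hb' : ∀ n, |x (n + 1) - x n| ≤ 2 * C := fun n =>
    (abs_sub _ _).trans (by linarith [hb (n+1), hb n])
  rcases ht with rfl | ht
  · have h1 : ∀ n, x (n + 1 + 1) - x (n + 1) - (x (n + 1) - x n) = x (0 + 1 + 1) - x (0 + 1) - (x (0 + 1) - x 0) :=
      fun n => int_const (w := fun n => x (n + 1 + 1) - x (n + 1) - (x (n + 1) - x n))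
        (fun n => by linarith [h n]) n
    have h2 := lin_bounded (x := fun n => x (n + 1) - x n)
      (e := x (0 + 1 + 1) - x (0 + 1) - (x (0 + 1) - x 0)) hb' (fun n => by linarith [h1 n])
    have h3 : ∀ n, x (n + 1) - x n = x (0 + 1) - x 0 :=
      fun n => int_const (w := fun n => x (n + 1) - x n) (fun n => by linarith [h1 n]) n
    have h4 := lin_bounded (x := x) (e := x (0 + 1) - x 0) hb (fun n => by linarith [h3 n])
    linarith [h3 n]
  · have := rec_bounded (y := fun n => x (n + 1) - x n) hb' ht (fun n => h n) n
    linarith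

lemma good_trace {M : GLZ} (h : red3 M = 1) :
    M.1 0 0 * M.1 1 1 - M.1 0 1 * M.1 1 0 = 1 ∧
    (((M.1 0 0 + M.1 1 1 : ℤ) : ℝ) = 2 ∨ 2 < |((M.1 0 0 + M.1 1 1 : ℤ) : ℝ)|) := by
  have hh : ∀ i j, ((M.1 i j : ℤ) : ZMod 3) = (1 : Matrix (Fin 2) (Fin 2) (ZMod 3)) i j := by
    intro i j
    have := congrArg (fun x : GL (Fin 2) (ZMod 3) => x.1 i j) h
    exact this
  have a := hh 0 0
  have b := hh 0 1
  have c := hh 1 0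
  have d := hh 1 1
  simp at a b c d
  have a' : (3 : ℤ) ∣ M.1 0 0 - 1 := 
    (ZMod.intCast_zmod_eq_zero_iff_dvd _ 3).1 (by simp [a])
  have d' : (3 : ℤ) ∣ M.1 1 1 - 1 := 
    (ZMod.intCast_zmod_eq_zero_iff_dvd _ 3).1 (by simp [d])
  have b' : (3 : ℤ) ∣ M.1 0 1 := 
    (ZMod.intCast_zmod_eq_zero_iff_dvd _ 3).1 (by simp [b])
  have c' : (3 : ℤ) ∣ M.1 1 0 := 
    (ZMod.intCast_zmod_eq_zero_iff_dvd _ 3).1 (by simp [c])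
  obtain ⟨a1, ha⟩ := a'
  obtain ⟨b1, hb⟩ := b'
  obtain ⟨c1, hc⟩ := c'
  obtain ⟨d1, hd⟩ := d'
  have ha : M.1 0 0 = 3 * a1 + 1 := by linarith
  have hd : M.1 1 1 = 3 * d1 + 1 := by linarith
  have hdet := detcast M
  rw [Matrix.det_fin_two, ha, hb, hc, hd] at hdet
  rw [ha, hb, hc, hd]
  have e : (3 * a1 + 1) * (3 * d1 + 1) - 3 * b1 * (3 * c1) = 1 + 3 * (a1 + d1) + 9 * (a1 * d1 - b1 * c1) := by ring
  rw [e] at hdet ⊢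
  generalize a1 * d1 - b1 * c1 = k at *
  refine ⟨by omega, ?_⟩
  have : 3 * a1 + 1 + (3 * d1 + 1) = 2 - 9 * k := by omega
  rw [this]
  have : k = 0 ∨ 1 ≤ k ∨ k ≤ -1 := by omega
  rcases this with rfl | h | h
  · left; simp
  · right; rw [lt_abs]; right
    exact_mod_cast (by omega : (2 : ℤ) < -(2 - 9 * k))
  · right; rw [lt_abs]; left
    exact_mod_cast (by omega : (2 : ℤ) < (2 - 9 * k))

lemma good_const {M : GLZ} (h : red3 M = 1) {u : ℤ → ℝ × ℝ} {C : ℝ} {c : ℝ × ℝ}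
    (hb1 : ∀ n, |(u n).1| ≤ C) (hb2 : ∀ n, |(u n).2| ≤ C)
    (hu : ∀ n, u (n + 1) = mact M.1 (u n) - c) (n : ℤ) : u (n + 1) = u n := by
  obtain ⟨hdet, ht⟩ := good_trace h
  have hdet' : (M.1 0 0 : ℝ) * M.1 1 1 - M.1 0 1 * M.1 1 0 = 1 := by exact_mod_cast hdet
  have e1 : ∀ n, (u (n + 1)).1 = (M.1 0 0 : ℝ) * (u n).1 + (M.1 0 1 : ℝ) * (u n).2 - c.1 :=
    fun n => by rw [hu]; rfl
  have e2 : ∀ n, (u (n + 1)).2 = (M.1 1 0 : ℝ) * (u n).1 + (M.1 1 1 : ℝ) * (u n).2 - c.2 :=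
    fun n => by rw [hu]; rfl
  apply Prod.ext
  · refine scal_good hb1 ht (fun n => ?_) n
    push_cast
    rw [e1 (n + 1 + 1), e1 (n + 1), e2 (n + 1), e1 n, e2 n]
    linear_combination ((u n).1 - ((M.1 0 0 : ℝ) * (u n).1 + (M.1 0 1 : ℝ) * (u n).2 - c.1)) * hdet'
  · refine scal_good hb2 ht (fun n => ?_) n
    push_cast
    rw [e2 (n + 1 + 1), e1 (n + 1), e2 (n + 1), e1 n, e2 n]
    linear_combination ((u n).2 - ((M.1 1 0 : ℝ) * (u n).1 + (M.1 1 1 : ℝ) * (u n).2 - c.2)) * hdet'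

/-- the matrix of a torus homeomorphism -/
noncomputable def mcgFun (f : T2 ≃ₜ T2) : Matrix (Fin 2) (Fin 2) ℤ :=
  (exists_lm f.continuous).choose_spec.choose

lemma mcgFun_spec (f : T2 ≃ₜ T2) : ∃ F, IsLM f F (mcgFun f) :=
  ⟨_, (exists_lm f.continuous).choose_spec.choose_spec⟩

lemma mcgFun_eq {f : T2 ≃ₜ T2} {F A} (h : IsLM f F A) : mcgFun f = A := by
  obtain ⟨G, hG⟩ := mcgFun_spec f
  exact hG.mat_unique h

/-- as a monoid hom -/
noncomputable def mcgM : (T2 ≃ₜ T2) →* Matrix (Fin 2) (Fin 2) ℤ where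
  toFun := mcgFun
  map_one' := mcgFun_eq (f := 1) isLM_id
  map_mul' f g := by
    obtain ⟨F, hF⟩ := mcgFun_spec f
    obtain ⟨G, hG⟩ := mcgFun_spec g
    exact mcgFun_eq (f := f * g) (hF.comp hG)

/-- the mapping class hom -/
noncomputable def mcg : (T2 ≃ₜ T2) →* GLZ := mcgM.toHomUnits

lemma mcg_lift {f : T2 ≃ₜ T2} {F} (h : IsLift f F) : IsLM f F (mcg f).1 := by
  obtain ⟨G, hG⟩ := mcgFun_spec f
  exact hG.of_lift h

lemma mcg_exists (f : T2 ≃ₜ T2) : ∃ F, IsLM f F (mcg f).1 := mcgFun_spec f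

lemma mcg_isotopic {f : T2 ≃ₜ T2} (h : IsotopicToId f) : mcg f = 1 := by
  obtain ⟨F, hF⟩ := isotopic_lm h
  exact Units.ext (mcgFun_eq hF)

lemma lift_of_triv {f : T2 ≃ₜ T2} (hf : mcg f = 1) {F} (h : IsLift f F) : IsLM f F 1 := by
  have := mcg_lift h
  rw [hf] at this
  exact this


/-- states on C(T2) -/
def States : Set (C(T2, ℝ) → ℝ) :=
  {Λ | (∀ f g, Λ (f + g) = Λ f + Λ g) ∧ (∀ (c : ℝ) f, Λ (c • f) = c * Λ f) ∧
    (∀ f, 0 ≤ f → 0 ≤ Λ f) ∧ Λ 1 = 1}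

/-- push-forward of a functional -/
def push (g : T2 ≃ₜ T2) (Λ : C(T2, ℝ) → ℝ) : C(T2, ℝ) → ℝ :=
  fun f => Λ (f.comp (g : C(T2, T2)))

lemma push_mul (g h : T2 ≃ₜ T2) (Λ) : push (g * h) Λ = push g (push h Λ) := rfl
lemma push_one (Λ) : push 1 Λ = Λ := rfl

lemma push_states {g : T2 ≃ₜ T2} {Λ} (h : Λ ∈ States) : push g Λ ∈ States := by
  obtain ⟨h1, h2, h3, h4⟩ := h
  exact ⟨fun f k => h1 (f.comp (g : C(T2, T2))) (k.comp (g : C(T2, T2))),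
    fun c f => h2 c (f.comp (g : C(T2, T2))),
    fun f hf => h3 (f.comp (g : C(T2, T2))) (fun x => hf (g x)), h4⟩

lemma state_sub {Λ} (h : Λ ∈ States) (f g : C(T2, ℝ)) : Λ (f - g) = Λ f - Λ g := by
  have h1 := h.1 f ((-1 : ℝ) • g)
  rw [h.2.1] at h1
  have : f + (-1 : ℝ) • g = f - g := by ext; simp; ring
  rw [this] at h1
  rw [h1]; ring

lemma state_mono {Λ} (h : Λ ∈ States) {f g : C(T2, ℝ)} (hfg : f ≤ g) : Λ f ≤ Λ g := by
  have := h.2.2.1 (g - f) (sub_nonneg.2 hfg)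
  rw [state_sub h] at this
  linarith

lemma state_bound {Λ} (h : Λ ∈ States) (f : C(T2, ℝ)) : |Λ f| ≤ ‖f‖ := by
  have hb : ∀ c : ℝ, Λ (c • 1) = c := fun c => by rw [h.2.1, h.2.2.2, mul_one]
  rw [abs_le]
  constructor
  · rw [← hb (-‖f‖)]
    refine state_mono h ?_
    intro x
    simpa using (abs_le.1 (f.norm_coe_le_norm x)).1
  · rw [← hb ‖f‖]
    refine state_mono h ?_
    intro x
    simpa using (abs_le.1 (f.norm_coe_le_norm x)).2

lemma isClosed_states : IsClosed States := by
  have e : States = (⋂ f, ⋂ g, {Λ | Λ (f + g) = Λ f + Λ g}) ∩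
     ((⋂ c : ℝ, ⋂ f, {Λ | Λ (c • f) = c * Λ f}) ∩
      ((⋂ f, ⋂ (_ : 0 ≤ f), {Λ | 0 ≤ Λ f}) ∩ {Λ | Λ 1 = 1})) := by
    ext Λ
    simp [States]
  rw [e]
  refine IsClosed.inter ?_ (IsClosed.inter ?_ (IsClosed.inter ?_ ?_))
  · exact isClosed_iInter fun f => isClosed_iInter fun g => isClosed_eq (by fun_prop) (by fun_prop)
  · exact isClosed_iInter fun f => isClosed_iInter fun g => isClosed_eq (by fun_prop) (by fun_prop)
  · exact isClosed_iInter fun f => isClosed_iInter fun g => isClosed_le (by fun_prop) (by fun_prop)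
  · exact isClosed_eq (by fun_prop) (by fun_prop)

lemma isCompact_states : IsCompact States := by
  have : IsCompact (Set.pi univ (fun f : C(T2, ℝ) => Icc (-‖f‖) ‖f‖)) :=
    isCompact_univ_pi fun f => isCompact_Icc
  refine this.of_isClosed_subset isClosed_states ?_
  intro Λ h f _
  exact abs_le.1 (state_bound h f)

lemma convex_states : Convex ℝ States := by
  rintro x ⟨x1, x2, x3, x4⟩ y ⟨y1, y2, y3, y4⟩ a b ha hb hab
  refine ⟨fun f g => ?_, fun c f => ?_, fun f hf => ?_, ?_⟩
  · simp only [Pi.add_apply, Pi.smul_apply, smul_eq_mul, x1, y1]; ring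
  · simp only [Pi.add_apply, Pi.smul_apply, smul_eq_mul, x2, y2]; ring
  · simp only [Pi.add_apply, Pi.smul_apply, smul_eq_mul]
    have := x3 f hf
    have := y3 f hf
    positivity
  · simp only [Pi.add_apply, Pi.smul_apply, smul_eq_mul, x4, y4]; linarith

lemma continuous_push (g : T2 ≃ₜ T2) : Continuous (push g) := by
  unfold push; fun_prop

lemma single_fixed {K : Set (C(T2, ℝ) → ℝ)} (hK : K ⊆ States) (hc : IsCompact K) (hv : Convex ℝ K)
    (hne : K.Nonempty) (g : T2 ≃ₜ T2) (hg : ∀ Λ ∈ K, push g Λ ∈ K) :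
    ∃ Λ ∈ K, push g Λ = Λ := by
  obtain ⟨Λ0, h0⟩ := hne
  set P : ℕ → (C(T2, ℝ) → ℝ) := fun i => (push g)^[i] Λ0 with hP
  have hPK : ∀ i, P i ∈ K := by
    intro i
    induction i with
    | zero => exact h0
    | succ i ih => simp only [hP, Function.iterate_succ_apply']; exact hg _ ih
  set a : ℕ → (C(T2, ℝ) → ℝ) := fun n => ∑ i ∈ Finset.range (n + 1), ((n + 1 : ℝ)⁻¹) • P i with ha
  have haK : ∀ n, a n ∈ K := by
    intro n
    refine hv.sum_mem (fun i _ => by positivity) ?_ (fun i _ => hPK i)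
    simp
    field_simp
  have hdiff : ∀ n f, push g (a n) f - a n f = (n + 1 : ℝ)⁻¹ * (P (n + 1) f - P 0 f) := by
    intro n f
    have e : push g (a n) f = ∑ i ∈ Finset.range (n + 1), (n + 1 : ℝ)⁻¹ * P (i + 1) f := by
      simp only [push, ha, hP, Finset.sum_apply, Pi.smul_apply, smul_eq_mul,
        Function.iterate_succ_apply']
    rw [e]
    simp only [ha, Finset.sum_apply, Pi.smul_apply, smul_eq_mul]
    rw [← Finset.sum_sub_distrib, ← Finset.sum_range_sub (fun i => P i f), Finset.mul_sum]
    exact Finset.sum_congr rfl fun i _ => by ring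
  obtain ⟨Λ, hΛ, hcl⟩ := hc.exists_mapClusterPt (f := atTop) (u := a)
    (Filter.tendsto_principal.2 (Filter.Eventually.of_forall haK))
  refine ⟨Λ, hΛ, ?_⟩
  funext f
  have hD : Continuous (fun M : C(T2, ℝ) → ℝ => push g M f - M f) := by
    unfold push; fun_prop
  have h1 : MapClusterPt (push g Λ f - Λ f) atTop (fun n => push g (a n) f - a n f) :=
    hcl.continuousAt_comp (f := fun M : C(T2, ℝ) → ℝ => push g M f - M f) hD.continuousAt
  have h2 : Tendsto (fun n => push g (a n) f - a n f) atTop (𝓝 0) := by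
    simp only [hdiff]
    have t1 : Tendsto (fun n : ℕ => (2 * ‖f‖) * (1 / ((n : ℝ) + 1))) atTop (𝓝 0) := by
      simpa using tendsto_one_div_add_atTop_nhds_zero_nat.const_mul (2 * ‖f‖)
    refine squeeze_zero_norm (fun n => ?_) t1
    rw [norm_mul, Real.norm_eq_abs, Real.norm_eq_abs, abs_of_pos (by positivity : (0:ℝ) < (n + 1 : ℝ)⁻¹)]
    have : |P (n + 1) f - P 0 f| ≤ 2 * ‖f‖ := (abs_sub _ _).trans (by
      linarith [state_bound (hK (hPK (n + 1))) f, state_bound (hK (hPK 0)) f])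
    rw [one_div, mul_comm]
    gcongr
  have h3 : ClusterPt (push g Λ f - Λ f) (𝓝 0) := ClusterPt.mono h1 h2
  have h4 : push g Λ f - Λ f = 0 := eq_of_nhds_neBot h3
  linarith

lemma finite_fixed {K : Set (C(T2, ℝ) → ℝ)} (hK : K ⊆ States) (hc : IsCompact K) (hv : Convex ℝ K)
    (hne : K.Nonempty) (S : Set (T2 ≃ₜ T2)) (hS : ∀ g ∈ S, ∀ Λ ∈ K, push g Λ ∈ K)
    (hcomm : ∀ g ∈ S, ∀ h ∈ S, ∀ Λ ∈ K, push g (push h Λ) = push h (push g Λ))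
    (s : Finset S) : ({Λ ∈ K | ∀ g ∈ s, push g Λ = Λ}).Nonempty := by
  classical
  induction s using Finset.induction_on with
  | empty => simpa using hne
  | insert a s _ ih =>
    have k1 : IsCompact {Λ ∈ K | ∀ g ∈ s, push g Λ = Λ} := by
      refine hc.inter_right ?_
      have : {Λ : C(T2, ℝ) → ℝ | ∀ g ∈ s, push g Λ = Λ} = ⋂ g ∈ s, {Λ | push g Λ = Λ} := by
        ext; simp
      change IsClosed {Λ : C(T2, ℝ) → ℝ | ∀ g ∈ s, push g Λ = Λ}
      rw [this]
      exact isClosed_biInter fun g _ => isClosed_eq (continuous_push _) continuous_id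
    have k2 : Convex ℝ {Λ ∈ K | ∀ g ∈ s, push g Λ = Λ} := by
      refine hv.inter ?_
      intro x hx y hy p q _ _ _ g hg
      have e1 : push g x = x := hx g hg
      have e2 : push g y = y := hy g hg
      calc push g (p • x + q • y) = p • push g x + q • push g y := rfl
        _ = _ := by rw [e1, e2]
    obtain ⟨Λ, ⟨h1, h2⟩, h3⟩ := single_fixed (K := {Λ ∈ K | ∀ g ∈ s, push g Λ = Λ})
      (fun Λ h => hK h.1) k1 k2 ih a (by
        rintro Λ ⟨h1, h2⟩
        refine ⟨hS a a.2 Λ h1, fun g hg => ?_⟩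
        rw [hcomm g g.2 a a.2 Λ h1, h2 g hg])
    refine ⟨Λ, h1, ?_⟩
    intro g hg
    rcases Finset.mem_insert.1 hg with rfl | hg
    · exact h3
    · exact h2 g hg

lemma markov_kakutani {K : Set (C(T2, ℝ) → ℝ)} (hK : K ⊆ States) (hc : IsCompact K) (hv : Convex ℝ K)
    (hne : K.Nonempty) (S : Set (T2 ≃ₜ T2)) (hS : ∀ g ∈ S, ∀ Λ ∈ K, push g Λ ∈ K)
    (hcomm : ∀ g ∈ S, ∀ h ∈ S, ∀ Λ ∈ K, push g (push h Λ) = push h (push g Λ)) :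
    ∃ Λ ∈ K, ∀ g ∈ S, push g Λ = Λ := by
  have := hc.inter_iInter_nonempty (fun g : S => {Λ | push g Λ = Λ})
    (fun g => isClosed_eq (continuous_push _) continuous_id) (fun s => by
      obtain ⟨Λ, h1, h2⟩ := finite_fixed hK hc hv hne S hS hcomm s
      exact ⟨Λ, h1, by simpa using h2⟩)
  obtain ⟨Λ, h1, h2⟩ := this
  refine ⟨Λ, h1, fun g hg => ?_⟩
  exact (mem_iInter.1 h2) ⟨g, hg⟩

/-- first component -/
def fstC (d : C(T2, ℝ × ℝ)) : C(T2, ℝ) := ⟨fun x => (d x).1, by fun_prop⟩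
/-- second component -/
def sndC (d : C(T2, ℝ × ℝ)) : C(T2, ℝ) := ⟨fun x => (d x).2, by fun_prop⟩
/-- rotation vector of a state -/
def rot (Λ : C(T2, ℝ) → ℝ) (d : C(T2, ℝ × ℝ)) : ℝ × ℝ := (Λ (fstC d), Λ (sndC d))

/-- `d` is the displacement of `F` -/
def IsDisp (F : ℝ × ℝ → ℝ × ℝ) (d : C(T2, ℝ × ℝ)) : Prop := ∀ p, d (torusProj p) = F p - p

lemma exists_disp {f F} (h : IsLM f F 1) : ∃ d, IsDisp F d := by
  refine descends (u := fun p => F p - p) (h.1.1.sub continuous_id) (fun p m n => ?_)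
  simp only [h.2, mact_one]; abel

lemma conj_rel {φ g : T2 ≃ₜ T2} {F d} (hφ : mcg φ = 1) (hF : IsLift φ F) (hd : IsDisp F d) :
    ∃ E e, IsLift (g * φ * g⁻¹ * φ⁻¹ : T2 ≃ₜ T2) E ∧ IsDisp E e ∧
      ∀ Λ ∈ States, push φ Λ = Λ → push φ (push g Λ) = push g Λ →
        rot (push g Λ) d + rot (push g Λ) e = mact (mcg g).1 (rot Λ d) := by
  set ψ : T2 ≃ₜ T2 := g * φ * g⁻¹ * φ⁻¹ with hψ
  have hψ1 : mcg ψ = 1 := by simp [hψ, hφ]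
  obtain ⟨G, hG⟩ := mcg_exists g
  obtain ⟨E0, hE0⟩ := mcg_exists ψ
  rw [hψ1] at hE0
  have hmul : ψ * φ * g = g * φ := by rw [hψ]; group
  have l1 : IsLift (ψ * φ * g : T2 ≃ₜ T2) (fun p => E0 (F (G p))) :=
    ⟨hE0.1.1.comp (hF.1.comp hG.1.1), fun p => by rw [hE0.1.2, hF.2, hG.1.2]; rfl⟩
  have l2 : IsLift (ψ * φ * g : T2 ≃ₜ T2) (fun p => G (F p)) :=
    ⟨hG.1.1.comp hF.1, fun p => by rw [hG.1.2, hF.2, hmul]; rfl⟩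
  obtain ⟨m, n, hmn⟩ := l1.unique l2
  have hE := hE0.add_int m n
  set E := fun p => E0 p + ((m : ℝ), (n : ℝ)) with hEdef
  obtain ⟨e, he⟩ := exists_disp hE
  obtain ⟨η, hη⟩ := descends (u := fun p => G p - mact (mcg g).1 p)
    (hG.1.1.sub (continuous_mact _)) (fun p m n => by
      simp only [hG.2, mact_add]; abel)
  have point : ∀ x, d (g x) + e (φ (g x)) = mact (mcg g).1 (d x) + η (φ x) - η x := by
    intro x
    obtain ⟨p, rfl⟩ := surjective_torusProj x
    rw [← hG.1.2, hd, ← hF.2, he, hd, ← hF.2, hη, hη, mact_sub]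
    have : E (F (G p)) = G (F p) := (hmn p).symm
    rw [this]; abel
  refine ⟨E, e, hE.1, he, ?_⟩
  intro Λ hΛ i1 i2
  have c1 : (fstC d).comp (g : C(T2, T2)) + ((fstC e).comp (φ : C(T2, T2))).comp (g : C(T2, T2)) =
     ((((mcg g).1 0 0 : ℝ) • fstC d + ((mcg g).1 0 1 : ℝ) • sndC d) + (fstC η).comp (φ : C(T2, T2))) - fstC η := by
    ext x
    exact congrArg Prod.fst (point x)
  have c2 : (sndC d).comp (g : C(T2, T2)) + ((sndC e).comp (φ : C(T2, T2))).comp (g : C(T2, T2)) =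
     ((((mcg g).1 1 0 : ℝ) • fstC d + ((mcg g).1 1 1 : ℝ) • sndC d) + (sndC η).comp (φ : C(T2, T2))) - sndC η := by
    ext x
    exact congrArg Prod.snd (point x)
  have j1 : ∀ f : C(T2, ℝ), Λ ((f.comp (φ : C(T2, T2))).comp (g : C(T2, T2))) = push g Λ f :=
    fun f => congrFun i2 f
  have j2 : ∀ f : C(T2, ℝ), Λ (f.comp (φ : C(T2, T2))) = Λ f := fun f => congrFun i1 f
  apply Prod.ext
  · have := congrArg Λ c1
    rw [state_sub hΛ, hΛ.1, hΛ.1, hΛ.1, hΛ.2.1, hΛ.2.1, j2, j1] at this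
    simp only [rot, mact, Prod.fst_add]
    change Λ ((fstC d).comp (g : C(T2, T2))) + _ = _
    linarith
  · have := congrArg Λ c2
    rw [state_sub hΛ, hΛ.1, hΛ.1, hΛ.1, hΛ.2.1, hΛ.2.1, j2, j1] at this
    simp only [rot, mact, Prod.snd_add]
    change Λ ((sndC d).comp (g : C(T2, T2))) + _ = _
    linarith

lemma conj_rel2 {φ g : T2 ≃ₜ T2} {F d} (hφ : mcg φ = 1) (hF : IsLift φ F) (hd : IsDisp F d) :
    ∃ E e, IsLift (g * φ * g⁻¹ : T2 ≃ₜ T2) E ∧ IsDisp E e ∧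
      ∀ Λ ∈ States, push φ Λ = Λ →
        rot (push g Λ) e = mact (mcg g).1 (rot Λ d) := by
  set ψ : T2 ≃ₜ T2 := g * φ * g⁻¹ with hψ
  have hψ1 : mcg ψ = 1 := by simp [hψ, hφ]
  obtain ⟨G, hG⟩ := mcg_exists g
  obtain ⟨E0, hE0⟩ := mcg_exists ψ
  rw [hψ1] at hE0
  have hmul : ψ * g = g * φ := by rw [hψ]; group
  have l1 : IsLift (ψ * g : T2 ≃ₜ T2) (fun p => E0 (G p)) :=
    ⟨hE0.1.1.comp hG.1.1, fun p => by rw [hE0.1.2, hG.1.2]; rfl⟩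
  have l2 : IsLift (ψ * g : T2 ≃ₜ T2) (fun p => G (F p)) :=
    ⟨hG.1.1.comp hF.1, fun p => by rw [hG.1.2, hF.2, hmul]; rfl⟩
  obtain ⟨m, n, hmn⟩ := l1.unique l2
  have hE := hE0.add_int m n
  set E := fun p => E0 p + ((m : ℝ), (n : ℝ)) with hEdef
  obtain ⟨e, he⟩ := exists_disp hE
  obtain ⟨η, hη⟩ := descends (u := fun p => G p - mact (mcg g).1 p)
    (hG.1.1.sub (continuous_mact _)) (fun p m n => by
      simp only [hG.2, mact_add]; abel)
  have point : ∀ x, e (g x) = mact (mcg g).1 (d x) + η (φ x) - η x := by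
    intro x
    obtain ⟨p, rfl⟩ := surjective_torusProj x
    rw [← hG.1.2, he, hd, ← hF.2, hη, hη, mact_sub]
    have : E (G p) = G (F p) := (hmn p).symm
    rw [this]; abel
  refine ⟨E, e, hE.1, he, ?_⟩
  intro Λ hΛ i1
  have c1 : (fstC e).comp (g : C(T2, T2)) =
     ((((mcg g).1 0 0 : ℝ) • fstC d + ((mcg g).1 0 1 : ℝ) • sndC d) + (fstC η).comp (φ : C(T2, T2))) - fstC η := by
    ext x
    exact congrArg Prod.fst (point x)
  have c2 : (sndC e).comp (g : C(T2, T2)) =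
     ((((mcg g).1 1 0 : ℝ) • fstC d + ((mcg g).1 1 1 : ℝ) • sndC d) + (sndC η).comp (φ : C(T2, T2))) - sndC η := by
    ext x
    exact congrArg Prod.snd (point x)
  have j2 : ∀ f : C(T2, ℝ), Λ (f.comp (φ : C(T2, T2))) = Λ f := fun f => congrFun i1 f
  apply Prod.ext
  · have := congrArg Λ c1
    rw [state_sub hΛ, hΛ.1, hΛ.1, hΛ.2.1, hΛ.2.1, j2] at this
    simp only [rot, mact]
    change Λ ((fstC e).comp (g : C(T2, T2))) = _
    linarith
  · have := congrArg Λ c2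
    rw [state_sub hΛ, hΛ.1, hΛ.1, hΛ.2.1, hΛ.2.1, j2] at this
    simp only [rot, mact]
    change Λ ((sndC e).comp (g : C(T2, T2))) = _
    linarith


/-- stabilizer of a functional -/
def stab (Λ : C(T2, ℝ) → ℝ) : Subgroup (T2 ≃ₜ T2) where
  carrier := {g | push g Λ = Λ}
  one_mem' := push_one Λ
  mul_mem' := by
    intro a b ha hb
    simp only [mem_setOf_eq] at *
    rw [push_mul, hb, ha]
  inv_mem' := by
    intro a ha
    simp only [mem_setOf_eq] at *
    conv_lhs => rw [← ha]
    rw [← push_mul, inv_mul_cancel, push_one]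

lemma mem_stab {g Λ} : g ∈ stab Λ ↔ push g Λ = Λ := Iff.rfl

lemma stab_push {L : Subgroup (T2 ≃ₜ T2)} {g : T2 ≃ₜ T2} {Λ} (hg : g ∈ Subgroup.normalizer (L : Set (T2 ≃ₜ T2)))
    (h : L ≤ stab Λ) : L ≤ stab (push g Λ) := by
  intro l hl
  rw [mem_stab, ← push_mul]
  have h1 : g⁻¹ * l * g ∈ L := by
    rw [Subgroup.mem_normalizer_iff] at hg
    refine (hg _).2 ?_
    have : g * (g⁻¹ * l * g) * g⁻¹ = l := by group
    rw [this]; exact hl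
  have h2 : push (g⁻¹ * l * g) Λ = Λ := h h1
  have : l * g = g * (g⁻¹ * l * g) := by group
  rw [this, push_mul, h2]

lemma key_inv {H : Subgroup (T2 ≃ₜ T2)} {Z : ℕ → Subgroup (T2 ≃ₜ T2)}
    (hgood : ∀ h ∈ H, red3 (mcg h) = 1) (hZ0 : ∀ x ∈ Z 0, x = 1)
    (hcomm : ∀ j, ∀ φ ∈ Z (j + 1), ∀ g ∈ H, g * φ * g⁻¹ * φ⁻¹ ∈ Z j)
    {L : Subgroup (T2 ≃ₜ T2)} {g : T2 ≃ₜ T2} (hgH : g ∈ H) (hg : g ∈ Subgroup.normalizer (L : Set (T2 ≃ₜ T2))) (j : ℕ) :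
    ∀ φ ∈ Z j, φ ∈ L → mcg φ = 1 → ∀ F d, IsLift φ F → IsDisp F d →
      ∀ Λ ∈ States, L ≤ stab Λ → rot (push g Λ) d = rot Λ d := by
  induction j with
  | zero =>
    intro φ hφ _ _ F d hF hd Λ hΛ _
    have := hZ0 φ hφ
    subst this
    obtain ⟨m, n, hmn⟩ := isLM_id.1.unique (f := id) hF
    have hd' : ∀ x, d x = ((m : ℝ), (n : ℝ)) := by
      intro x
      obtain ⟨p, rfl⟩ := surjective_torusProj x
      rw [hd, hmn]; simp
    have e1 : fstC d = (m : ℝ) • 1 := by ext x; simp [fstC, hd']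
    have e2 : sndC d = (n : ℝ) • 1 := by ext x; simp [sndC, hd']
    have hp := push_states (g := g) hΛ
    simp only [rot, e1, e2, hΛ.2.1, hp.2.1, hΛ.2.2.2, hp.2.2.2]
  | succ j ih =>
    intro φ hφ hφL hφ1 F d hF hd Λ hΛ hL
    obtain ⟨E, e, hE, he, hrel⟩ := conj_rel (g := g) hφ1 hF hd
    have hψZ := hcomm j φ hφ g hgH
    have hψL : g * φ * g⁻¹ * φ⁻¹ ∈ L :=
      L.mul_mem ((Subgroup.mem_normalizer_iff.1 hg φ).1 hφL) (L.inv_mem hφL)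
    have hψ1 : mcg (g * φ * g⁻¹ * φ⁻¹) = 1 := by simp [hφ1]
    have ih' := ih _ hψZ hψL hψ1 E e hE he
    have hS : ∀ n : ℤ, push (g ^ n) Λ ∈ States := fun n => push_states hΛ
    have hI : ∀ n : ℤ, L ≤ stab (push (g ^ n) Λ) := fun n =>
      stab_push (Subgroup.zpow_mem _ hg n) hL
    have hsucc : ∀ n : ℤ, push (g ^ (n + 1)) Λ = push g (push (g ^ n) Λ) := by
      intro n
      rw [← push_mul, ← zpow_one_add, add_comm]
    have he0 : ∀ n : ℤ, rot (push (g ^ n) Λ) e = rot Λ e := by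
      intro n
      have step : ∀ n : ℤ, rot (push (g ^ (n + 1)) Λ) e = rot (push (g ^ n) Λ) e := fun n => by
        rw [hsucc]; exact ih' _ (hS n) (hI n)
      apply Prod.ext
      · have := int_const (w := fun n : ℤ => (rot (push (g ^ n) Λ) e).1)
          (fun n => congrArg Prod.fst (step n)) n
        simpa [push_one] using this
      · have := int_const (w := fun n : ℤ => (rot (push (g ^ n) Λ) e).2)
          (fun n => congrArg Prod.snd (step n)) n
        simpa [push_one] using this
    have hrec : ∀ n : ℤ, rot (push (g ^ (n + 1)) Λ) d =
        mact (mcg g).1 (rot (push (g ^ n) Λ) d) - rot Λ e := by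
      intro n
      rw [← hrel _ (hS n) (hI n hφL) (by rw [← hsucc]; exact hI (n + 1) hφL), ← hsucc, he0]
      abel
    have := good_const (hgood g hgH) (u := fun n : ℤ => rot (push (g ^ n) Λ) d)
      (C := max ‖fstC d‖ ‖sndC d‖)
      (fun n => (state_bound (hS n) _).trans (le_max_left _ _))
      (fun n => (state_bound (hS n) _).trans (le_max_right _ _)) hrec 0
    simpa [push_one] using this

lemma core_step {H : Subgroup (T2 ≃ₜ T2)} {Z : ℕ → Subgroup (T2 ≃ₜ T2)}
    (hgood : ∀ h ∈ H, red3 (mcg h) = 1) (hZ0 : ∀ x ∈ Z 0, x = 1)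
    (hcomm : ∀ j, ∀ φ ∈ Z (j + 1), ∀ g ∈ H, g * φ * g⁻¹ * φ⁻¹ ∈ Z j)
    (hZH : ∀ j, Z j ≤ H) {c : ℕ} (hc : Z c = H) {φ : T2 ≃ₜ T2} (hφ : φ ∈ H) (hφ1 : mcg φ = 1)
    {F d} (hF : IsLift φ F) (hd : IsDisp F d) {Λ0} (h0 : Λ0 ∈ States) (hφ0 : push φ Λ0 = Λ0)
    (j : ℕ) : ∃ Λ ∈ States, Subgroup.zpowers φ ⊔ Z j ≤ stab Λ ∧ rot Λ d = rot Λ0 d := by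
  induction j with
  | zero =>
    refine ⟨Λ0, h0, sup_le ?_ ?_, rfl⟩
    · rw [Subgroup.zpowers_le]; exact hφ0
    · intro x hx
      rw [hZ0 x hx]; exact one_mem _
  | succ j ih =>
    set L := Subgroup.zpowers φ ⊔ Z j with hL
    have hφL : φ ∈ L := (le_sup_left : _ ≤ L) (Subgroup.mem_zpowers φ)
    have hZL : Z j ≤ L := le_sup_right
    have hLH : L ≤ H := sup_le (by rw [Subgroup.zpowers_le]; exact hφ) (hZH j)
    have aux : ∀ g ∈ Z (j + 1), ∀ l ∈ L, g * l * g⁻¹ ∈ L := by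
      intro g hg l hl
      have h1 := hcomm j g hg l (hLH hl)
      have h2 := L.mul_mem (L.inv_mem (hZL h1)) hl
      have : (l * g * l⁻¹ * g⁻¹)⁻¹ * l = g * l * g⁻¹ := by group
      rwa [this] at h2
    have hnorm : ∀ g ∈ Z (j + 1), g ∈ Subgroup.normalizer (L : Set (T2 ≃ₜ T2)) := by
      intro g hg
      rw [Subgroup.mem_normalizer_iff]
      intro l
      refine ⟨aux g hg l, fun h => ?_⟩
      have := aux g⁻¹ (inv_mem hg) _ h
      have e : g⁻¹ * (g * l * g⁻¹) * g⁻¹⁻¹ = l := by group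
      rwa [e] at this
    set K : Set (C(T2, ℝ) → ℝ) := {Λ ∈ States | L ≤ stab Λ ∧ rot Λ d = rot Λ0 d} with hK
    have hKne : K.Nonempty := by
      obtain ⟨Λ, h1, h2, h3⟩ := ih
      exact ⟨Λ, h1, h2, h3⟩
    have hKc : IsCompact K := by
      refine isCompact_states.inter_right (t := {Λ | L ≤ stab Λ ∧ rot Λ d = rot Λ0 d}) ?_
      have : {Λ : C(T2, ℝ) → ℝ | L ≤ stab Λ ∧ rot Λ d = rot Λ0 d} =
          (⋂ l ∈ L, {Λ | push l Λ = Λ}) ∩ {Λ | rot Λ d = rot Λ0 d} := by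
        ext Λ
        simp only [mem_inter_iff, mem_iInter, mem_setOf_eq]
        exact Iff.rfl
      rw [this]
      refine IsClosed.inter (isClosed_biInter fun l _ =>
        isClosed_eq (continuous_push _) continuous_id) (isClosed_eq ?_ continuous_const)
      unfold rot; fun_prop
    have hKv : Convex ℝ K := by
      rintro x ⟨x1, x2, x3⟩ y ⟨y1, y2, y3⟩ p q hp hq hpq
      refine ⟨convex_states x1 y1 hp hq hpq, fun l hl => ?_, ?_⟩
      · have e1 : push l x = x := x2 hl
        have e2 : push l y = y := y2 hl
        calc push l (p • x + q • y) = p • push l x + q • push l y := rfl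
          _ = _ := by rw [e1, e2]
      · calc rot (p • x + q • y) d = p • rot x d + q • rot y d := rfl
          _ = _ := by rw [x3, y3, ← add_smul, hpq, one_smul]
    have hφc : φ ∈ Z c := hc ▸ hφ
    obtain ⟨Λ, ⟨h1, h2, h3⟩, h4⟩ := markov_kakutani (K := K) (fun Λ h => h.1) hKc hKv hKne
      (Z (j + 1) : Set (T2 ≃ₜ T2))
      (by
        rintro g hg Λ ⟨h1, h2, h3⟩
        refine ⟨push_states h1, stab_push (hnorm g hg) h2, ?_⟩
        rw [key_inv hgood hZ0 hcomm (hZH _ hg) (hnorm g hg) c φ hφc hφL hφ1 F d hF hd Λ h1 h2, h3])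
      (by
        rintro g hg h hh Λ ⟨h1, h2, h3⟩
        have := hcomm j h⁻¹ (inv_mem hh) g⁻¹ (inv_mem (hZH _ hg))
        have t : push (g⁻¹ * h⁻¹ * g⁻¹⁻¹ * h⁻¹⁻¹) Λ = Λ := h2 (hZL this)
        rw [← push_mul, ← push_mul]
        have e : g * h = h * g * (g⁻¹ * h⁻¹ * g⁻¹⁻¹ * h⁻¹⁻¹) := by group
        rw [e, push_mul (h * g), t])
    exact ⟨Λ, h1, sup_le (le_sup_left.trans h2) (fun g hg => h4 g hg), h3⟩

lemma core {H : Subgroup (T2 ≃ₜ T2)} (hn : Group.IsNilpotent H)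
    (hgood : ∀ h ∈ H, red3 (mcg h) = 1) {φ : T2 ≃ₜ T2} (hφ : φ ∈ H) (hφ1 : mcg φ = 1)
    {F d} (hF : IsLift φ F) (hd : IsDisp F d) {Λ0} (h0 : Λ0 ∈ States) (hφ0 : push φ Λ0 = Λ0) :
    ∃ Λ ∈ States, (∀ h ∈ H, push h Λ = Λ) ∧ rot Λ d = rot Λ0 d := by
  obtain ⟨c, hc⟩ := hn.nilpotent
  have hcH : (Subgroup.upperCentralSeries H c).map H.subtype = H := by
    rw [hc, ← MonoidHom.range_eq_map, Subgroup.range_subtype]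
  obtain ⟨Λ, h1, h2, h3⟩ := core_step (H := H)
    (Z := fun j => (Subgroup.upperCentralSeries H j).map H.subtype) hgood
    (by simp) (by
      rintro j _ ⟨x, hx, rfl⟩ g hg
      have := (Subgroup.mem_upperCentralSeries_succ_iff.1 hx) ⟨g, hg⟩
      refine ⟨⟨g, hg⟩ * x * ⟨g, hg⟩⁻¹ * x⁻¹, ?_, rfl⟩
      have e := inv_mem this
      simp only [commutatorElement_def] at e
      have e2 : (x * ⟨g, hg⟩ * x⁻¹ * ⟨g, hg⟩⁻¹)⁻¹ = (⟨g, hg⟩ * x * ⟨g, hg⟩⁻¹ * x⁻¹ : H) := by group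
      rw [← e2]; exact e)
    (by rintro j _ ⟨x, hx, rfl⟩; exact x.2) hcH hφ hφ1 hF hd h0 hφ0 c
  refine ⟨Λ, h1, fun h hh => ?_, h3⟩
  exact h2 (le_sup_right (a := Subgroup.zpowers φ) (by rw [hcH]; exact hh))


/-- functional of a measure -/
noncomputable def mst (μ : Measure T2) : C(T2, ℝ) → ℝ := fun f => ∫ x, f x ∂μ

lemma integrable_cont {E : Type*} [NormedAddCommGroup E] [SecondCountableTopology E]
    (μ : Measure T2) [IsFiniteMeasure μ] (f : C(T2, E)) : Integrable f μ :=
  f.continuous.integrable_of_hasCompactSupport (HasCompactSupport.of_compactSpace f)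

lemma mst_states (μ : Measure T2) [IsProbabilityMeasure μ] : mst μ ∈ States := by
  refine ⟨fun f g => integral_add (integrable_cont μ f) (integrable_cont μ g),
    fun c f => integral_const_mul c _, fun f hf => integral_nonneg hf, ?_⟩
  simp [mst]

lemma mst_push_iff (μ : Measure T2) [IsProbabilityMeasure μ] (g : T2 ≃ₜ T2) :
    MeasurePreserving g μ μ ↔ push g (mst μ) = mst μ := by
  have hm : Measurable g := g.continuous.measurable
  have key : ∀ f : C(T2, ℝ), ∫ x, f x ∂(μ.map g) = push g (mst μ) f := fun f =>
    integral_map hm.aemeasurable f.continuous.aestronglyMeasurable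
  constructor
  · intro h
    funext f
    rw [← key, h.map_eq]; rfl
  · intro h
    refine ⟨hm, ?_⟩
    have : IsProbabilityMeasure (μ.map g) := Measure.isProbabilityMeasure_map hm.aemeasurable
    apply ext_of_forall_integral_eq_of_IsFiniteMeasure
    intro f
    exact (key f.toContinuousMap).trans (congrFun h f.toContinuousMap)

lemma exists_meas {Λ} (h : Λ ∈ States) : ∃ μ : Measure T2, IsProbabilityMeasure μ ∧ mst μ = Λ := by
  set ΛL : CompactlySupportedContinuousMap T2 ℝ →ₗ[ℝ] ℝ :=
    { toFun := fun f => Λ f.toContinuousMap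
      map_add' := fun f g => h.1 f.toContinuousMap g.toContinuousMap
      map_smul' := fun c f => h.2.1 c f.toContinuousMap } with hΛL
  set P : CompactlySupportedContinuousMap T2 ℝ →ₚ[ℝ] ℝ :=
    PositiveLinearMap.mk₀ ΛL (fun f hf => h.2.2.1 f.toContinuousMap (fun x => hf x)) with hP
  have key : ∀ f : C(T2, ℝ), ∫ x, f x ∂(RealRMK.rieszMeasure P) = Λ f := fun f =>
    RealRMK.integral_rieszMeasure P (CompactlySupportedContinuousMap.continuousMapEquiv f)
  refine ⟨RealRMK.rieszMeasure P, ⟨?_⟩, funext key⟩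
  have h1 := key 1
  rw [h.2.2.2] at h1
  simp [Measure.real] at h1
  exact (ENNReal.toReal_eq_one_iff _).1 h1

lemma disp_unique {F d e} (hd : IsDisp F d) (he : IsDisp F e) : d = e := by
  ext1 x
  obtain ⟨p, rfl⟩ := surjective_torusProj x
  rw [hd, he]

lemma hasRot_iff {F d} (hd : IsDisp F d) (μ : Measure T2) [IsProbabilityMeasure μ] (v : ℝ × ℝ) :
    HasRotVec F μ v ↔ rot (mst μ) d = v := by
  have e : ∫ x, d x ∂μ = rot (mst μ) d :=
    Prod.ext (fst_integral (integrable_cont μ d)) (snd_integral (integrable_cont μ d))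
  constructor
  · rintro ⟨g, hg, rfl⟩
    rw [disp_unique hg hd, e]
  · intro h
    exact ⟨d, hd, e.trans h⟩

lemma rot_sets {H : Subgroup (T2 ≃ₜ T2)} (hn : Group.IsNilpotent H)
    (hgood : ∀ h ∈ H, red3 (mcg h) = 1) {φ : T2 ≃ₜ T2} (hφ : φ ∈ H) (hφ1 : mcg φ = 1)
    {F} (hF : IsLift φ F) :
        {v : ℝ × ℝ | ∃ μ : Measure T2, IsProbabilityMeasure μ ∧
            MeasurePreserving (⇑φ) μ μ ∧ HasRotVec F μ v} =
        {v : ℝ × ℝ | ∃ ν : Measure T2, IsProbabilityMeasure ν ∧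
            (∀ h ∈ H, MeasurePreserving (⇑h) ν ν) ∧ HasRotVec F ν v} := by
  obtain ⟨d, hd⟩ := exists_disp (lift_of_triv hφ1 hF)
  ext v
  constructor
  · rintro ⟨μ, hμ, h1, h2⟩
    rw [mst_push_iff] at h1
    rw [hasRot_iff hd] at h2
    obtain ⟨Λ, k1, k2, k3⟩ := core hn hgood hφ hφ1 hF hd (mst_states μ) h1
    obtain ⟨ν, hν, rfl⟩ := exists_meas k1
    refine ⟨ν, hν, fun h hh => ?_, ?_⟩
    · rw [mst_push_iff]; exact k2 h hh
    · rw [hasRot_iff hd, k3, h2]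
  · rintro ⟨ν, hν, h1, h2⟩
    exact ⟨ν, hν, h1 φ hφ, h2⟩

lemma irr_eq {H : Subgroup (T2 ≃ₜ T2)} (hn : Group.IsNilpotent H)
    (hgood : ∀ h ∈ H, red3 (mcg h) = 1) {φ : T2 ≃ₜ T2} (hφ : φ ∈ H) :
    IsIrrotational φ ↔ IsIrrotationalFor φ (H : Set (T2 ≃ₜ T2)) := by
  constructor
  · rintro ⟨h1, F, hF, h2⟩
    exact ⟨h1, F, hF, fun μ hμ h => h2 μ hμ (h φ hφ)⟩
  · rintro ⟨h1, F, hF, h2⟩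
    refine ⟨h1, F, hF, fun μ hμ h => ?_⟩
    have hφ1 := mcg_isotopic h1
    obtain ⟨d, hd⟩ := exists_disp (lift_of_triv hφ1 hF)
    have hm : rot (mst μ) d ∈ {v : ℝ × ℝ | ∃ μ : Measure T2, IsProbabilityMeasure μ ∧
            MeasurePreserving (⇑φ) μ μ ∧ HasRotVec F μ v} :=
      ⟨μ, hμ, h, (hasRot_iff hd μ _).2 rfl⟩
    rw [rot_sets hn hgood hφ hφ1 hF] at hm
    obtain ⟨ν, hν, k1, k2⟩ := hm
    have k3 := h2 ν hν k1
    rw [hasRot_iff hd] at k2 k3 ⊢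
    rw [← k2, k3]

lemma irrFor_iff {φ : T2 ≃ₜ T2} {S : Set (T2 ≃ₜ T2)} : IsIrrotationalFor φ S ↔
    IsotopicToId (⇑φ) ∧ ∃ F d, IsLift φ F ∧ IsDisp F d ∧
      ∀ Λ ∈ States, (∀ ψ ∈ S, push ψ Λ = Λ) → rot Λ d = (0, 0) := by
  refine and_congr_right fun hi => ?_
  constructor
  · rintro ⟨F, hF, h⟩
    obtain ⟨d, hd⟩ := exists_disp (lift_of_triv (mcg_isotopic hi) hF)
    refine ⟨F, d, hF, hd, fun Λ hΛ hS => ?_⟩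
    obtain ⟨μ, hμ, rfl⟩ := exists_meas hΛ
    exact (hasRot_iff hd μ _).1 (h μ hμ fun ψ hψ => (mst_push_iff μ ψ).2 (hS ψ hψ))
  · rintro ⟨F, d, hF, hd, h⟩
    refine ⟨F, hF, fun μ hμ hS => ?_⟩
    exact (hasRot_iff hd μ _).2 (h _ (mst_states μ) fun ψ hψ => (mst_push_iff μ ψ).1 (hS ψ hψ))

lemma irr_iff {φ : T2 ≃ₜ T2} : IsIrrotational φ ↔ IsIrrotationalFor φ {φ} := by
  simp [IsIrrotational, IsIrrotationalFor]

lemma isot_one : IsotopicToId (⇑(1 : T2 ≃ₜ T2)) :=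
  ⟨fun _ => id, continuous_snd, fun _ => (Homeomorph.refl T2).isHomeomorph, rfl, rfl, by simp⟩

lemma isot_mul {a b : T2 ≃ₜ T2} (ha : IsotopicToId a) (hb : IsotopicToId b) :
    IsotopicToId (⇑(a * b)) := by
  obtain ⟨A, a1, a2, a3, a4, -⟩ := ha
  obtain ⟨B, b1, b2, b3, b4, -⟩ := hb
  refine ⟨fun t => A t ∘ B t, ?_, fun t => (a2 t).comp (b2 t), ?_, ?_, by simp⟩
  · exact a1.comp (continuous_fst.prodMk b1)
  · simp [a3, b3]
  · simp only [a4, b4]; rfl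

lemma isot_inv {a : T2 ≃ₜ T2} (ha : IsotopicToId a) : IsotopicToId (⇑(a⁻¹)) := by
  obtain ⟨A, a1, a2, a3, a4, -⟩ := ha
  refine ⟨fun t => A (1 - t) ∘ (a⁻¹ : T2 ≃ₜ T2), ?_,
    fun t => (a2 _).comp (a⁻¹ : T2 ≃ₜ T2).isHomeomorph, ?_, ?_, by simp⟩
  · exact a1.comp (((continuous_const.sub continuous_fst)).prodMk
      ((a⁻¹ : T2 ≃ₜ T2).continuous.comp continuous_snd))
  · simp only [sub_zero, a4]
    exact congrArg DFunLike.coe (mul_inv_cancel a)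
  · simp [a3]

lemma isot_conj {a g : T2 ≃ₜ T2} (ha : IsotopicToId a) : IsotopicToId (⇑(g * a * g⁻¹)) := by
  obtain ⟨A, a1, a2, a3, a4, -⟩ := ha
  refine ⟨fun t => g ∘ A t ∘ (g⁻¹ : T2 ≃ₜ T2), ?_,
    fun t => g.isHomeomorph.comp ((a2 _).comp (g⁻¹ : T2 ≃ₜ T2).isHomeomorph), ?_, ?_, by simp⟩
  · exact g.continuous.comp (a1.comp (continuous_fst.prodMk
      ((g⁻¹ : T2 ≃ₜ T2).continuous.comp continuous_snd)))
  · simp only [a3]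
    exact congrArg DFunLike.coe (mul_inv_cancel g)
  · simp only [a4]; rfl

lemma irr_one : IsIrrotational 1 := by
  refine ⟨isot_one, id, isLM_id.1, fun μ hμ _ => ⟨0, fun p => by simp, by simp; rfl⟩⟩

lemma rot_zero_add {Λ : C(T2, ℝ) → ℝ} (h : Λ ∈ States) {d e : C(T2, ℝ × ℝ)} :
    rot Λ (d + e) = rot Λ d + rot Λ e :=
  Prod.ext (h.1 (fstC d) (fstC e)) (h.1 (sndC d) (sndC e))

lemma irrFor_mul {H : Subgroup (T2 ≃ₜ T2)} {a b : T2 ≃ₜ T2} (hbH : b ∈ H)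
    (ha : IsIrrotationalFor a H) (hb : IsIrrotationalFor b H) : IsIrrotationalFor (a * b) H := by
  rw [irrFor_iff] at *
  obtain ⟨ia, A, d, hA, hd, h1⟩ := ha
  obtain ⟨ib, B, e, hB, he, h2⟩ := hb
  refine ⟨isot_mul ia ib, A ∘ B, d.comp (b : C(T2, T2)) + e,
    ⟨hA.1.comp hB.1, fun p => by simp only [Function.comp, hA.2, hB.2]; rfl⟩, ?_, ?_⟩
  · intro p
    change d (b (torusProj p)) + e (torusProj p) = A (B p) - p
    rw [← hB.2, hd, he]; abel
  · intro Λ hΛ hS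
    rw [rot_zero_add hΛ, h2 Λ hΛ hS]
    have : rot Λ (d.comp (b : C(T2, T2))) = rot (push b Λ) d := rfl
    rw [this, hS b hbH, h1 Λ hΛ hS]; simp

lemma irrFor_inv {H : Subgroup (T2 ≃ₜ T2)} {a : T2 ≃ₜ T2} (haH : a ∈ H)
    (ha : IsIrrotationalFor a H) : IsIrrotationalFor a⁻¹ H := by
  rw [irrFor_iff] at *
  obtain ⟨ia, A, d, hA, hd, h1⟩ := ha
  obtain ⟨B0, hB0⟩ := mcg_exists a⁻¹
  have l1 : IsLift id (fun p => B0 (A p)) := ⟨hB0.1.1.comp hA.1, fun p => by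
    rw [hB0.1.2, hA.2]
    exact congrArg (fun f : T2 ≃ₜ T2 => f (torusProj p)) (inv_mul_cancel a)⟩
  obtain ⟨m, n, hmn⟩ := l1.unique isLM_id.1
  have hB := (hB0.add_int m n).1
  set B := fun p => B0 p + ((m : ℝ), (n : ℝ)) with hBd
  have hBA : ∀ p, B (A p) = p := fun p => (hmn p).symm
  obtain ⟨e, he⟩ := exists_disp (lift_of_triv (mcg_isotopic (isot_inv ia)) hB)
  refine ⟨isot_inv ia, B, e, hB, he, ?_⟩
  intro Λ hΛ hS
  have point : e.comp (a : C(T2, T2)) + d = 0 := by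
    ext1 x
    obtain ⟨p, rfl⟩ := surjective_torusProj x
    change e (a (torusProj p)) + d (torusProj p) = 0
    rw [← hA.2, he, hd, hBA]; abel
  have h2 : rot Λ (e.comp (a : C(T2, T2)) + d) = rot (push a Λ) e + rot Λ d := rot_zero_add hΛ
  rw [hS a haH, h1 Λ hΛ hS, point] at h2
  have h3 : rot Λ 0 = 0 := by
    have := rot_zero_add hΛ (d := 0) (e := 0)
    simpa using this
  rw [h3] at h2
  rw [← Prod.zero_eq_mk, h2, ← Prod.zero_eq_mk, add_zero]

lemma irr_conj {a g : T2 ≃ₜ T2} (ha : IsIrrotational a) : IsIrrotational (g * a * g⁻¹) := by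
  rw [irr_iff, irrFor_iff] at *
  obtain ⟨ia, A, d, hA, hd, h1⟩ := ha
  obtain ⟨E, e, hE, he, h2⟩ := conj_rel2 (g := g) (mcg_isotopic ia) hA hd
  refine ⟨isot_conj ia, E, e, hE, he, ?_⟩
  intro Λ hΛ hS
  have hs := hS _ rfl
  have hs' : push a (push g⁻¹ Λ) = push g⁻¹ Λ := by
    conv_rhs => rw [← hs]
    rw [← push_mul, ← push_mul]
    congr 1; group
  have h3 := h2 _ (push_states (g := g⁻¹) hΛ) hs'
  rw [← push_mul, mul_inv_cancel, push_one] at h3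
  rw [h3, h1 _ (push_states hΛ) (by simpa using hs')]
  simp [mact]



end helpers

/-- **Proposition (bigsma3).** Let `G` be a nilpotent subgroup of `Homeo(T²)`.
There is a normal subgroup `H` of `G` of index 1, 2, 3, 4, 6 or 8 containing `G₀`
such that for every `φ ∈ G₀` and every lift `φ̃` the sets of rotation vectors with
respect to `P(φ)` and to `P(H)` coincide. In particular `I_G = I_H = H_I`, and
`I_G` is a normal subgroup of `G`. -/
theorem stmt_9
    (G : Subgroup (T2 ≃ₜ T2))
    (hnilp : Group.IsNilpotent G) :
    (∃ H : Subgroup (T2 ≃ₜ T2), H ≤ G ∧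
      (∀ ψ ∈ G, IsotopicToId (⇑ψ) → ψ ∈ H) ∧
      (∀ g ∈ G, ∀ h ∈ H, g * h * g⁻¹ ∈ H) ∧
      (H.subgroupOf G).index ∈ ({1, 2, 3, 4, 6, 8} : Set ℕ) ∧
      (∀ φ ∈ G, IsotopicToId (⇑φ) → ∀ F, IsLift (⇑φ) F →
        {v : ℝ × ℝ | ∃ μ : Measure T2, IsProbabilityMeasure μ ∧
            MeasurePreserving (⇑φ) μ μ ∧ HasRotVec F μ v} =
        {v : ℝ × ℝ | ∃ ν : Measure T2, IsProbabilityMeasure ν ∧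
            (∀ h ∈ H, MeasurePreserving (⇑h) ν ν) ∧ HasRotVec F ν v}) ∧
      {ψ : T2 ≃ₜ T2 | ψ ∈ G ∧ IsIrrotational ψ} =
        {ψ : T2 ≃ₜ T2 | ψ ∈ H ∧ IsIrrotational ψ} ∧
      {ψ : T2 ≃ₜ T2 | ψ ∈ H ∧ IsIrrotational ψ} =
        {ψ : T2 ≃ₜ T2 | ψ ∈ H ∧ IsIrrotationalFor ψ (H : Set (T2 ≃ₜ T2))}) ∧
    (∃ N : Subgroup (T2 ≃ₜ T2),
      (N : Set (T2 ≃ₜ T2)) = {ψ : T2 ≃ₜ T2 | ψ ∈ G ∧ IsIrrotational ψ} ∧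
      ∀ g ∈ G, ∀ n ∈ N, g * n * g⁻¹ ∈ N) := by
  set H : Subgroup (T2 ≃ₜ T2) := G ⊓ (red3.comp mcg).ker with hH
  have hHG : H ≤ G := inf_le_left
  have hgood : ∀ h ∈ H, red3 (mcg h) = 1 := fun h hh => hh.2
  have hin : ∀ ψ ∈ G, IsotopicToId (⇑ψ) → ψ ∈ H := by
    intro ψ hψ hi
    refine ⟨hψ, ?_⟩
    change red3 (mcg ψ) = 1
    rw [mcg_isotopic hi, map_one]
  have hn : Group.IsNilpotent H :=
    Subgroup.isNilpotent_of_ker_le_center (Subgroup.inclusion hHG)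
      (by rw [(MonoidHom.ker_eq_bot_iff _).2 (Subgroup.inclusion_injective hHG)]; exact bot_le)
  refine ⟨⟨H, hHG, hin, ?_, ?_, ?_, ?_, ?_⟩, ?_⟩
  · intro g hg h hh
    refine ⟨G.mul_mem (G.mul_mem hg hh.1) (G.inv_mem hg), ?_⟩
    exact (MonoidHom.normal_ker (red3.comp mcg)).conj_mem h hh.2 g
  · have : H.subgroupOf G = (red3.comp (mcg.comp G.subtype)).ker := by
      ext x
      simp [hH, Subgroup.mem_subgroupOf, MonoidHom.mem_ker]
    rw [this]
    exact index_lemma _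
  · intro φ hφ hi F hF
    exact rot_sets hn hgood (hin φ hφ hi) (mcg_isotopic hi) hF
  · ext ψ
    exact ⟨fun h => ⟨hin ψ h.1 h.2.1, h.2⟩, fun h => ⟨hHG h.1, h.2⟩⟩
  · ext ψ
    exact ⟨fun h => ⟨h.1, (irr_eq hn hgood h.1).1 h.2⟩, fun h => ⟨h.1, (irr_eq hn hgood h.1).2 h.2⟩⟩
  · refine ⟨{ carrier := {ψ : T2 ≃ₜ T2 | ψ ∈ G ∧ IsIrrotational ψ}
              one_mem' := ⟨one_mem _, irr_one⟩
              mul_mem' := ?_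
              inv_mem' := ?_ }, rfl, ?_⟩
    · rintro a b ⟨ha, ia⟩ ⟨hb, ib⟩
      have ha' := hin a ha ia.1
      have hb' := hin b hb ib.1
      exact ⟨G.mul_mem ha hb, (irr_eq hn hgood (H.mul_mem ha' hb')).2
        (irrFor_mul hb' ((irr_eq hn hgood ha').1 ia) ((irr_eq hn hgood hb').1 ib))⟩
    · rintro a ⟨ha, ia⟩
      have ha' := hin a ha ia.1
      exact ⟨G.inv_mem ha, (irr_eq hn hgood (H.inv_mem ha')).2
        (irrFor_inv ha' ((irr_eq hn hgood ha').1 ia))⟩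
    · rintro g hg n ⟨hn1, hn2⟩
      exact ⟨G.mul_mem (G.mul_mem hg hn1) (G.inv_mem hg), irr_conj hn2⟩
end
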